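/- Let ρ : Q → ℝ be a Lipschitz continuous function on the unit square Q = [0,1]² with ρ(x) ≥ a for some constant a > 0 and ∫_Q ρ(x) dx = 1, and let μ be the probability measure on Q with density ρ. For each N, let x_1,…,x_N and y_1,…,y_N be 2N points sampled independently with distribution μ, with empirical measures X^N = (1/N) Σ_{i=1}^N δ_{x_i} and Y^N = (1/N) Σ_{i=1}^N δ_{y_i}. Then limsup_{N→∞} (2πN / log N) · E_μ[W₂²(X^N, Y^N)] ≤ 1. -/

import Mathlib

open MeasureTheory Filter
open scoped ENNReal NNReal Topology

noncomputable section

/-- The plane, with the Euclidean norm. -/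
abbrev E2 : Type := EuclideanSpace ℝ (Fin 2)

/-- The unit square `Q = [0,1]²`. -/
def unitSq : Set E2 := {x | ∀ i, x i ∈ Set.Icc (0 : ℝ) 1}

/-- The squared 2-Wasserstein distance `W₂²(ν₁, ν₂)`: the infimum of
`∫ |x − y|² dJ` over all couplings `J` of `ν₁` and `ν₂`. -/
def W2sq (ν₁ ν₂ : Measure E2) : ℝ :=
  sInf {c | ∃ J : Measure (E2 × E2), IsProbabilityMeasure J ∧
    J.map Prod.fst = ν₁ ∧ J.map Prod.snd = ν₂ ∧
    c = ∫ p, ‖p.1 - p.2‖ ^ 2 ∂J}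

/-- The empirical measure `X^N = (1/N) Σ_{i=1}^N δ_{x_i}`. -/
def empMeas {N : ℕ} (x : Fin N → E2) : Measure E2 :=
  (N : ℝ≥0∞)⁻¹ • ∑ i, Measure.dirac (x i)

/-! ### Hopf–Lax operator -/

/-- Hopf–Lax operator. -/
def HL (T : ℝ) (φ : E2 → ℝ) (y : E2) : ℝ := ⨅ x, (φ x + ‖x - y‖ ^ 2 / (2 * T))

theorem HL_bdd {L : ℝ≥0} {φ : E2 → ℝ} (hφ : LipschitzWith L φ) {T : ℝ} (hT : 0 < T) (y : E2) :
    BddBelow (Set.range fun x => φ x + ‖x - y‖ ^ 2 / (2 * T)) := by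
  refine ⟨φ y - L ^ 2 * T / 2, ?_⟩
  rintro _ ⟨x, rfl⟩
  have h1 : φ y - φ x ≤ L * ‖x - y‖ := by
    have := hφ.dist_le_mul y x
    rw [Real.dist_eq, dist_comm, dist_eq_norm] at this
    exact (le_abs_self _).trans this
  have h2 : L * ‖x - y‖ ≤ ‖x - y‖ ^ 2 / (2 * T) + L ^ 2 * T / 2 := by
    have : ‖x - y‖ ^ 2 / (2 * T) + L ^ 2 * T / 2 - L * ‖x - y‖ = (‖x - y‖ - L * T) ^ 2 / (2 * T) := by
      field_simp; ring
    have h3 : 0 ≤ (‖x - y‖ - L * T) ^ 2 / (2 * T) := by positivity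
    linarith
  simp only
  linarith

theorem HL_le {L : ℝ≥0} {φ : E2 → ℝ} (hφ : LipschitzWith L φ) {T : ℝ} (hT : 0 < T) (x y : E2) :
    HL T φ y ≤ φ x + ‖x - y‖ ^ 2 / (2 * T) :=
  ciInf_le (HL_bdd hφ hT y) x

theorem le_HL {φ : E2 → ℝ} {T c : ℝ} {y : E2} (h : ∀ x, c ≤ φ x + ‖x - y‖ ^ 2 / (2 * T)) :
    c ≤ HL T φ y := le_ciInf h

theorem HL_lip {L : ℝ≥0} {φ : E2 → ℝ} (hφ : LipschitzWith L φ) {T : ℝ} (hT : 0 < T) :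
    LipschitzWith L (HL T φ) := by
  refine LipschitzWith.of_le_add_mul L fun y y' => ?_
  have : HL T φ y - L * dist y y' ≤ HL T φ y' := by
    apply le_HL
    intro x
    have h1 := HL_le hφ hT (x + (y - y')) y
    have h2 : φ (x + (y - y')) - φ x ≤ L * dist y y' := by
      have := hφ.dist_le_mul (x + (y - y')) x
      rw [Real.dist_eq, dist_eq_norm, add_sub_cancel_left, ← dist_eq_norm] at this
      exact (le_abs_self _).trans this
    have h3 : x + (y - y') - y = x - y' := by abel
    rw [h3] at h1
    linarith
  linarith

theorem sq_split (u v : E2) {S T : ℝ} (hS : 0 < S) (hT : 0 < T) :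
    ‖u + v‖ ^ 2 / (2 * (S + T)) ≤ ‖u‖ ^ 2 / (2 * S) + ‖v‖ ^ 2 / (2 * T) := by
  have h0 : ‖u + v‖ ^ 2 ≤ (‖u‖ + ‖v‖) ^ 2 := by
    gcongr; exact norm_add_le u v
  have h1 : ‖u‖ ^ 2 / (2 * S) + ‖v‖ ^ 2 / (2 * T) - (‖u‖ + ‖v‖) ^ 2 / (2 * (S + T))
      = (T * ‖u‖ - S * ‖v‖) ^ 2 / (2 * S * T * (S + T)) := by
    have : S + T ≠ 0 := by positivity
    field_simp; ring
  have h2 : 0 ≤ (T * ‖u‖ - S * ‖v‖) ^ 2 / (2 * S * T * (S + T)) := by positivity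
  have h3 : ‖u + v‖ ^ 2 / (2 * (S + T)) ≤ (‖u‖ + ‖v‖) ^ 2 / (2 * (S + T)) := by gcongr
  linarith

theorem HL_semigroup {L : ℝ≥0} {φ : E2 → ℝ} (hφ : LipschitzWith L φ) {S T : ℝ} (hS : 0 < S)
    (hT : 0 < T) (y : E2) : HL (S + T) φ y ≤ HL T (HL S φ) y := by
  apply le_HL
  intro z
  have : HL (S + T) φ y - ‖z - y‖ ^ 2 / (2 * T) ≤ HL S φ z := by
    apply le_HL
    intro x
    have h1 := HL_le hφ (add_pos hS hT) x y
    have h2 := sq_split (x - z) (z - y) hS hT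
    rw [sub_add_sub_cancel] at h2
    linarith
  linarith

theorem HL_neg {L : ℝ≥0} {φ : E2 → ℝ} (hφ : LipschitzWith L φ) {T : ℝ} (hT : 0 < T) (x : E2) :
    -φ x ≤ HL T (fun y => -HL T φ y) x := by
  apply le_HL
  intro y
  have h1 := HL_le hφ hT x y
  rw [norm_sub_rev] at h1
  linarith

/-- Transport cost bound in dual form between two functionals. -/
def TC (T : ℝ) (ℓ₀ ℓ₁ : (E2 → ℝ) → ℝ) (C : ℝ) : Prop :=
  ∀ (L : ℝ≥0) (φ : E2 → ℝ), LipschitzWith L φ → ℓ₁ (HL T φ) - ℓ₀ φ ≤ C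

/-- Monotone and odd on Lipschitz functions. -/
def Good (ℓ : (E2 → ℝ) → ℝ) : Prop :=
  (∀ (L : ℝ≥0) (φ ψ : E2 → ℝ), LipschitzWith L φ → LipschitzWith L ψ → (∀ x, φ x ≤ ψ x) →
    ℓ φ ≤ ℓ ψ) ∧ ∀ φ, ℓ (fun x => -φ x) = -ℓ φ

theorem TC_trans {S T : ℝ} (hS : 0 < S) (hT : 0 < T) {ℓ₀ ℓ₁ ℓ₂ : (E2 → ℝ) → ℝ} {C D : ℝ}
    (h2 : Good ℓ₂) (h : TC S ℓ₀ ℓ₁ C) (h' : TC T ℓ₁ ℓ₂ D) : TC (S + T) ℓ₀ ℓ₂ (C + D) := by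
  intro L φ hφ
  have a1 := h L φ hφ
  have a2 := h' L (HL S φ) (HL_lip hφ hS)
  have a3 := h2.1 L _ _ (HL_lip hφ (add_pos hS hT)) (HL_lip (HL_lip hφ hS) hT)
    (HL_semigroup hφ hS hT)
  linarith

theorem TC_symm {T : ℝ} (hT : 0 < T) {ℓ₀ ℓ₁ : (E2 → ℝ) → ℝ} {C : ℝ}
    (h0 : Good ℓ₀) (h1 : Good ℓ₁) (h : TC T ℓ₀ ℓ₁ C) : TC T ℓ₁ ℓ₀ C := by
  intro L φ hφ
  have hl : LipschitzWith L (fun y => -HL T φ y) := (HL_lip hφ hT).neg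
  have a1 := h L _ hl
  have a2 := h1.1 L _ _ hφ.neg (HL_lip hl hT) (HL_neg hφ hT)
  have a3 := h1.2 φ
  have a4 := h0.2 (HL T φ)
  change ℓ₁ (fun x => -φ x) ≤ _ at a2
  linarith

/-! ### Finite Kantorovich duality -/

/-- Coordinatewise projection onto the unit square. -/
def clampSq (x : E2) : E2 := WithLp.toLp 2 (fun i => max 0 (min 1 (x i)))

theorem clampSq_mem (x : E2) : clampSq x ∈ unitSq := by
  intro i
  simp [clampSq]

theorem clampSq_eq {x : E2} (hx : x ∈ unitSq) : clampSq x = x := by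
  ext i
  have := hx i
  simp [clampSq, this.1, this.2]

theorem clampSq_norm (x y : E2) : ‖clampSq x - clampSq y‖ ≤ ‖x - y‖ := by
  rw [EuclideanSpace.norm_eq, EuclideanSpace.norm_eq]
  apply Real.sqrt_le_sqrt
  apply Finset.sum_le_sum
  intro i _
  simp only [clampSq, PiLp.sub_apply, Real.norm_eq_abs]
  refine pow_le_pow_left₀ (abs_nonneg _) ?_ 2
  have h1 := abs_max_sub_max_le_abs (min 1 (x i)) (min 1 (y i)) 0
  have h2 := abs_min_sub_min_le_max 1 (x i) 1 (y i)
  simp only [sub_self, abs_zero] at h2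
  rw [max_comm 0, max_comm 0]
  refine h1.trans (h2.trans ?_)
  simp

theorem sq_diam {x y : E2} (hx : x ∈ unitSq) (hy : y ∈ unitSq) : ‖x - y‖ ^ 2 ≤ 2 := by
  rw [EuclideanSpace.norm_sq_eq]
  simp only [Fin.sum_univ_two, PiLp.sub_apply, Real.norm_eq_abs, sq_abs]
  have := hx 0; have := hx 1; have := hy 0; have := hy 1
  simp only [Set.mem_Icc] at *
  nlinarith

theorem sq_diam' {x y : E2} (hx : x ∈ unitSq) (hy : y ∈ unitSq) : ‖x - y‖ ≤ 2 := by
  have := sq_diam hx hy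
  nlinarith [norm_nonneg (x - y)]

theorem W2sq_le_plan {N : ℕ} (x y : Fin N → E2)
    (J : Fin N × Fin N → ℝ) (hJ : ∀ p, 0 ≤ J p) (hs : ∑ p, J p = 1)
    (h1 : ∀ i, ∑ j, J (i, j) = (N : ℝ)⁻¹) (h2 : ∀ j, ∑ i, J (i, j) = (N : ℝ)⁻¹) :
    W2sq (empMeas x) (empMeas y) ≤ ∑ p, J p * ‖x p.1 - y p.2‖ ^ 2 := by
  have hN : 0 < N := by
    rcases Nat.eq_zero_or_pos N with h | h
    · subst h; simp at hs
    · exact h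
  have hNinv : (N : ℝ≥0∞)⁻¹ = ENNReal.ofReal ((N : ℝ)⁻¹) := by
    rw [ENNReal.ofReal_inv_of_pos (by positivity)]; simp
  apply csInf_le
  · refine ⟨0, ?_⟩
    rintro c ⟨J, -, -, -, rfl⟩
    positivity
  · refine ⟨∑ p, ENNReal.ofReal (J p) • Measure.dirac (x p.1, y p.2), ?_, ?_, ?_, ?_⟩
    · constructor
      simp only [Measure.coe_finsetSum, Finset.sum_apply, Measure.smul_apply, measure_univ,
        smul_eq_mul, mul_one]
      rw [← ENNReal.ofReal_sum_of_nonneg (fun p _ => hJ p), hs, ENNReal.ofReal_one]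
    · rw [Measure.map_finset_sum measurable_fst.aemeasurable]
      simp only [Measure.map_smul, Measure.map_dirac' measurable_fst]
      rw [Fintype.sum_prod_type, empMeas, Finset.smul_sum]
      refine Finset.sum_congr rfl fun i _ => ?_
      simp only
      rw [← Finset.sum_smul, ← ENNReal.ofReal_sum_of_nonneg (fun p _ => hJ _), h1, hNinv]
    · rw [Measure.map_finset_sum measurable_snd.aemeasurable]
      simp only [Measure.map_smul, Measure.map_dirac' measurable_snd]
      rw [Fintype.sum_prod_type_right, empMeas, Finset.smul_sum]
      refine Finset.sum_congr rfl fun i _ => ?_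
      simp only
      rw [← Finset.sum_smul, ← ENNReal.ofReal_sum_of_nonneg (fun p _ => hJ _), h2, hNinv]
    · rw [integral_finsetSum_measure]
      · refine Finset.sum_congr rfl fun p _ => ?_
        rw [integral_smul_measure, integral_dirac, ENNReal.toReal_ofReal (hJ p), smul_eq_mul]
      · intro p _
        apply Integrable.smul_measure _ ENNReal.ofReal_ne_top
        exact integrable_dirac (by simp)

theorem dual_potentials {N : ℕ} (hN : 0 < N) (x y : Fin N → E2) {δ : ℝ} (hδ : 0 < δ) :
    ∃ f g : Fin N → ℝ, (∀ i j, g j - f i ≤ ‖x i - y j‖ ^ 2 / 2) ∧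
      W2sq (empMeas x) (empMeas y) / 2 ≤
        (N : ℝ)⁻¹ * ∑ j, g j - (N : ℝ)⁻¹ * ∑ i, f i + δ := by
  set w := W2sq (empMeas x) (empMeas y) with hw
  have hNr : (0 : ℝ) < N := by exact_mod_cast hN
  let Λ : (Fin N × Fin N → ℝ) →ₗ[ℝ] (Fin N → ℝ) × (Fin N → ℝ) × ℝ :=
    { toFun := fun J => (fun i => ∑ j, J (i, j), fun j => ∑ i, J (i, j),
        ∑ p, J p * (‖x p.1 - y p.2‖ ^ 2 / 2))
      map_add' := by
        intro a b
        ext <;> simp [Finset.sum_add_distrib, add_mul]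
      map_smul' := by
        intro r a
        ext <;> simp [Finset.mul_sum, mul_assoc] }
  have hΛ : Continuous Λ := LinearMap.continuous_of_finiteDimensional Λ
  set A := Λ '' stdSimplex ℝ (Fin N × Fin N) with hA
  have hAc : IsCompact A := (isCompact_stdSimplex ℝ _).image hΛ
  have hAv : Convex ℝ A := (convex_stdSimplex ℝ _).linear_image Λ
  let u : Fin N → ℝ := fun _ => (N : ℝ)⁻¹
  set B : Set ((Fin N → ℝ) × (Fin N → ℝ) × ℝ) := {u} ×ˢ ({u} ×ˢ Set.Iic (w / 2 - δ)) with hB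
  have hBc : IsClosed B := isClosed_singleton.prod (isClosed_singleton.prod isClosed_Iic)
  have hBv : Convex ℝ B := (convex_singleton u).prod ((convex_singleton u).prod (convex_Iic _))
  have hdisj : Disjoint A B := by
    rw [Set.disjoint_left]
    rintro _ ⟨J, hJ, rfl⟩ hb
    obtain ⟨hb1, hb2, hb3⟩ := hb
    have e1 : (fun i => ∑ j, J (i, j)) = u := hb1
    have e2 : (fun j => ∑ i, J (i, j)) = u := hb2
    have e3 : ∑ p, J p * (‖x p.1 - y p.2‖ ^ 2 / 2) ≤ w / 2 - δ := hb3
    have := W2sq_le_plan x y J hJ.1 hJ.2 (fun i => congrFun e1 i) (fun j => congrFun e2 j)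
    rw [← hw] at this
    have e4 : ∑ p, J p * (‖x p.1 - y p.2‖ ^ 2 / 2) = (∑ p, J p * ‖x p.1 - y p.2‖ ^ 2) / 2 := by
      rw [Finset.sum_div]; exact Finset.sum_congr rfl fun p _ => by ring
    rw [e4] at e3
    linarith
  obtain ⟨F, s, v, hs1, hsv, hv1⟩ := geometric_hahn_banach_compact_closed hAv hAc hBv hBc hdisj
  set p : Fin N → ℝ := fun i => F (Pi.single i 1, 0, 0) with hp
  set q : Fin N → ℝ := fun j => F (0, Pi.single j 1, 0) with hq
  set γ : ℝ := F (0, 0, 1) with hγ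
  have hF : ∀ (α β : Fin N → ℝ) (t : ℝ), F (α, β, t) = ∑ i, α i * p i + ∑ j, β j * q j + t * γ := by
    intro α β t
    have e1 : (α, β, t) = ∑ i, α i • ((Pi.single i 1, 0, 0) : (Fin N → ℝ) × (Fin N → ℝ) × ℝ)
        + ∑ j, β j • ((0, Pi.single j 1, 0) : (Fin N → ℝ) × (Fin N → ℝ) × ℝ)
        + t • ((0, 0, 1) : (Fin N → ℝ) × (Fin N → ℝ) × ℝ) := by
      refine Prod.ext ?_ (Prod.ext ?_ ?_)
      · ext i
        simp [Prod.fst_sum, Finset.sum_apply, Pi.single_apply]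
      · ext i
        simp [Prod.fst_sum, Prod.snd_sum, Finset.sum_apply, Pi.single_apply]
      · simp [Prod.snd_sum]
    rw [e1]
    simp only [map_add, map_sum, map_smul, smul_eq_mul, hp, hq, hγ]
  have hij : ∀ i j, p i + q j + ‖x i - y j‖ ^ 2 / 2 * γ < s := by
    intro i j
    have h := hs1 (Λ (Pi.single (i, j) 1)) ⟨_, single_mem_stdSimplex ℝ _, rfl⟩
    have e : Λ (Pi.single (i, j) 1) = (Pi.single i 1, Pi.single j 1, ‖x i - y j‖ ^ 2 / 2) := by
      refine Prod.ext ?_ (Prod.ext ?_ ?_)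
      · ext k
        simp only [Λ, LinearMap.coe_mk, AddHom.coe_mk, Pi.single_apply, Prod.mk.injEq]
        by_cases hk : k = i <;> simp [hk]
      · ext k
        simp only [Λ, LinearMap.coe_mk, AddHom.coe_mk, Pi.single_apply, Prod.mk.injEq]
        by_cases hk : k = j <;> simp [hk]
      · simp [Λ, Pi.single_apply]
    rw [e, hF] at h
    simpa [Pi.single_apply] using h
  have hBt : ∀ t ≤ w / 2 - δ, v < (N : ℝ)⁻¹ * ∑ i, p i + (N : ℝ)⁻¹ * ∑ j, q j + t * γ := by
    intro t ht
    have := hv1 (u, u, t) ⟨rfl, rfl, ht⟩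
    rw [hF] at this
    simpa [u, Finset.mul_sum] using this
  set mp := (N : ℝ)⁻¹ * ∑ i, p i
  set mq := (N : ℝ)⁻¹ * ∑ j, q j
  have hγ0 : γ ≤ 0 := by
    by_contra hcon
    push Not at hcon
    have := hBt (min (w / 2 - δ) ((v - mp - mq) / γ)) (min_le_left _ _)
    have h2 : min (w / 2 - δ) ((v - mp - mq) / γ) * γ ≤ (v - mp - mq) / γ * γ := by
      gcongr; exact min_le_right _ _
    rw [div_mul_cancel₀ _ hcon.ne'] at h2
    linarith
  have hγ1 : γ ≠ 0 := by
    intro h0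
    rw [h0] at hij
    have h1 := hBt _ le_rfl
    rw [h0] at h1
    have h2 : ∑ i, ∑ j, (p i + q j + ‖x i - y j‖ ^ 2 / 2 * 0) ≤ ∑ i : Fin N, ∑ j : Fin N, s :=
      Finset.sum_le_sum fun i _ => Finset.sum_le_sum fun j _ => (hij i j).le
    simp only [mul_zero, add_zero, Finset.sum_add_distrib, Finset.sum_const, Finset.card_univ,
      Fintype.card_fin, nsmul_eq_mul, ← Finset.mul_sum] at h2
    have h3 : (N : ℝ) * N * (mp + mq) ≤ N * N * s := by
      have : (N : ℝ) * N * (mp + mq) = N * ∑ i, p i + N * ∑ j, q j := by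
        simp only [mp, mq]; field_simp
      rw [this]; linarith
    have h4 : mp + mq ≤ s := le_of_mul_le_mul_left h3 (by positivity)
    linarith
  have hg : 0 < -γ := by
    rcases lt_or_eq_of_le hγ0 with h | h
    · linarith
    · exact absurd h hγ1
  refine ⟨fun i => (v - p i) / (-γ), fun j => q j / (-γ), ?_, ?_⟩
  · intro i j
    rw [← sub_div, div_le_iff₀ hg]
    have := hij i j
    linarith
  · have h1 := hBt _ le_rfl
    rw [← Finset.sum_div, ← Finset.sum_div, Finset.sum_sub_distrib]
    simp only [Finset.sum_const, Finset.card_univ, Fintype.card_fin, nsmul_eq_mul]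
    have : (N : ℝ)⁻¹ * ((∑ j, q j) / -γ) - (N : ℝ)⁻¹ * ((N * v - ∑ i, p i) / -γ)
        = (mp + mq - v) / (-γ) := by
      simp only [mp, mq]; field_simp; ring
    rw [this]
    have : w / 2 - δ ≤ (mp + mq - v) / (-γ) := by
      rw [le_div_iff₀ hg]; linarith
    linarith

/-- Finite duality with a Lipschitz potential. -/
theorem duality {N : ℕ} (hN : 0 < N) (x y : Fin N → E2) (hx : ∀ i, x i ∈ unitSq)
    (hy : ∀ i, y i ∈ unitSq) {δ : ℝ} (hδ : 0 < δ) :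
    ∃ φ : E2 → ℝ, LipschitzWith 2 φ ∧
      W2sq (empMeas x) (empMeas y) / 2 ≤
        (N : ℝ)⁻¹ * ∑ j, HL 1 φ (y j) - (N : ℝ)⁻¹ * ∑ i, φ (x i) + δ := by
  obtain ⟨f, g, hfg, hW⟩ := dual_potentials hN x y hδ
  have : Nonempty (Fin N) := ⟨⟨0, hN⟩⟩
  let φ : E2 → ℝ := fun z => Finset.univ.sup' Finset.univ_nonempty
    (fun j => g j - ‖clampSq z - y j‖ ^ 2 / 2)
  refine ⟨φ, ?_, hW.trans ?_⟩
  · apply LipschitzWith.of_le_add_mul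
    intro z z'
    apply Finset.sup'_le
    intro j _
    have h1 : g j - ‖clampSq z' - y j‖ ^ 2 / 2 ≤ φ z' :=
      Finset.le_sup' (fun j => g j - ‖clampSq z' - y j‖ ^ 2 / 2) (Finset.mem_univ j)
    have h2 : ‖clampSq z' - y j‖ ≤ ‖clampSq z - y j‖ + ‖z - z'‖ := by
      have : clampSq z' - y j = (clampSq z - y j) + (clampSq z' - clampSq z) := by abel
      rw [this]
      refine (norm_add_le _ _).trans ?_
      gcongr
      rw [norm_sub_rev z]
      exact clampSq_norm _ _
    have h3 := sq_diam' (clampSq_mem z) (hy j)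
    have h3' := sq_diam' (clampSq_mem z') (hy j)
    rw [dist_eq_norm]
    have h5 := norm_nonneg (clampSq z - y j)
    have h6 := norm_nonneg (clampSq z' - y j)
    have h7 := norm_nonneg (z - z')
    have h8 : ‖clampSq z' - y j‖ ^ 2 - ‖clampSq z - y j‖ ^ 2 ≤ 4 * ‖z - z'‖ := by
      rw [sq_sub_sq]
      by_cases hc : ‖clampSq z' - y j‖ - ‖clampSq z - y j‖ ≤ 0
      · nlinarith
      · push Not at hc
        nlinarith
    have : ((2 : ℝ≥0) : ℝ) = 2 := rfl
    rw [this]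
    linarith
  · have h1 : ∀ j, g j ≤ HL 1 φ (y j) := by
      intro j
      apply le_HL
      intro z
      have h1 : g j - ‖clampSq z - y j‖ ^ 2 / 2 ≤ φ z :=
        Finset.le_sup' (fun j => g j - ‖clampSq z - y j‖ ^ 2 / 2) (Finset.mem_univ j)
      have h2 := clampSq_norm z (y j)
      rw [clampSq_eq (hy j)] at h2
      have h3 : ‖clampSq z - y j‖ ^ 2 ≤ ‖z - y j‖ ^ 2 := by gcongr
      linarith
    have h2 : ∀ i, φ (x i) ≤ f i := by
      intro i
      apply Finset.sup'_le
      intro j _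
      rw [clampSq_eq (hx i)]
      linarith [hfg i j]
    have h3 : (N : ℝ)⁻¹ * ∑ j, g j ≤ (N : ℝ)⁻¹ * ∑ j, HL 1 φ (y j) := by
      gcongr; exact h1 _
    have h4 : (N : ℝ)⁻¹ * ∑ i, φ (x i) ≤ (N : ℝ)⁻¹ * ∑ i, f i := by
      gcongr; exact h2 _
    linarith

/-! ### Mollification -/

/-- Properties of a mollification operator at Lipschitz level `L` and scale `ε`. -/
def IsMol (L : ℝ≥0) (ε C : ℝ) (M : (E2 → ℝ) → E2 → ℝ) : Prop :=
  (∀ φ : E2 → ℝ, LipschitzWith L φ → (∀ x, |M φ x - φ x| ≤ L * ε) ∧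
    ∃ G : E2 → E2, Continuous G ∧ (∀ x, HasGradientAt (M φ) (G x) x) ∧ (∀ x, ‖G x‖ ≤ L) ∧
      ∀ x v, M φ (x + v) ≤ M φ x + inner ℝ (G x) v + C * ‖v‖ ^ 2) ∧
  ∀ φ ψ : E2 → ℝ, LipschitzWith L φ → LipschitzWith L ψ → ∀ (w : E2) (c : ℝ) (x : E2),
    (∀ z, ψ z ≤ φ (z - w) + c) → M ψ x ≤ M φ (x - w) + c

theorem exists_mol (L : ℝ≥0) {ε : ℝ} (hε : 0 < ε) :
    ∃ (C : ℝ) (M : (E2 → ℝ) → E2 → ℝ), 0 ≤ C ∧ IsMol L ε C M := by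
  let bb : ContDiffBump (0 : E2) := ⟨ε / 2, ε, by positivity, by linarith⟩
  let b : E2 → ℝ := bb.normed volume
  let Λ := ContinuousLinearMap.lsmul ℝ ℝ (E := ℝ)
  let M : (E2 → ℝ) → E2 → ℝ := fun φ => MeasureTheory.convolution b φ Λ volume
  have hbc : HasCompactSupport b := bb.hasCompactSupport_normed
  have hbd : ContDiff ℝ 1 b := bb.contDiff_normed (n := 1)
  have hb0 : ∀ x, 0 ≤ b x := fun x => bb.nonneg_normed x
  have hb1 : ∫ x, b x = 1 := bb.integral_normed
  have hM : ∀ φ x, M φ x = ∫ t, b t * φ (x - t) := fun φ x => rfl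
  have hint : ∀ φ : E2 → ℝ, Continuous φ → ∀ x, Integrable (fun t => b t * φ (x - t)) := by
    intro φ hφ x
    apply Continuous.integrable_of_hasCompactSupport
    · exact hbd.continuous.mul (hφ.comp (by fun_prop))
    · exact hbc.mul_right
  let C₀ : ℝ := ∫ t, ‖fderiv ℝ b t‖
  have hC₀ : 0 ≤ C₀ := by positivity
  have hdc : Continuous (fderiv ℝ b) := hbd.continuous_fderiv (by norm_num)
  have hmono : ∀ φ ψ : E2 → ℝ, LipschitzWith L φ → LipschitzWith L ψ → ∀ (w : E2) (c : ℝ) (x : E2),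
      (∀ z, ψ z ≤ φ (z - w) + c) → M ψ x ≤ M φ (x - w) + c := by
    intro φ ψ hφ hψ w c x h
    have e : M φ (x - w) + c = ∫ t, (b t * φ (x - w - t) + b t * c) := by
      rw [integral_add (hint φ hφ.continuous _) (bb.integrable_normed.mul_const c),
        integral_mul_const, hb1, one_mul, hM]
    rw [e, hM]
    apply integral_mono (hint ψ hψ.continuous x)
      ((hint φ hφ.continuous _).add (bb.integrable_normed.mul_const c))
    intro t
    have h1 := h (x - t)
    have h2 : x - t - w = x - w - t := by abel
    rw [h2] at h1
    have := mul_le_mul_of_nonneg_left h1 (hb0 t)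
    simp only [Pi.add_apply]
    linarith
  have hpre : ∀ (a : E2 →L[ℝ] ℝ) (r : ℝ), ‖Λ.precompL E2 a r‖ ≤ ‖a‖ * ‖r‖ := by
    intro a r
    refine ContinuousLinearMap.opNorm_le_bound _ (by positivity) fun v => ?_
    have : Λ.precompL E2 a r v = a v * r := rfl
    rw [this, norm_mul]
    have := a.le_opNorm v
    calc ‖a v‖ * ‖r‖ ≤ (‖a‖ * ‖v‖) * ‖r‖ := by gcongr
      _ = _ := by ring
  refine ⟨C₀ * L, M, by positivity, ?_, hmono⟩
  intro φ hφ
  have hMl : LipschitzWith L (M φ) := by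
    apply LipschitzWith.of_le_add_mul
    intro x y
    have h := hmono φ φ hφ hφ (x - y) (L * dist x y) x (by
      intro z
      have := hφ.dist_le_mul z (z - (x - y))
      rw [Real.dist_eq, dist_eq_norm, sub_sub_cancel, ← dist_eq_norm] at this
      have := (le_abs_self _).trans this
      linarith)
    rwa [sub_sub_cancel] at h
  let D : E2 → E2 →L[ℝ] ℝ := MeasureTheory.convolution (fderiv ℝ b) φ (Λ.precompL E2) volume
  have hD : ∀ x, HasFDerivAt (M φ) (D x) x := fun x =>
    hbc.hasFDerivAt_convolution_left Λ hbd hφ.continuous.locallyIntegrable x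
  have hDint : ∀ x, Integrable (fun t => Λ.precompL E2 (fderiv ℝ b t) (φ (x - t))) := by
    intro x
    exact (hbc.fderiv (𝕜 := ℝ)).convolutionExists_left _ hdc hφ.continuous.locallyIntegrable x
  have hDl : ∀ x y, ‖D x - D y‖ ≤ C₀ * L * ‖x - y‖ := by
    intro x y
    have e : D x - D y = ∫ t, (Λ.precompL E2 (fderiv ℝ b t) (φ (x - t) - φ (y - t))) := by
      have : D x - D y = (∫ t, Λ.precompL E2 (fderiv ℝ b t) (φ (x - t)))
        - ∫ t, Λ.precompL E2 (fderiv ℝ b t) (φ (y - t)) := rfl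
      rw [this, ← integral_sub (hDint x) (hDint y)]
      simp only [map_sub]
    rw [e]
    have hI : Integrable (fun t => ‖fderiv ℝ b t‖) :=
      (hdc.integrable_of_hasCompactSupport (hbc.fderiv (𝕜 := ℝ))).norm
    have : C₀ * L * ‖x - y‖ = ∫ t, ‖fderiv ℝ b t‖ * (L * ‖x - y‖) := by
      rw [integral_mul_const]; ring
    rw [this]
    apply norm_integral_le_of_norm_le (hI.mul_const _)
    refine Filter.Eventually.of_forall fun t => ?_
    refine (hpre _ _).trans ?_
    gcongr
    have := hφ.dist_le_mul (x - t) (y - t)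
    rwa [dist_eq_norm, dist_eq_norm, sub_sub_sub_cancel_right] at this
  have hDc : Continuous D := by
    have : LipschitzWith (Real.toNNReal (C₀ * L)) D := by
      apply LipschitzWith.of_dist_le_mul
      intro x y
      rw [dist_eq_norm, dist_eq_norm, Real.coe_toNNReal _ (by positivity)]
      exact hDl x y
    exact this.continuous
  refine ⟨?_, fun x => (InnerProductSpace.toDual ℝ E2).symm (D x), ?_, ?_, ?_, ?_⟩
  · intro x
    have := bb.dist_normed_convolution_le (μ := (volume : Measure E2)) (g := φ) (x₀ := x) (ε := L * ε)
      hφ.continuous.aestronglyMeasurable (by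
        intro y hy
        refine (hφ.dist_le_mul y x).trans ?_
        gcongr
        exact (Metric.mem_ball.1 hy).le)
    rwa [Real.dist_eq] at this
  · exact (InnerProductSpace.toDual ℝ E2).symm.continuous.comp hDc
  · intro x
    exact (hD x).hasGradientAt
  · intro x
    rw [LinearIsometryEquiv.norm_map]
    exact (hD x).le_of_lipschitz hMl
  · intro x v
    rw [InnerProductSpace.toDual_symm_apply]
    have h := (convex_closedBall x ‖v‖).norm_image_sub_le_of_norm_hasFDerivWithin_le' (f := M φ)
      (f' := D) (φ := D x) (C := C₀ * L * ‖v‖) (x := x) (y := x + v)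
      (fun y _ => (hD y).hasFDerivWithinAt)
      (fun y hy => (hDl y x).trans (by
        gcongr
        rw [← dist_eq_norm]; exact Metric.mem_closedBall.1 hy))
      (by simp) (by simp)
    rw [add_sub_cancel_left] at h
    have := (le_abs_self _).trans h
    have e : C₀ * L * ‖v‖ * ‖v‖ = C₀ * L * ‖v‖ ^ 2 := by ring
    linarith

/-! ### The half-open square, densities and the path lemma -/

/-- Half-open unit square. -/
def Qs : Set E2 := {x | ∀ i, x i ∈ Set.Ico (0 : ℝ) 1}

/-- Lebesgue measure on the half-open unit square. -/
def lam : Measure E2 := volume.restrict Qs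

theorem volume_box (a b : Fin 2 → ℝ) :
    volume {x : E2 | ∀ i, x i ∈ Set.Ico (a i) (b i)} = ∏ i, ENNReal.ofReal (b i - a i) := by
  have h := (EuclideanSpace.volume_preserving_symm_measurableEquiv_toLp (Fin 2)).symm.measure_preimage
    (s := {x : E2 | ∀ i, x i ∈ Set.Ico (a i) (b i)}) (by
      apply MeasurableSet.nullMeasurableSet
      rw [Set.ofPred_forall]
      exact MeasurableSet.iInter fun i => (by fun_prop : Measurable fun x : E2 => x i) measurableSet_Ico)
  rw [← h, ← Real.volume_pi_Ico]
  congr 1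
  ext x
  simp [Set.mem_pi]

theorem measurableSet_box (a b : Fin 2 → ℝ) :
    MeasurableSet {x : E2 | ∀ i, x i ∈ Set.Ico (a i) (b i)} := by
  rw [Set.ofPred_forall]
  exact MeasurableSet.iInter fun i => (by fun_prop : Measurable fun x : E2 => x i) measurableSet_Ico

theorem measurableSet_sq : MeasurableSet Qs := measurableSet_box _ _

theorem volume_sq : volume Qs = 1 := by
  have := volume_box (fun _ => 0) (fun _ => 1)
  simpa [Qs] using this

instance lam_prob : IsProbabilityMeasure lam := ⟨by simp [lam, volume_sq]⟩

theorem sq_subset : Qs ⊆ unitSq := fun _ hx i => ⟨(hx i).1, (hx i).2.le⟩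

theorem sq_norm {x : E2} (hx : x ∈ unitSq) : ‖x‖ ≤ 2 := by
  have h0 : (0 : E2) ∈ unitSq := fun i => by simp
  simpa using sq_diam' hx h0

theorem sq_convex : Convex ℝ Qs := by
  have : Qs = ⋂ i : Fin 2, (fun x : E2 => x i) ⁻¹' Set.Ico (0 : ℝ) 1 := by
    ext x; simp [Qs]
  rw [this]
  refine convex_iInter fun i => ?_
  exact (convex_Ico (0 : ℝ) 1).linear_preimage (EuclideanSpace.proj (𝕜 := ℝ) i).toLinearMap

theorem ae_lam : ∀ᵐ x ∂lam, x ∈ Qs := ae_restrict_mem measurableSet_sq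

theorem integrable_lam_of_bdd {E : Type*} [NormedAddCommGroup E] {f : E2 → E}
    (hf : AEStronglyMeasurable f lam) {B : ℝ} (hB : ∀ z ∈ Qs, ‖f z‖ ≤ B) : Integrable f lam :=
  Integrable.of_bound hf B (ae_lam.mono hB)

theorem continuous_bdd_sq {E : Type*} [NormedAddCommGroup E] {f : E2 → E} (hf : Continuous f) :
    ∃ B : ℝ, 0 ≤ B ∧ ∀ z ∈ Qs, ‖f z‖ ≤ B := by
  obtain ⟨B, hB⟩ := (isCompact_closedBall (0 : E2) 2).exists_bound_of_continuousOn hf.continuousOn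
  have hh : ∀ z ∈ Qs, ‖f z‖ ≤ B := fun z hz => hB z (by simpa using sq_norm (sq_subset hz))
  refine ⟨B, ?_, hh⟩
  exact (norm_nonneg _).trans (hh 0 (fun i => by simp))

/-- Admissible density. -/
structure Dens (f : E2 → ℝ) : Prop where
  meas : Measurable f
  nonneg : ∀ z, 0 ≤ f z
  bdd : ∃ B, ∀ z, f z ≤ B
  mass : ∫ z, f z ∂lam = 1

theorem Dens.integrable_mul {f : E2 → ℝ} (hf : Dens f) {φ : E2 → ℝ} (hφ : Continuous φ) :
    Integrable (fun z => φ z * f z) lam := by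
  obtain ⟨B, hB⟩ := hf.bdd
  obtain ⟨A, hA0, hA⟩ := continuous_bdd_sq hφ
  refine integrable_lam_of_bdd (B := A * B) ?_ ?_
  · exact (hφ.measurable.mul hf.meas).aestronglyMeasurable
  · intro z hz
    rw [norm_mul, Real.norm_of_nonneg (hf.nonneg z)]
    exact mul_le_mul (hA z hz) (hB z) (hf.nonneg z) hA0

theorem Dens.integrable {f : E2 → ℝ} (hf : Dens f) : Integrable f lam := by
  simpa using hf.integrable_mul (φ := fun _ => 1) continuous_const

theorem Dens.mix {f g : E2 → ℝ} (hf : Dens f) (hg : Dens g) {a : ℝ} (h0 : 0 ≤ a) (h1 : a ≤ 1) :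
    Dens (fun z => (1 - a) * f z + a * g z) := by
  obtain ⟨B, hB⟩ := hf.bdd
  obtain ⟨B', hB'⟩ := hg.bdd
  have h1' : 0 ≤ 1 - a := by linarith
  refine ⟨(hf.meas.const_mul _).add (hg.meas.const_mul _), fun z => ?_,
    ⟨(1 - a) * B + a * B', fun z => ?_⟩, ?_⟩
  · have := hf.nonneg z; have := hg.nonneg z; positivity
  · have := hB z; have := hB' z; gcongr
  · rw [integral_add (hf.integrable.const_mul _) (hg.integrable.const_mul _),
      integral_const_mul, integral_const_mul, hf.mass, hg.mass]; ring

/-- Functional associated with a density. -/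
def den (f : E2 → ℝ) (φ : E2 → ℝ) : ℝ := ∫ z, φ z * f z ∂lam

theorem den_mix {f g : E2 → ℝ} (hf : Dens f) (hg : Dens g) (a : ℝ) {φ : E2 → ℝ}
    (hφ : Continuous φ) :
    den (fun z => (1 - a) * f z + a * g z) φ = (1 - a) * den f φ + a * den g φ := by
  unfold den
  rw [← integral_const_mul, ← integral_const_mul, ← integral_add
    ((hf.integrable_mul hφ).const_mul _) ((hg.integrable_mul hφ).const_mul _)]
  congr 1; ext z; ring

theorem den_good {f : E2 → ℝ} (hf : Dens f) : Good (den f) := by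
  refine ⟨fun L φ ψ hφ hψ h => ?_, fun φ => ?_⟩
  · apply integral_mono (hf.integrable_mul hφ.continuous) (hf.integrable_mul hψ.continuous)
    intro z
    exact mul_le_mul_of_nonneg_right (h z) (hf.nonneg z)
  · unfold den
    rw [← integral_neg]; simp only [neg_mul]

/-- Weak form of `f₁ - f₀ = - div W`. -/
def Weak (f₀ f₁ : E2 → ℝ) (W : E2 → E2) : Prop :=
  ∀ (φ : E2 → ℝ) (G : E2 → E2), Continuous G → (∀ x, HasGradientAt φ (G x) x) →
    (∃ L, ∀ x, ‖G x‖ ≤ L) → den f₁ φ - den f₀ φ = ∫ z, inner ℝ (G z) (W z) ∂lam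

theorem step_lemma {L : ℝ≥0} {ε C : ℝ} (hC : 0 ≤ C) {M : (E2 → ℝ) → E2 → ℝ} (hM : IsMol L ε C M)
    {f₀ f₁ : E2 → ℝ} (h0 : Dens f₀) (h1 : Dens f₁) {W : E2 → E2} (hW : Integrable W lam)
    (hweak : Weak f₀ f₁ W) {H : E2 → ℝ} (hH : Integrable H lam) {T h : ℝ} (hT : 0 < T) (hh : 0 < h)
    {a a' : ℝ} (ha : a ∈ Set.Icc (0 : ℝ) 1) (ha' : a' ∈ Set.Icc (0 : ℝ) 1)
    (hyp : ∀ z ∈ Qs, ((T / h) * (a' - a)) ^ 2 * ‖W z‖ ^ 2 ≤ H z * ((1 - a') * f₀ z + a' * f₁ z))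
    (hH0 : ∀ z ∈ Qs, 0 ≤ H z)
    {φ : E2 → ℝ} (hφ : LipschitzWith L φ) :
    den (fun z => (1 - a') * f₀ z + a' * f₁ z) (M (HL h φ)) -
      den (fun z => (1 - a) * f₀ z + a * f₁ z) (M φ) ≤
      (h / T) * ((∫ z, H z ∂lam) / (2 * T)) + C * L ^ 2 * h ^ 2 := by
  obtain ⟨G, hGc, hGg, hGL, hGT⟩ := (hM.1 φ hφ).2
  obtain ⟨G', hGc', hGg', -, -⟩ := (hM.1 _ (HL_lip hφ hh)).2
  have hc1 : Continuous (M φ) := continuous_iff_continuousAt.2 fun x =>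
    (hGg x).hasFDerivAt.continuousAt
  have hc2 : Continuous (M (HL h φ)) := continuous_iff_continuousAt.2 fun x =>
    (hGg' x).hasFDerivAt.continuousAt
  set F := fun z => (1 - a') * f₀ z + a' * f₁ z with hF
  have hFd : Dens F := h0.mix h1 ha'.1 ha'.2
  have hw := hweak (M φ) G hGc hGg ⟨L, hGL⟩
  have e1 : den F (M φ) - den (fun z => (1 - a) * f₀ z + a * f₁ z) (M φ)
      = (a' - a) * ∫ z, inner ℝ (G z) (W z) ∂lam := by
    rw [hF, den_mix h0 h1 a' hc1, den_mix h0 h1 a hc1, ← hw]; ring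
  have hIW : Integrable (fun z => inner ℝ (G z) (W z)) lam := by
    refine (hW.norm.const_mul (L : ℝ)).mono'
      (hGc.aestronglyMeasurable.inner hW.aestronglyMeasurable) ?_
    refine Filter.Eventually.of_forall fun z => ?_
    refine (norm_inner_le_norm _ _).trans ?_
    gcongr
    exact hGL z
  have key : ∀ z ∈ Qs, M (HL h φ) z * F z - M φ z * F z + (a' - a) * inner ℝ (G z) (W z) ≤
      (h / T) * (H z / (2 * T)) + C * L ^ 2 * h ^ 2 * F z := by
    intro z hz
    have b1 : M (HL h φ) z ≤ M φ (z - h • G z) + h * ‖G z‖ ^ 2 / 2 := by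
      apply hM.2 φ (HL h φ) hφ (HL_lip hφ hh)
      intro y
      refine (HL_le hφ hh (y - h • G z) y).trans (le_of_eq ?_)
      rw [sub_sub_cancel_left, norm_neg, norm_smul, Real.norm_of_nonneg hh.le]
      field_simp
    have b2 := hGT z (-(h • G z))
    rw [← sub_eq_add_neg, inner_neg_right, inner_smul_right, real_inner_self_eq_norm_sq, norm_neg,
      norm_smul, Real.norm_of_nonneg hh.le] at b2
    have b3 : ‖G z‖ ^ 2 ≤ (L : ℝ) ^ 2 := by
      have := hGL z; gcongr
    have b4 : M (HL h φ) z - M φ z ≤ - (h / 2 * ‖G z‖ ^ 2) + C * L ^ 2 * h ^ 2 := by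
      have : C * (h * ‖G z‖) ^ 2 ≤ C * L ^ 2 * h ^ 2 := by
        have : C * (h * ‖G z‖) ^ 2 = C * h ^ 2 * ‖G z‖ ^ 2 := by ring
        rw [this]
        have := mul_le_mul_of_nonneg_left b3 (by positivity : 0 ≤ C * h ^ 2)
        linarith
      linarith
    have b5 : (a' - a) * inner ℝ (G z) (W z) ≤ |a' - a| * (‖G z‖ * ‖W z‖) := by
      refine (le_abs_self _).trans ?_
      rw [abs_mul]
      gcongr
      exact abs_real_inner_le_norm _ _
    have hFz := hFd.nonneg z
    have b6 : |a' - a| * (‖G z‖ * ‖W z‖) ≤ h / 2 * ‖G z‖ ^ 2 * F z + (h / T) * (H z / (2 * T)) := by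
      have c1 := hyp z hz
      have c2 : (|a' - a| * ‖W z‖) ^ 2 ≤ (h / T) ^ 2 * (H z * F z) := by
        have : (|a' - a| * ‖W z‖) ^ 2 = (h / T) ^ 2 * ((T / h * (a' - a)) ^ 2 * ‖W z‖ ^ 2) := by
          rw [mul_pow, sq_abs]; field_simp
        rw [this]
        gcongr
      have hH0z := hH0 z hz
      have c3 : (|a' - a| * (‖G z‖ * ‖W z‖)) ^ 2 ≤ (h / 2 * ‖G z‖ ^ 2 * F z + (h / T) * (H z / (2 * T))) ^ 2 := by
        have d1 : (|a' - a| * (‖G z‖ * ‖W z‖)) ^ 2 = ‖G z‖ ^ 2 * (|a' - a| * ‖W z‖) ^ 2 := by ring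
        have d2 : ‖G z‖ ^ 2 * (|a' - a| * ‖W z‖) ^ 2 ≤ ‖G z‖ ^ 2 * ((h / T) ^ 2 * (H z * F z)) := by
          gcongr
        have d3 : (h / 2 * ‖G z‖ ^ 2 * F z + (h / T) * (H z / (2 * T))) ^ 2 -
            ‖G z‖ ^ 2 * ((h / T) ^ 2 * (H z * F z)) =
            (h / 2 * ‖G z‖ ^ 2 * F z - (h / T) * (H z / (2 * T))) ^ 2 := by
          field_simp; ring
        have d4 := sq_nonneg (h / 2 * ‖G z‖ ^ 2 * F z - (h / T) * (H z / (2 * T)))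
        linarith
      exact le_of_sq_le_sq c3 (by positivity)
    have b7 := mul_le_mul_of_nonneg_right b4 hFz
    nlinarith
  have hi1 := hFd.integrable_mul hc2
  have hi2 := hFd.integrable_mul hc1
  have hi12 : Integrable (fun z => M (HL h φ) z * F z - M φ z * F z) lam := hi1.sub hi2
  have hI := integral_mono_ae (hi12.add (hIW.const_mul (a' - a)))
    (((hH.div_const (2 * T)).const_mul (h / T)).add (hFd.integrable.const_mul (C * L ^ 2 * h ^ 2)))
    (ae_lam.mono key)
  simp only [Pi.add_apply, Pi.sub_apply] at hI
  rw [integral_add hi12 (hIW.const_mul (a' - a)), integral_sub hi1 hi2,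
    integral_add ((hH.div_const (2 * T)).const_mul (h / T))
      (hFd.integrable.const_mul (C * L ^ 2 * h ^ 2)), integral_const_mul, integral_const_mul,
    integral_const_mul, integral_div, hFd.mass, ← e1] at hI
  have : den F (M (HL h φ)) = ∫ z, M (HL h φ) z * F z ∂lam := rfl
  have : den F (M φ) = ∫ z, M φ z * F z ∂lam := rfl
  linarith

theorem HL_iter_lip {L : ℝ≥0} {φ : E2 → ℝ} (hφ : LipschitzWith L φ) {h : ℝ} (hh : 0 < h) (k : ℕ) :
    LipschitzWith L ((HL h)^[k] φ) := by
  induction k with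
  | zero => simpa
  | succ k ih => rw [Function.iterate_succ_apply']; exact HL_lip ih hh

theorem HL_iter_le {L : ℝ≥0} {φ : E2 → ℝ} (hφ : LipschitzWith L φ) {h : ℝ} (hh : 0 < h) (k : ℕ) (y : E2) :
    HL ((k + 1 : ℕ) * h) φ y ≤ (HL h)^[k + 1] φ y := by
  induction k generalizing y with
  | zero => simp
  | succ k ih =>
    rw [Function.iterate_succ_apply']
    have e : ((k + 1 + 1 : ℕ) : ℝ) * h = (k + 1 : ℕ) * h + h := by push_cast; ring
    rw [e]
    have hk : 0 < ((k + 1 : ℕ) : ℝ) * h := by positivity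
    refine (HL_semigroup hφ hk hh y).trans ?_
    apply le_HL
    intro x
    have := HL_le (HL_lip hφ hk) hh x y
    linarith [ih x]

/-- The path lemma. -/
theorem path_lemma {f₀ f₁ : E2 → ℝ} (h0 : Dens f₀) (h1 : Dens f₁) {W : E2 → E2}
    (hW : Integrable W lam)
    (hweak : Weak f₀ f₁ W) {H : E2 → ℝ} (hH : Integrable H lam) {T : ℝ} (hT : 0 < T)
    {a : ℝ → ℝ} (ha0 : a 0 = 0) (ha1 : a 1 = 1) (ha : ∀ s ∈ Set.Icc (0 : ℝ) 1, a s ∈ Set.Icc (0 : ℝ) 1)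
    (hyp : ∀ (n k : ℕ), k < n → ∀ z ∈ Qs, (n * (a ((k + 1) / n) - a (k / n))) ^ 2 * ‖W z‖ ^ 2 ≤
      H z * ((1 - a ((k + 1) / n)) * f₀ z + a ((k + 1) / n) * f₁ z))
    (hH0 : ∀ z ∈ Qs, 0 ≤ H z) :
    TC T (den f₀) (den f₁) ((∫ z, H z ∂lam) / (2 * T)) := by
  intro L φ hφ
  set I := (∫ z, H z ∂lam) / (2 * T) with hI
  have main : ∀ ε > 0, den f₁ (HL T φ) - den f₀ φ ≤ I + 2 * (L * ε) := by
    intro ε hε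
    obtain ⟨C, M, hC, hM⟩ := exists_mol L hε
    have step : ∀ n : ℕ, den f₁ (HL T φ) - den f₀ φ ≤ I + 2 * (L * ε) + C * L ^ 2 * T ^ 2 / (n + 1 : ℕ) := by
      intro n
      set m := n + 1 with hm
      have hmpos : (0 : ℝ) < m := by positivity
      set h := T / m with hh
      have hhpos : 0 < h := by positivity
      have ind : ∀ k : ℕ, k ≤ m → den (fun z => (1 - a (k / m)) * f₀ z + a (k / m) * f₁ z)
          (M ((HL h)^[k] φ)) - den f₀ (M φ) ≤ k * ((1 / m) * I + C * L ^ 2 * h ^ 2) := by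
        intro k
        induction k with
        | zero => intro _; simp [ha0]
        | succ k ih =>
          intro hk
          have hk' : k < m := hk
          have hkm : (k : ℝ) + 1 ≤ m := by exact_mod_cast hk
          have i1 := ih hk'.le
          have i2 := step_lemma hC hM h0 h1 hW hweak hH hT hhpos (a := a (k / m))
            (a' := a ((k + 1) / m))
            (ha _ ⟨by positivity, by rw [div_le_one hmpos]; linarith⟩)
            (ha _ ⟨by positivity, by rw [div_le_one hmpos]; linarith⟩)
            (by
              have : T / h = m := by rw [hh]; field_simp
              rw [this]
              exact hyp m k hk') hH0 (HL_iter_lip hφ hhpos k)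
          have : h / T = 1 / m := by rw [hh]; field_simp
          rw [this] at i2
          rw [Function.iterate_succ_apply']
          push_cast
          linarith
      have fin := ind m le_rfl
      rw [div_self hmpos.ne', ha1] at fin
      simp only [sub_self, zero_mul, one_mul, zero_add] at fin
      have e1 : (m : ℝ) * ((1 / m) * I + C * L ^ 2 * h ^ 2) = I + C * L ^ 2 * T ^ 2 / m := by
        rw [hh]; field_simp
      rw [e1] at fin
      have hl := HL_iter_lip hφ hhpos m
      have cM : ∀ ψ : E2 → ℝ, LipschitzWith L ψ → Continuous (M ψ) := by
        intro ψ hψ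
        obtain ⟨G, -, hGg, -⟩ := (hM.1 ψ hψ).2
        exact continuous_iff_continuousAt.2 fun x => (hGg x).hasFDerivAt.continuousAt
      have comp : ∀ f : E2 → ℝ, Dens f → ∀ φ ψ : E2 → ℝ, Continuous φ → Continuous ψ →
          (∀ x, φ x ≤ ψ x + L * ε) → den f φ ≤ den f ψ + L * ε := by
        intro f hf φ ψ hφ hψ hle
        have : den f ψ + L * ε = ∫ z, (ψ z * f z + L * ε * f z) ∂lam := by
          rw [integral_add (hf.integrable_mul hψ) (hf.integrable.const_mul _), integral_const_mul,
            hf.mass, mul_one]; rfl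
        rw [this]
        apply integral_mono (hf.integrable_mul hφ)
          ((hf.integrable_mul hψ).add (hf.integrable.const_mul _))
        intro z
        have := mul_le_mul_of_nonneg_right (hle z) (hf.nonneg z)
        simp only [Pi.add_apply]
        linarith
      have j1 : den f₁ (HL T φ) ≤ den f₁ (M ((HL h)^[m] φ)) + L * ε := by
        apply comp f₁ h1 _ _ (HL_lip hφ hT).continuous (cM _ hl)
        intro x
        have q1 := HL_iter_le hφ hhpos n x
        rw [← hm] at q1
        have : (m : ℝ) * h = T := by rw [hh]; field_simp
        rw [this] at q1
        have q2 := abs_le.1 ((hM.1 _ hl).1 x)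
        linarith [q2.1]
      have j2 : den f₀ (M φ) ≤ den f₀ φ + L * ε := by
        apply comp f₀ h0 _ _ (cM _ hφ) hφ.continuous
        intro x
        have q2 := abs_le.1 ((hM.1 _ hφ).1 x)
        linarith [q2.2]
      linarith
    have lim : Tendsto (fun n : ℕ => I + 2 * (L * ε) + C * L ^ 2 * T ^ 2 / (n + 1 : ℕ)) atTop
        (𝓝 (I + 2 * (L * ε) + 0)) :=
      tendsto_const_nhds.add ((tendsto_const_div_atTop_nhds_zero_nat _).comp (tendsto_add_atTop_nat 1))
    rw [add_zero] at lim
    exact ge_of_tendsto' lim step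
  have lim : Tendsto (fun ε : ℝ => I + 2 * (L * ε)) (𝓝[>] 0) (𝓝 (I + 2 * (L * 0))) := by
    apply Tendsto.mono_left _ nhdsWithin_le_nhds
    exact (Continuous.tendsto (by fun_prop) 0)
  simp only [mul_zero, add_zero] at lim
  exact ge_of_tendsto lim (eventually_mem_nhdsWithin.mono fun ε hε => main ε hε)

/-! ### Radial integrals and straight-line kernels -/

theorem radial_integral (f : ℝ → ℝ) :
    ∫ x : E2, f ‖x‖ = 2 * Real.pi * ∫ y in Set.Ioi (0 : ℝ), y * f y := by
  have h := integral_fun_norm_addHaar (volume : Measure E2) f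
  rw [h]
  have : (volume : Measure E2).real (Metric.ball 0 1) = Real.pi := by
    simp [Measure.real, EuclideanSpace.volume_ball_fin_two, Real.pi_pos.le]
  rw [this]
  simp
  ring

theorem radial_integrable {f : ℝ → ℝ} (h : IntegrableOn (fun y => y * f y) (Set.Ioi 0)) :
    Integrable (fun x : E2 => f ‖x‖) := by
  rw [integrable_fun_norm_addHaar (volume : Measure E2)]
  simpa using h

theorem inv_norm_ball {r : ℝ} (hr : 0 < r) :
    Integrable (fun x : E2 => (Set.Iio r).indicator (fun s => s⁻¹) ‖x‖) ∧
    ∫ x : E2, (Set.Iio r).indicator (fun s => s⁻¹) ‖x‖ = 2 * Real.pi * r := by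
  have e : Set.EqOn (fun y : ℝ => y * (Set.Iio r).indicator (fun s => s⁻¹) y)
      ((Set.Iio r).indicator (fun _ => 1)) (Set.Ioi 0) := by
    intro y hy
    have : y ≠ 0 := (Set.mem_Ioi.1 hy).ne'
    by_cases h : y < r
    · simp [Set.indicator, h, this]
    · simp [Set.indicator, h]
  have hI : IntegrableOn ((Set.Iio r).indicator (fun _ => (1 : ℝ))) (Set.Ioi 0) := by
    rw [IntegrableOn, integrable_indicator_iff measurableSet_Iio, IntegrableOn,
      Measure.restrict_restrict measurableSet_Iio, Set.inter_comm, Set.Ioi_inter_Iio]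
    simp
  refine ⟨radial_integrable (hI.congr_fun e.symm measurableSet_Ioi), ?_⟩
  rw [radial_integral, setIntegral_congr_fun measurableSet_Ioi e,
    setIntegral_indicator measurableSet_Iio, Set.Ioi_inter_Iio]
  simp [hr.le]

theorem inv_norm_bound {E : Set E2} (hE : MeasurableSet E) (hEf : volume E ≠ ∞) (p : E2) {r : ℝ}
    (hr : 0 < r) :
    IntegrableOn (fun z => ‖z - p‖⁻¹) E ∧
    ∫ z in E, ‖z - p‖⁻¹ ≤ 2 * Real.pi * r + volume.real E / r := by
  obtain ⟨h1, h2⟩ := inv_norm_ball hr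
  have h1' := h1.comp_sub_right p
  have h2' : ∫ x : E2, (Set.Iio r).indicator (fun s => s⁻¹) ‖x - p‖ = 2 * Real.pi * r := by
    rw [← h2]; exact integral_sub_right_eq_self (fun x : E2 => (Set.Iio r).indicator (fun s => s⁻¹) ‖x‖) p
  have hc : IntegrableOn (fun _ : E2 => r⁻¹) E := by
    simp [lt_top_iff_ne_top, hEf]
  have hle : ∀ z : E2, ‖z - p‖⁻¹ ≤ (Set.Iio r).indicator (fun s => s⁻¹) ‖z - p‖ + r⁻¹ := by
    intro z
    by_cases h : ‖z - p‖ < r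
    · rw [Set.indicator_of_mem (Set.mem_Iio.2 h)]
      have : 0 ≤ r⁻¹ := by positivity
      linarith
    · rw [Set.indicator_of_notMem (by simpa using h)]
      rw [zero_add]
      exact inv_anti₀ hr (not_lt.1 h)
  have hg := h1'.integrableOn.add hc
  have hi : IntegrableOn (fun z => ‖z - p‖⁻¹) E := by
    refine Integrable.mono' hg (by fun_prop) ?_
    refine Eventually.of_forall fun z => ?_
    rw [Real.norm_of_nonneg (by positivity)]
    exact hle z
  refine ⟨hi, ?_⟩
  refine (integral_mono hi hg hle).trans ?_
  simp only [Pi.add_apply]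
  rw [integral_add h1'.integrableOn hc]
  have a1 : ∫ z in E, (Set.Iio r).indicator (fun s => s⁻¹) ‖z - p‖ ≤ 2 * Real.pi * r := by
    rw [← h2']
    apply setIntegral_le_integral h1'
    refine Eventually.of_forall fun z => ?_
    by_cases h : ‖z - p‖ < r
    · simp [Set.indicator, h]
    · simp [Set.indicator, h]
  have a2 : ∫ _ in E, r⁻¹ = volume.real E / r := by
    simp [div_eq_mul_inv]
  linarith

theorem inv_norm_lam (p : E2) : Integrable (fun z => ‖z - p‖⁻¹) lam ∧ ∫ z, ‖z - p‖⁻¹ ∂lam ≤ 8 := by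
  obtain ⟨h1, h2⟩ := inv_norm_bound measurableSet_sq (by simp [volume_sq]) p one_pos
  refine ⟨h1, h2.trans ?_⟩
  have : volume.real Qs = 1 := by simp [Measure.real, volume_sq]
  rw [this]
  have := Real.pi_lt_d2
  linarith

/-- Straight-line kernel: field moving a point `p` to the density `g` along segments. -/
def K (g : E2 → ℝ) (p z : E2) : E2 :=
  (∫ t in Set.Ioo (0 : ℝ) 1, (t ^ 3)⁻¹ * g (p + t⁻¹ • (z - p))) • (z - p)

theorem K_aux {g : E2 → ℝ} (hg : Measurable g) (h0 : ∀ q, 0 ≤ g q) {B : ℝ} (hB : ∀ q, g q ≤ B)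
    {D : ℝ} (hD : 0 < D) {p : E2} (hs : ∀ q, g q ≠ 0 → ‖q - p‖ ≤ D) {z : E2} (hz : z ≠ p) :
    IntegrableOn (fun t : ℝ => (t ^ 3)⁻¹ * g (p + t⁻¹ • (z - p))) (Set.Ioo 0 1) ∧
    ∫ t in Set.Ioo (0 : ℝ) 1, (t ^ 3)⁻¹ * g (p + t⁻¹ • (z - p)) ≤
      B * D ^ 2 / 2 * (‖z - p‖⁻¹) ^ 2 := by
  have hzp : 0 < ‖z - p‖ := norm_pos_iff.2 (sub_ne_zero.2 hz)
  set s := ‖z - p‖ / D with hsdef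
  have hs0 : 0 < s := by positivity
  have hB0 : 0 ≤ B := (h0 0).trans (hB 0)
  have hle : ∀ t ∈ Set.Ioo (0 : ℝ) 1, (t ^ 3)⁻¹ * g (p + t⁻¹ • (z - p)) ≤
      (Set.Ici s).indicator (fun t => B * t ^ (-3 : ℝ)) t := by
    intro t ht
    by_cases h : s ≤ t
    · rw [Set.indicator_of_mem (Set.mem_Ici.2 h), mul_comm]
      have : t ^ (-3 : ℝ) = (t ^ 3)⁻¹ := by
        rw [Real.rpow_neg ht.1.le]; norm_cast
      rw [this]
      have : 0 < t := ht.1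
      gcongr
      exact hB _
    · rw [Set.indicator_of_notMem (by simpa using h)]
      have : g (p + t⁻¹ • (z - p)) = 0 := by
        by_contra hne
        have h1 := hs _ hne
        rw [add_sub_cancel_left, norm_smul, norm_inv, Real.norm_of_nonneg ht.1.le] at h1
        apply h
        rw [hsdef, div_le_iff₀ hD]
        rw [inv_mul_le_iff₀ ht.1] at h1
        exact h1
      simp [this]
  have hi0 : IntegrableOn (fun t : ℝ => B * t ^ (-3 : ℝ)) (Set.Ici s) :=
    ((integrableOn_Ici_iff_integrableOn_Ioi (by simp)).2
      (integrableOn_Ioi_rpow_of_lt (by norm_num) hs0)).const_mul B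
  have hi1 : IntegrableOn ((Set.Ici s).indicator (fun t : ℝ => B * t ^ (-3 : ℝ))) Set.univ := by
    rw [IntegrableOn, Measure.restrict_univ, integrable_indicator_iff measurableSet_Ici]
    exact hi0
  have hi2 := hi1.mono_set (Set.subset_univ (Set.Ioo (0 : ℝ) 1))
  have hnn : ∀ t ∈ Set.Ioo (0 : ℝ) 1, 0 ≤ (t ^ 3)⁻¹ * g (p + t⁻¹ • (z - p)) := by
    intro t ht
    have : 0 < t := ht.1
    have := h0 (p + t⁻¹ • (z - p))
    positivity
  have hi : IntegrableOn (fun t : ℝ => (t ^ 3)⁻¹ * g (p + t⁻¹ • (z - p))) (Set.Ioo 0 1) := by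
    refine Integrable.mono' hi2 ?_ ?_
    · exact (by fun_prop : Measurable _).aestronglyMeasurable
    · refine (ae_restrict_mem measurableSet_Ioo).mono fun t ht => ?_
      rw [Real.norm_of_nonneg (hnn t ht)]
      exact hle t ht
  refine ⟨hi, (setIntegral_mono_on hi hi2 measurableSet_Ioo hle).trans ?_⟩
  have : ∫ t in Set.Ioo (0 : ℝ) 1, (Set.Ici s).indicator (fun t => B * t ^ (-3 : ℝ)) t ≤
      ∫ t, (Set.Ici s).indicator (fun t => B * t ^ (-3 : ℝ)) t := by
    apply setIntegral_le_integral (by simpa using hi1)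
    refine Eventually.of_forall fun t => ?_
    refine Set.indicator_nonneg (fun t ht => ?_) t
    have : 0 < t := hs0.trans_le ht
    positivity
  refine this.trans (le_of_eq ?_)
  rw [integral_indicator measurableSet_Ici, integral_const_mul, integral_Ici_eq_integral_Ioi,
    integral_Ioi_rpow_of_lt (by norm_num) hs0]
  have : s ^ (-3 + 1 : ℝ) = (s ^ 2)⁻¹ := by
    rw [show (-3 + 1 : ℝ) = -2 by norm_num, Real.rpow_neg hs0.le]; norm_cast
  rw [this, hsdef]
  field_simp
  norm_num

theorem K_bound {g : E2 → ℝ} (hg : Measurable g) (h0 : ∀ q, 0 ≤ g q) {B : ℝ} (hB : ∀ q, g q ≤ B)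
    {D : ℝ} (hD : 0 < D) {p : E2} (hs : ∀ q, g q ≠ 0 → ‖q - p‖ ≤ D) (z : E2) :
    ‖K g p z‖ ≤ B * D ^ 2 / 2 * ‖z - p‖⁻¹ := by
  by_cases hz : z = p
  · simp [K, hz]
  have hzp : 0 < ‖z - p‖ := norm_pos_iff.2 (sub_ne_zero.2 hz)
  unfold K
  rw [norm_smul, Real.norm_of_nonneg]
  · have := mul_le_mul_of_nonneg_right (K_aux hg h0 hB hD hs hz).2 hzp.le
    refine this.trans (le_of_eq ?_)
    field_simp
  · apply setIntegral_nonneg measurableSet_Ioo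
    intro t ht
    have : 0 < t := ht.1
    have := h0 (p + t⁻¹ • (z - p))
    positivity

theorem K_zero {g : E2 → ℝ} (hgs : ∀ q, q ∉ Qs → g q = 0) {p : E2} (hp : p ∈ Qs) {z : E2} {t : ℝ}
    (ht : t ∈ Set.Ioo (0 : ℝ) 1) (hz : z ∉ Qs) : g (p + t⁻¹ • (z - p)) = 0 := by
  apply hgs
  intro hq
  apply hz
  have := sq_convex hp hq (sub_nonneg.2 ht.2.le) ht.1.le (by ring)
  convert this using 1
  rw [smul_add, smul_smul, mul_inv_cancel₀ ht.1.ne', sub_smul, one_smul, one_smul]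
  abel

theorem K_measurable {α : Type*} [MeasurableSpace α] {g : α → E2 → ℝ}
    (hg : Measurable (Function.uncurry g)) {P Z : α → E2} (hP : Measurable P) (hZ : Measurable Z) :
    Measurable (fun x => K (g x) (P x) (Z x)) := by
  have : Measurable (fun y : α × ℝ => (y.2 ^ 3)⁻¹ * g y.1 (P y.1 + y.2⁻¹ • (Z y.1 - P y.1))) := by
    have h2 : Measurable (fun y : α × ℝ => g y.1 (P y.1 + y.2⁻¹ • (Z y.1 - P y.1))) := by
      apply hg.comp (g := Function.uncurry g) (f := fun y : α × ℝ => (y.1, P y.1 + y.2⁻¹ • (Z y.1 - P y.1)))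
      fun_prop
    fun_prop
  have h3 := (this.stronglyMeasurable.integral_prod_right'
    (ν := volume.restrict (Set.Ioo (0:ℝ) 1))).measurable
  exact Measurable.smul h3 (hZ.sub hP)

theorem lam_of_support {f : E2 → ℝ} (h : ∀ z, z ∉ Qs → f z = 0) : ∫ z, f z ∂lam = ∫ z, f z :=
  setIntegral_eq_integral_of_forall_compl_eq_zero h

theorem K_scale {g : E2 → ℝ} (hgs : ∀ q, q ∉ Qs → g q = 0) {p : E2} (hp : p ∈ Qs) (G : E2 → E2)
    {t : ℝ} (ht : t ∈ Set.Ioo (0 : ℝ) 1) :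
    ∫ q, g q * inner ℝ (G (p + t • (q - p))) (q - p) ∂lam =
      ∫ z, (t ^ 3)⁻¹ * g (p + t⁻¹ • (z - p)) * inner ℝ (G z) (z - p) ∂lam := by
  rw [lam_of_support (fun q hq => by simp [hgs q hq]),
    lam_of_support (fun z hz => by simp [K_zero hgs hp ht hz])]
  have ht0 := ht.1
  set Φ : E2 → ℝ := fun w => g (p + t⁻¹ • w) * inner ℝ (G (p + w)) (t⁻¹ • w) with hΦ
  have e1 : ∀ q, g q * inner ℝ (G (p + t • (q - p))) (q - p) = Φ (t • (q - p)) := by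
    intro q
    simp only [hΦ, smul_smul, inv_mul_cancel₀ ht0.ne', one_smul, add_sub_cancel]
  have e2 : ∀ z, (t ^ 3)⁻¹ * g (p + t⁻¹ • (z - p)) * inner ℝ (G z) (z - p) =
      (t ^ 2)⁻¹ * Φ (z - p) := by
    intro z
    simp only [hΦ, inner_smul_right, add_sub_cancel]
    field_simp
  simp_rw [e1, e2]
  rw [integral_sub_right_eq_self (fun q => Φ (t • q)) p, integral_const_mul,
    integral_sub_right_eq_self Φ p, Measure.integral_comp_smul_of_nonneg volume Φ t (hR := ht0.le)]
  simp

theorem segment_ftc {φ : E2 → ℝ} {G : E2 → E2} (hG : Continuous G)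
    (hφ : ∀ x, HasGradientAt φ (G x) x) (p q : E2) :
    φ q - φ p = ∫ t in Set.Ioo (0 : ℝ) 1, inner ℝ (G (p + t • (q - p))) (q - p) := by
  rw [← integral_Ioc_eq_integral_Ioo, ← intervalIntegral.integral_of_le zero_le_one]
  have hd : ∀ t ∈ Set.uIcc (0 : ℝ) 1, HasDerivAt (fun t : ℝ => φ (p + t • (q - p)))
      (inner ℝ (G (p + t • (q - p))) (q - p)) t := by
    intro t _
    have h1 : HasDerivAt (fun t : ℝ => p + t • (q - p)) (q - p) t := by
      simpa using ((hasDerivAt_id t).smul_const (q - p)).const_add p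
    have h2 := (hφ (p + t • (q - p))).hasFDerivAt.comp_hasDerivAt t h1
    rw [InnerProductSpace.toDual_apply_apply] at h2
    exact h2
  rw [intervalIntegral.integral_eq_sub_of_hasDerivAt hd]
  · simp
  · apply Continuous.intervalIntegrable
    fun_prop

theorem K_int {g : E2 → ℝ} (hg : Dens g) (hgs : ∀ q, q ∉ Qs → g q = 0) {p : E2} (hp : p ∈ Qs) :
    ∃ C, 0 ≤ C ∧ (∀ z, z ≠ p → IntegrableOn
      (fun t : ℝ => (t ^ 3)⁻¹ * g (p + t⁻¹ • (z - p))) (Set.Ioo 0 1) ∧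
      ∫ t in Set.Ioo (0 : ℝ) 1, (t ^ 3)⁻¹ * g (p + t⁻¹ • (z - p)) ≤ C * (‖z - p‖⁻¹) ^ 2) := by
  obtain ⟨B, hB⟩ := hg.bdd
  have : 0 ≤ B := (hg.nonneg 0).trans (hB 0)
  refine ⟨B * 2 ^ 2 / 2, by positivity, fun z hz => K_aux hg.meas hg.nonneg hB two_pos ?_ hz⟩
  intro q hq
  have : q ∈ Qs := by
    by_contra h
    exact hq (hgs q h)
  exact sq_diam' (sq_subset this) (sq_subset hp)

theorem ae_ne (p : E2) : ∀ᵐ z ∂lam, z ≠ p := by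
  have : ∀ᵐ z : E2, z ≠ p := by
    simp [ae_iff]
  exact ae_restrict_of_ae this

theorem K_id {g : E2 → ℝ} (hg : Dens g) (hgs : ∀ q, q ∉ Qs → g q = 0) {p : E2} (hp : p ∈ Qs)
    {φ : E2 → ℝ} {G : E2 → E2} (hG : Continuous G)
    (hφ : ∀ x, HasGradientAt φ (G x) x) {L : ℝ} (hL : ∀ x, ‖G x‖ ≤ L) :
    ∫ q, (φ q - φ p) * g q ∂lam = ∫ z, inner ℝ (G z) (K g p z) ∂lam := by
  have hL0 : 0 ≤ L := (norm_nonneg _).trans (hL 0)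
  have hgm := hg.meas
  have hGm := hG.measurable
  obtain ⟨B, hB⟩ := hg.bdd
  have hB0 : 0 ≤ B := (hg.nonneg 0).trans (hB 0)
  have e1 : ∀ q, (φ q - φ p) * g q =
      ∫ t in Set.Ioo (0 : ℝ) 1, g q * inner ℝ (G (p + t • (q - p))) (q - p) := by
    intro q
    rw [segment_ftc hG hφ p q, mul_comm, ← integral_const_mul]
  simp_rw [e1]
  rw [integral_integral_swap]
  swap
  · refine Integrable.of_bound ?_ (B * (L * 2)) ?_
    · refine (Measurable.aestronglyMeasurable ?_)
      simp only [Function.uncurry_def]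
      fun_prop
    · have : ∀ᵐ y ∂(lam.prod (volume.restrict (Set.Ioo (0 : ℝ) 1))), y.1 ∈ Qs :=
        Measure.quasiMeasurePreserving_fst.ae ae_lam
      refine this.mono fun y hy => ?_
      simp only [Function.uncurry_def]
      rw [norm_mul, Real.norm_of_nonneg (hg.nonneg _)]
      gcongr
      · exact hB _
      · refine (norm_inner_le_norm _ _).trans ?_
        gcongr
        · exact hL _
        · exact sq_diam' (sq_subset hy) (sq_subset hp)
  rw [setIntegral_congr_fun measurableSet_Ioo (fun t ht => K_scale hgs hp G ht)]
  rw [integral_integral_swap]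
  · apply integral_congr_ae
    refine Eventually.of_forall fun z => ?_
    simp only [K, inner_smul_right]
    rw [integral_mul_const]
  · obtain ⟨C, hC0, hC⟩ := K_int hg hgs hp
    have hm : Measurable (Function.uncurry fun (t : ℝ) (z : E2) =>
        (t ^ 3)⁻¹ * g (p + t⁻¹ • (z - p)) * inner ℝ (G z) (z - p)) := by
      simp only [Function.uncurry_def]
      fun_prop
    rw [integrable_prod_iff' hm.aestronglyMeasurable]
    constructor
    · refine (ae_ne p).mono fun z hz => ?_
      simp only [Function.uncurry_apply_pair]
      exact (hC z hz).1.mul_const _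
    · refine Integrable.mono' (((inv_norm_lam p).1.const_mul (C * L))) ?_ ?_
      · exact (hm.norm.stronglyMeasurable.integral_prod_left').aestronglyMeasurable
      · refine (ae_ne p).mono fun z hz => ?_
        have hzp : 0 < ‖z - p‖ := norm_pos_iff.2 (sub_ne_zero.2 hz)
        rw [Real.norm_of_nonneg (integral_nonneg fun _ => norm_nonneg _)]
        have : ∫ t in Set.Ioo (0 : ℝ) 1, ‖Function.uncurry (fun (t : ℝ) (z : E2) =>
            (t ^ 3)⁻¹ * g (p + t⁻¹ • (z - p)) * inner ℝ (G z) (z - p)) (t, z)‖ =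
            (∫ t in Set.Ioo (0 : ℝ) 1, (t ^ 3)⁻¹ * g (p + t⁻¹ • (z - p))) *
              ‖(inner ℝ (G z) (z - p) : ℝ)‖ := by
          rw [← integral_mul_const]
          apply setIntegral_congr_fun measurableSet_Ioo
          intro t ht
          have h1 : 0 < t := ht.1
          have h2 := hg.nonneg (p + t⁻¹ • (z - p))
          simp only [Function.uncurry_apply_pair, norm_mul]
          rw [Real.norm_of_nonneg (by positivity), Real.norm_of_nonneg h2]
        rw [this]
        calc _ ≤ (C * (‖z - p‖⁻¹) ^ 2) * (L * ‖z - p‖) := by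
              gcongr
              · exact (hC z hz).2
              · exact (norm_inner_le_norm _ _).trans (by gcongr; exact hL _)
          _ = _ := by field_simp

/-- Field transporting density `f` to density `g`. -/
def Av (f g : E2 → ℝ) (z : E2) : E2 := ∫ p, f p • K g p z ∂lam

theorem Av_bound {f g : E2 → ℝ} (hf : ∀ z, 0 ≤ f z) {c : ℝ}
    (hK : ∀ p ∈ Qs, ∀ z, f p ≠ 0 → ‖K g p z‖ ≤ c * ‖z - p‖⁻¹) (z : E2)
    (hi : Integrable (fun p => f p * ‖z - p‖⁻¹) lam) :
    ‖Av f g z‖ ≤ c * ∫ p, f p * ‖z - p‖⁻¹ ∂lam := by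
  unfold Av
  rw [← integral_const_mul]
  refine norm_integral_le_of_norm_le (hi.const_mul c) (ae_lam.mono fun p hp => ?_)
  rw [norm_smul, Real.norm_of_nonneg (hf p)]
  by_cases h : f p = 0
  · simp [h]
  · have := mul_le_mul_of_nonneg_left (hK p hp z h) (hf p)
    linarith

theorem inv_norm_lam' (z : E2) :
    Integrable (fun p => ‖z - p‖⁻¹) lam ∧ ∫ p, ‖z - p‖⁻¹ ∂lam ≤ 8 := by
  simp_rw [norm_sub_rev z]
  exact inv_norm_lam z

theorem Dens.pot_integrable {f : E2 → ℝ} (hf : Dens f) (z : E2) :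
    Integrable (fun p => f p * ‖z - p‖⁻¹) lam := by
  obtain ⟨B, hB⟩ := hf.bdd
  refine ((inv_norm_lam' z).1.const_mul B).mono' ?_ (Eventually.of_forall fun p => ?_)
  · have := hf.meas
    exact (by fun_prop : Measurable _).aestronglyMeasurable
  · have := hf.nonneg p
    rw [Real.norm_of_nonneg (by positivity)]
    gcongr
    exact hB p

theorem Dens.pot_bound {f : E2 → ℝ} (hf : Dens f) {B : ℝ} (hB : ∀ z, f z ≤ B) (z : E2) :
    ∫ p, f p * ‖z - p‖⁻¹ ∂lam ≤ 8 * B := by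
  have hB0 : 0 ≤ B := (hf.nonneg 0).trans (hB 0)
  have := integral_mono (hf.pot_integrable z) ((inv_norm_lam' z).1.const_mul B) (fun p => by
    simp only
    gcongr
    exact hB p)
  rw [integral_const_mul] at this
  nlinarith [(inv_norm_lam' z).2]

theorem Av_measurable {α : Type*} [MeasurableSpace α] {f g : α → E2 → ℝ}
    (hf : Measurable (Function.uncurry f)) (hg : Measurable (Function.uncurry g)) :
    Measurable (fun y : α × E2 => Av (f y.1) (g y.1) y.2) := by
  unfold Av
  have h1 : Measurable (fun u : (α × E2) × E2 => K (g u.1.1) u.2 u.1.2) :=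
    K_measurable (g := fun u : (α × E2) × E2 => g u.1.1)
      (hg.comp (by fun_prop : Measurable (fun v : ((α × E2) × E2) × E2 => (v.1.1.1, v.2))))
      measurable_snd (by fun_prop)
  have h2 : Measurable (fun u : (α × E2) × E2 => f u.1.1 u.2) :=
    hf.comp (by fun_prop : Measurable (fun v : (α × E2) × E2 => (v.1.1, v.2)))
  have := (h2.smul h1).stronglyMeasurable.integral_prod_right' (ν := lam)
  exact this.measurable

theorem weak_Av {f g : E2 → ℝ} (hf : Dens f) (hg : Dens g) (hgs : ∀ q, q ∉ Qs → g q = 0) :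
    Weak f g (Av f g) := by
  intro φ G hG hφ ⟨L, hL⟩
  have hL0 : 0 ≤ L := (norm_nonneg _).trans (hL 0)
  have hφc : Continuous φ := continuous_iff_continuousAt.2 fun x => (hφ x).hasFDerivAt.continuousAt
  obtain ⟨B, hB⟩ := hg.bdd
  obtain ⟨B', hB'⟩ := hf.bdd
  have hB0 : 0 ≤ B := (hg.nonneg 0).trans (hB 0)
  have hB0' : 0 ≤ B' := (hf.nonneg 0).trans (hB' 0)
  have hKb : ∀ p ∈ Qs, ∀ z, ‖K g p z‖ ≤ (B * 2 ^ 2 / 2) * ‖z - p‖⁻¹ := by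
    intro p hp z
    refine K_bound hg.meas hg.nonneg hB two_pos ?_ z
    intro q hq
    have : q ∈ Qs := by
      by_contra h
      exact hq (hgs q h)
    exact sq_diam' (sq_subset this) (sq_subset hp)
  have hKm : Measurable (fun y : E2 × E2 => K g y.1 y.2) :=
    K_measurable (g := fun _ : E2 × E2 => g) (hg.meas.comp measurable_snd) measurable_fst measurable_snd
  have hfK : ∀ z, Integrable (fun p => f p • K g p z) lam := by
    intro z
    refine ((hf.pot_integrable z).const_mul (B * 2 ^ 2 / 2)).mono' ?_ (ae_lam.mono fun p hp => ?_)
    · have h1 := hf.meas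
      have h2 : Measurable (fun p => K g p z) := hKm.comp (by fun_prop : Measurable fun p : E2 => (p, z))
      exact (h1.smul h2).aestronglyMeasurable
    · rw [norm_smul, Real.norm_of_nonneg (hf.nonneg p)]
      have := mul_le_mul_of_nonneg_left (hKb p hp z) (hf.nonneg p)
      linarith
  have e1 : den g φ - den f φ = ∫ p, f p * ∫ q, (φ q - φ p) * g q ∂lam ∂lam := by
    have : ∀ p, f p * ∫ q, (φ q - φ p) * g q ∂lam = den g φ * f p - φ p * f p := by
      intro p
      have h1 : ∫ q, (φ q - φ p) * g q ∂lam = den g φ - φ p := by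
        simp_rw [sub_mul]
        rw [integral_sub (hg.integrable_mul hφc) (hg.integrable.const_mul _), integral_const_mul, hg.mass]
        simp [den]
      rw [h1]; ring
    simp_rw [this]
    rw [integral_sub (hf.integrable.const_mul _) (hf.integrable_mul hφc), integral_const_mul, hf.mass]
    simp [den]
  rw [e1]
  have e2 : ∫ p, f p * ∫ q, (φ q - φ p) * g q ∂lam ∂lam =
      ∫ p, ∫ z, f p * inner ℝ (G z) (K g p z) ∂lam ∂lam := by
    apply integral_congr_ae
    refine ae_lam.mono fun p hp => ?_
    simp only
    rw [K_id hg hgs hp hG hφ hL, integral_const_mul]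
  rw [e2, integral_integral_swap]
  · apply integral_congr_ae
    refine Eventually.of_forall fun z => ?_
    simp only [Av]
    rw [← integral_inner (hfK z)]
    simp only [inner_smul_right]
  · have hm : Measurable (Function.uncurry fun (p z : E2) => f p * inner ℝ (G z) (K g p z)) := by
      simp only [Function.uncurry_def]
      have h1 := hf.meas
      have h2 := hG.measurable
      exact (h1.comp measurable_fst).mul ((h2.comp measurable_snd).inner hKm)
    have hbd : ∀ p ∈ Qs, ∀ z, ‖f p * inner ℝ (G z) (K g p z)‖ ≤
        (B' * L * (B * 2 ^ 2 / 2)) * ‖z - p‖⁻¹ := by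
      intro p hp z
      rw [norm_mul, Real.norm_of_nonneg (hf.nonneg p)]
      calc _ ≤ B' * (L * ((B * 2 ^ 2 / 2) * ‖z - p‖⁻¹)) := by
            gcongr
            · exact hB' p
            · refine (norm_inner_le_norm _ _).trans ?_
              gcongr
              · exact hL z
              · exact hKb p hp z
        _ = _ := by ring
    have hin : ∀ p ∈ Qs, Integrable (fun z => f p * inner ℝ (G z) (K g p z)) lam := by
      intro p hp
      refine ((inv_norm_lam p).1.const_mul (B' * L * (B * 2 ^ 2 / 2))).mono' ?_
        (Eventually.of_forall fun z => hbd p hp z)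
      exact (hm.comp (by fun_prop : Measurable fun z : E2 => (p, z))).aestronglyMeasurable
    rw [integrable_prod_iff hm.aestronglyMeasurable]
    refine ⟨ae_lam.mono hin, ?_⟩
    refine integrable_lam_of_bdd (B := (B' * L * (B * 2 ^ 2 / 2)) * 8) ?_ ?_
    · exact (hm.norm.stronglyMeasurable.integral_prod_right').aestronglyMeasurable
    · intro p hp
      rw [Real.norm_of_nonneg (integral_nonneg fun _ => norm_nonneg _)]
      refine (integral_mono (hin p hp).norm ((inv_norm_lam p).1.const_mul (B' * L * (B * 2 ^ 2 / 2)))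
        (hbd p hp)).trans ?_
      rw [integral_const_mul]
      have := (inv_norm_lam p).2
      gcongr

/-! ### Cells and the fields `V` -/

open Classical in
/-- Normalised indicator of the grid cell containing `x`. -/
def w0 (m : ℕ) (x p : E2) : ℝ := if (∀ i, ⌊(m : ℝ) * x i⌋ = ⌊(m : ℝ) * p i⌋) then (m : ℝ) ^ 2 else 0

theorem w0_symm (m : ℕ) (x p : E2) : w0 m x p = w0 m p x := by
  unfold w0
  simp only [eq_comm]

theorem w0_nonneg (m : ℕ) (x p : E2) : 0 ≤ w0 m x p := by
  unfold w0; split_ifs <;> positivity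

theorem w0_le (m : ℕ) (x p : E2) : w0 m x p ≤ (m : ℝ) ^ 2 := by
  unfold w0; split_ifs
  · exact le_rfl
  · positivity

theorem w0_measurable (m : ℕ) : Measurable (Function.uncurry (w0 m)) := by
  unfold w0
  simp only [Function.uncurry_def]
  refine Measurable.ite ?_ measurable_const measurable_const
  rw [Set.ofPred_forall]
  refine MeasurableSet.iInter fun i => ?_
  exact measurableSet_eq_fun (by fun_prop) (by fun_prop)

theorem w0_eq_indicator {m : ℕ} (hm : 0 < m) (x : E2) :
    w0 m x = {p : E2 | ∀ i, p i ∈ Set.Ico ((⌊(m : ℝ) * x i⌋ : ℝ) / m) ((⌊(m : ℝ) * x i⌋ + 1 : ℝ) / m)}.indicator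
      (fun _ => (m : ℝ) ^ 2) := by
  have hm' : (0 : ℝ) < m := by exact_mod_cast hm
  ext p
  unfold w0 Set.indicator
  congr 1
  apply propext
  simp only [Set.mem_ofPred_eq]
  refine forall_congr' fun i => ?_
  rw [eq_comm, Int.floor_eq_iff, Set.mem_Ico, div_le_iff₀ hm', lt_div_iff₀ hm', mul_comm (p i)]

theorem w0_supp {m : ℕ} (hm : 0 < m) {x : E2} (hx : x ∈ Qs) {p : E2} (hp : p ∉ Qs) : w0 m x p = 0 := by
  have hm' : (0 : ℝ) < m := by exact_mod_cast hm
  by_contra h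
  apply hp
  have hc : ∀ i, ⌊(m : ℝ) * x i⌋ = ⌊(m : ℝ) * p i⌋ := by
    by_contra h'
    exact h (by simp [w0, h'])
  intro i
  have h1 : (0 : ℤ) ≤ ⌊(m : ℝ) * x i⌋ := Int.floor_nonneg.2 (mul_nonneg hm'.le (hx i).1)
  have h2 : ⌊(m : ℝ) * x i⌋ < (m : ℤ) := by
    rw [Int.floor_lt]
    push_cast
    nlinarith [(hx i).2]
  rw [hc i] at h1 h2
  rw [Int.floor_nonneg] at h1
  rw [Int.floor_lt] at h2
  push_cast at h2
  exact ⟨by nlinarith, by nlinarith⟩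

theorem w0_near {m : ℕ} (hm : 0 < m) {x p : E2} (h : w0 m x p ≠ 0) : ‖p - x‖ ≤ 2 / m := by
  have hm' : (0 : ℝ) < m := by exact_mod_cast hm
  have hc : ∀ i, ⌊(m : ℝ) * x i⌋ = ⌊(m : ℝ) * p i⌋ := by
    by_contra h'
    exact h (by simp [w0, h'])
  have h1 : ∀ i, |p i - x i| ≤ 1 / m := by
    intro i
    have a := Int.abs_sub_lt_one_of_floor_eq_floor (hc i)
    rw [← mul_sub, abs_mul, abs_of_pos hm', abs_sub_comm] at a
    rw [le_div_iff₀ hm']; linarith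
  rw [EuclideanSpace.norm_eq]
  apply Real.sqrt_le_iff.2
  refine ⟨by positivity, ?_⟩
  rw [Fin.sum_univ_two]
  simp only [PiLp.sub_apply, Real.norm_eq_abs]
  have b0 := pow_le_pow_left₀ (abs_nonneg _) (h1 0) 2
  have b1 := pow_le_pow_left₀ (abs_nonneg _) (h1 1) 2
  have : (2 / m : ℝ) ^ 2 = 4 * (1 / m) ^ 2 := by ring
  have := sq_nonneg (1 / m : ℝ)
  linarith

theorem cell_volume {m : ℕ} (hm : 0 < m) (x : E2) :
    volume {p : E2 | ∀ i, p i ∈ Set.Ico ((⌊(m : ℝ) * x i⌋ : ℝ) / m) ((⌊(m : ℝ) * x i⌋ + 1 : ℝ) / m)} =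
      ENNReal.ofReal (((m : ℝ) ^ 2)⁻¹) := by
  have hm' : (0 : ℝ) < m := by exact_mod_cast hm
  rw [volume_box (fun i => (⌊(m : ℝ) * x i⌋ : ℝ) / m) (fun i => (⌊(m : ℝ) * x i⌋ + 1 : ℝ) / m)]
  rw [Fin.prod_univ_two, ← ENNReal.ofReal_mul]
  · congr 1
    field_simp
    ring
  · apply sub_nonneg.2
    gcongr
    linarith

theorem w0_int {m : ℕ} (hm : 0 < m) {x : E2} (hx : x ∈ Qs) : ∫ p, w0 m x p ∂lam = 1 := by
  have hm' : (0 : ℝ) < m := by exact_mod_cast hm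
  rw [lam_of_support (fun p hp => w0_supp hm hx hp), w0_eq_indicator hm,
    integral_indicator (measurableSet_box _ _), integral_const, Measure.real, Measure.restrict_apply_univ,
    cell_volume hm, ENNReal.toReal_ofReal (by positivity)]
  simp
  field_simp

theorem w0_dens {m : ℕ} (hm : 0 < m) {x : E2} (hx : x ∈ Qs) : Dens (w0 m x) :=
  ⟨(w0_measurable m).comp (by fun_prop : Measurable fun p : E2 => (x, p)), w0_nonneg m x,
    ⟨_, w0_le m x⟩, w0_int hm hx⟩

/-- radial majorant -/
def hh (d s : ℝ) : ℝ := if 2 * d ≤ s then (s - d)⁻¹ else 16 / d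

theorem hh_nonneg {d : ℝ} (hd : 0 < d) (s : ℝ) : 0 ≤ hh d s := by
  unfold hh; split_ifs with h
  · exact inv_nonneg.2 (by linarith)
  · positivity

theorem hh_le {d : ℝ} (hd : 0 < d) (s : ℝ) : hh d s ≤ 16 / d := by
  unfold hh; split_ifs with h
  · rw [inv_eq_one_div]
    apply div_le_div₀ <;> linarith
  · exact le_rfl

theorem hh_sq_mul {d : ℝ} (hd : 0 < d) {s : ℝ} (hs : 0 ≤ s) : hh d s ^ 2 * s ≤ 1024 * s⁻¹ := by
  rcases hs.eq_or_lt with rfl | hs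
  · simp
  have : hh d s ≤ 32 * s⁻¹ := by
    unfold hh; split_ifs with h
    · rw [inv_eq_one_div, ← div_eq_mul_inv, div_le_div_iff₀] <;> linarith
    · rw [← div_eq_mul_inv, div_le_div_iff₀] <;> linarith
  have h2 := pow_le_pow_left₀ (hh_nonneg hd s) this 2
  calc hh d s ^ 2 * s ≤ (32 * s⁻¹) ^ 2 * s := by gcongr
    _ = 1024 * s⁻¹ := by field_simp; norm_num

theorem hh_measurable (d : ℝ) : Measurable (hh d) := by
  unfold hh
  exact Measurable.ite (measurableSet_le measurable_const measurable_id) (by fun_prop) measurable_const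

theorem w0_pot {m : ℕ} (hm : 0 < m) {x : E2} (hx : x ∈ Qs) (z : E2) :
    ∫ p, w0 m x p * ‖z - p‖⁻¹ ∂lam ≤ hh (2 / m) ‖x - z‖ := by
  have hm' : (0 : ℝ) < m := by exact_mod_cast hm
  have hd : (0 : ℝ) < 2 / m := by positivity
  have hD := w0_dens hm hx
  unfold hh
  split_ifs with h
  · have hle : ∀ p, w0 m x p * ‖z - p‖⁻¹ ≤ w0 m x p * (‖x - z‖ - 2 / m)⁻¹ := by
      intro p
      by_cases hp : w0 m x p = 0
      · simp [hp]
      have h1 := w0_near hm hp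
      have h2 : ‖x - z‖ ≤ ‖z - p‖ + ‖p - x‖ := by
        rw [norm_sub_rev x z]
        exact norm_sub_le_norm_sub_add_norm_sub z p x
      have := w0_nonneg m x p
      gcongr
      · linarith
      · linarith
    refine (integral_mono (hD.pot_integrable z) (hD.integrable.mul_const _) hle).trans ?_
    rw [integral_mul_const, hD.mass, one_mul]
  · set E := {p : E2 | ∀ i, p i ∈ Set.Ico ((⌊(m : ℝ) * x i⌋ : ℝ) / m) ((⌊(m : ℝ) * x i⌋ + 1 : ℝ) / m)} with hE
    have hEm : MeasurableSet E := measurableSet_box _ _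
    have hv : volume E = ENNReal.ofReal (((m : ℝ) ^ 2)⁻¹) := cell_volume hm x
    have hb := (inv_norm_bound hEm (by rw [hv]; simp) z (r := 1 / m) (by positivity)).2
    rw [lam_of_support (fun p hp => by simp [w0_supp hm hx hp])]
    have e : (fun p => w0 m x p * ‖z - p‖⁻¹) = E.indicator (fun p => (m : ℝ) ^ 2 * ‖p - z‖⁻¹) := by
      ext p
      rw [w0_eq_indicator hm, ← hE, norm_sub_rev z p]
      by_cases hp : p ∈ E <;> simp [hp]
    rw [e, integral_indicator hEm, integral_const_mul]
    have hvr : volume.real E = ((m : ℝ) ^ 2)⁻¹ := by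
      rw [Measure.real, hv, ENNReal.toReal_ofReal (by positivity)]
    rw [hvr] at hb
    have := mul_le_mul_of_nonneg_left hb (by positivity : (0 : ℝ) ≤ (m : ℝ) ^ 2)
    refine this.trans ?_
    have e2 : (m : ℝ) ^ 2 * (2 * Real.pi * (1 / m) + ((m : ℝ) ^ 2)⁻¹ / (1 / m)) = (2 * Real.pi + 1) * m := by
      field_simp
    have e3 : 16 / (2 / m : ℝ) = 8 * m := by field_simp; norm_num
    rw [e2, e3]
    gcongr
    linarith [Real.pi_lt_d2]

/-- Uniform density on the ball of radius `δ` around `x`. -/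
def ub (δ : ℝ) (x p : E2) : ℝ := (Metric.ball x δ).indicator (fun _ => (Real.pi * δ ^ 2)⁻¹) p

/-- Inner square. -/
def Inn (δ : ℝ) : Set E2 := {x | ∀ i, x i ∈ Set.Ico δ (1 - δ)}

theorem measurableSet_Inn (δ : ℝ) : MeasurableSet (Inn δ) := measurableSet_box _ _

theorem ub_nonneg {δ : ℝ} (x p : E2) : 0 ≤ ub δ x p :=
  Set.indicator_nonneg (fun _ _ => by have := Real.pi_pos; positivity) _

theorem ub_le {δ : ℝ} (x p : E2) : ub δ x p ≤ (Real.pi * δ ^ 2)⁻¹ :=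
  Set.indicator_le_self' (fun _ _ => by have := Real.pi_pos; positivity) _

theorem ub_supp {δ : ℝ} {x : E2} (hx : x ∈ Inn δ) {p : E2} (hp : p ∉ Qs) : ub δ x p = 0 := by
  apply Set.indicator_of_notMem
  intro hb
  apply hp
  intro i
  have h1 : |p i - x i| ≤ ‖p - x‖ := by
    have := PiLp.norm_apply_le (p - x) i
    simpa using this
  rw [Metric.mem_ball, dist_eq_norm] at hb
  have := abs_lt.1 (h1.trans_lt hb)
  have := hx i
  exact ⟨by linarith [this.1], by linarith [this.2]⟩

theorem ub_measurable (δ : ℝ) : Measurable (Function.uncurry (ub δ)) := by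
  have : Function.uncurry (ub δ) = {y : E2 × E2 | dist y.2 y.1 < δ}.indicator
      (fun _ => (Real.pi * δ ^ 2)⁻¹) := by
    ext ⟨x, p⟩
    simp [ub, Set.indicator]
  rw [this]
  exact measurable_const.indicator (measurableSet_lt (by fun_prop) measurable_const)

theorem ub_dens {δ : ℝ} (hδ : 0 < δ) {x : E2} (hx : x ∈ Inn δ) : Dens (ub δ x) := by
  refine ⟨(ub_measurable δ).of_uncurry_left, ub_nonneg x,
    ⟨_, ub_le x⟩, ?_⟩
  rw [lam_of_support (fun p hp => ub_supp hx hp)]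
  unfold ub
  rw [integral_indicator Metric.isOpen_ball.measurableSet, integral_const, Measure.real,
    Measure.restrict_apply_univ, EuclideanSpace.volume_ball_fin_two, ENNReal.toReal_mul,
    ENNReal.toReal_pow, ENNReal.toReal_ofReal hδ.le, ENNReal.toReal_ofReal Real.pi_pos.le]
  have := Real.pi_pos
  simp
  field_simp

/-- Uniform density on the square. -/
def oneQ : E2 → ℝ := Qs.indicator (fun _ => 1)

theorem oneQ_dens : Dens oneQ := by
  refine ⟨measurable_const.indicator measurableSet_sq, Set.indicator_nonneg (fun _ _ => zero_le_one),
    ⟨1, Set.indicator_le_self' (fun _ _ => zero_le_one)⟩, ?_⟩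
  have : ∫ z, oneQ z ∂lam = ∫ z, (1 : ℝ) ∂lam := by
    apply integral_congr_ae
    exact ae_lam.mono fun z hz => by simp [oneQ, hz]
  rw [this]; simp

theorem oneQ_supp {q : E2} (hq : q ∉ Qs) : oneQ q = 0 := Set.indicator_of_notMem hq _

theorem oneQ_K {p : E2} (hp : p ∈ Qs) (z : E2) : ‖K oneQ p z‖ ≤ 2 * ‖z - p‖⁻¹ := by
  have := K_bound oneQ_dens.meas oneQ_dens.nonneg (B := 1)
    (Set.indicator_le_self' (fun _ _ => zero_le_one)) two_pos (p := p) (fun q hq => by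
      have : q ∈ Qs := by
        by_contra h
        exact hq (oneQ_supp h)
      exact sq_diam' (sq_subset this) (sq_subset hp)) z
  norm_num at this
  exact this

open Classical in
/-- The field from the cell of `x` to the uniform density. -/
def V (m : ℕ) (δ : ℝ) (x z : E2) : E2 :=
  if x ∈ Inn δ then Av (w0 m x) (ub δ x) z + Av (ub δ x) oneQ z else Av (w0 m x) oneQ z

theorem V_measurable (m : ℕ) (δ : ℝ) : Measurable (fun y : E2 × E2 => V m δ y.1 y.2) := by
  unfold V
  have h1 : Measurable (Function.uncurry fun _ : E2 => oneQ) := oneQ_dens.meas.comp measurable_snd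
  refine Measurable.ite (measurable_fst (measurableSet_Inn δ)) ?_ ?_
  · have a1 := Av_measurable (f := w0 m) (g := ub δ) (w0_measurable m) (ub_measurable δ)
    have a2 := Av_measurable (f := ub δ) (g := fun _ => oneQ) (ub_measurable δ) h1
    exact a1.add a2
  · exact Av_measurable (f := w0 m) (g := fun _ => oneQ) (w0_measurable m) h1

open Classical in
/-- Leading coefficient. -/
def kap (m : ℕ) (δ : ℝ) (x : E2) : ℝ :=
  if x ∈ Inn δ then (Real.pi * δ ^ 2)⁻¹ * (δ + 2 / m) ^ 2 / 2 else 2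

theorem ub_K {m : ℕ} (hm : 0 < m) {δ : ℝ} (hδ : 0 < δ) {x p : E2} (hx : x ∈ Inn δ) (z : E2)
    (hp : w0 m x p ≠ 0) : ‖K (ub δ x) p z‖ ≤ (Real.pi * δ ^ 2)⁻¹ * (δ + 2 / m) ^ 2 / 2 * ‖z - p‖⁻¹ := by
  have hm' : (0 : ℝ) < m := by exact_mod_cast hm
  refine K_bound (ub_dens hδ hx).meas (ub_nonneg x) (ub_le x) (by positivity) ?_ z
  intro q hq
  have h1 : ‖q - x‖ < δ := by
    by_contra h
    apply hq
    apply Set.indicator_of_notMem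
    rw [Metric.mem_ball, dist_eq_norm]
    exact h
  have h2 := w0_near hm hp
  have h3 := norm_sub_le_norm_sub_add_norm_sub q x p
  rw [norm_sub_rev x p] at h3
  linarith

theorem V_bound {m : ℕ} (hm : 0 < m) {δ : ℝ} (hδ : 0 < δ) {x : E2} (hx : x ∈ Qs) (z : E2) :
    ‖V m δ x z‖ ≤ kap m δ x * hh (2 / m) ‖x - z‖ + 16 * (Real.pi * δ ^ 2)⁻¹ := by
  have hm' : (0 : ℝ) < m := by exact_mod_cast hm
  have hpi := Real.pi_pos
  have hw := w0_pot hm hx z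
  have hD := w0_dens hm hx
  unfold V kap
  split_ifs with h
  · refine (norm_add_le _ _).trans (add_le_add ?_ ?_)
    · refine (Av_bound hD.nonneg (fun p _ z hp => ub_K hm hδ h z hp) z (hD.pot_integrable z)).trans ?_
      gcongr
    · have hU := ub_dens hδ h
      refine (Av_bound hU.nonneg (fun p hp z _ => oneQ_K hp z) z (hU.pot_integrable z)).trans ?_
      have := hU.pot_bound (ub_le x) z
      linarith
  · refine (Av_bound hD.nonneg (fun p hp z _ => oneQ_K hp z) z (hD.pot_integrable z)).trans ?_
    have : 0 ≤ 16 * (Real.pi * δ ^ 2)⁻¹ := by positivity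
    linarith

theorem Weak.trans {f g h : E2 → ℝ} {W W' : E2 → E2} (h1 : Weak f g W) (h2 : Weak g h W')
    (hW : Integrable W lam) (hW' : Integrable W' lam) : Weak f h (fun z => W z + W' z) := by
  intro φ G hG hφ hL
  have a1 := h1 φ G hG hφ hL
  have a2 := h2 φ G hG hφ hL
  obtain ⟨L, hL⟩ := hL
  have hI : ∀ W : E2 → E2, Integrable W lam → Integrable (fun z => inner ℝ (G z) (W z)) lam := by
    intro W hW
    refine (hW.norm.const_mul L).mono' (hG.aestronglyMeasurable.inner hW.aestronglyMeasurable) ?_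
    refine Filter.Eventually.of_forall fun z => ?_
    refine (norm_inner_le_norm _ _).trans ?_
    gcongr
    exact hL z
  simp_rw [inner_add_right]
  rw [integral_add (hI W hW) (hI W' hW'), ← a1, ← a2]
  ring

theorem V_weak {m : ℕ} (hm : 0 < m) {δ : ℝ} (hδ : 0 < δ) {x : E2} (hx : x ∈ Qs) :
    Weak (w0 m x) oneQ (V m δ x) := by
  have hD := w0_dens hm hx
  have h1 : Measurable (Function.uncurry fun _ : E2 => oneQ) := oneQ_dens.meas.comp measurable_snd
  by_cases h : x ∈ Inn δ
  · have e : V m δ x = fun z => Av (w0 m x) (ub δ x) z + Av (ub δ x) oneQ z := by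
      ext1 z; simp [V, h]
    rw [e]
    have hU := ub_dens hδ h
    refine Weak.trans (weak_Av hD hU fun q hq => ub_supp h hq) (weak_Av hU oneQ_dens fun q hq => oneQ_supp hq) ?_ ?_
    · refine integrable_lam_of_bdd ((Av_measurable (f := w0 m) (g := ub δ) (w0_measurable m) (ub_measurable δ)).comp
        (by fun_prop : Measurable fun z : E2 => (x, z))).aestronglyMeasurable
        (B := (Real.pi * δ ^ 2)⁻¹ * (δ + 2 / m) ^ 2 / 2 * (8 * m ^ 2)) ?_
      intro z _
      refine (Av_bound hD.nonneg (fun p _ z hp => ub_K hm hδ h z hp) z (hD.pot_integrable z)).trans ?_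
      have := Real.pi_pos
      gcongr
      exact hD.pot_bound (w0_le m x) z
    · refine integrable_lam_of_bdd ((Av_measurable (f := ub δ) (g := fun _ => oneQ) (ub_measurable δ) h1).comp
        (by fun_prop : Measurable fun z : E2 => (x, z))).aestronglyMeasurable
        (B := 2 * (8 * (Real.pi * δ ^ 2)⁻¹)) ?_
      intro z _
      refine (Av_bound hU.nonneg (fun p hp z _ => oneQ_K hp z) z (hU.pot_integrable z)).trans ?_
      gcongr
      exact hU.pot_bound (ub_le x) z
  · have e : V m δ x = Av (w0 m x) oneQ := by
      ext1 z; simp [V, h]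
    rw [e]
    exact weak_Av hD oneQ_dens fun q hq => oneQ_supp hq

theorem hh_radial {d : ℝ} (hd : 0 < d) (hd1 : d ≤ 1) :
    IntegrableOn (fun y => y * hh d y ^ 2) (Set.Ioc 0 2) ∧
    ∫ y in Set.Ioc (0 : ℝ) 2, y * hh d y ^ 2 ≤ Real.log (1 / d) + 1026 := by
  have hm : Measurable fun y => y * hh d y ^ 2 := by
    have := hh_measurable d
    fun_prop
  have hbd : ∀ y ∈ Set.Ioc (0 : ℝ) 2, ‖y * hh d y ^ 2‖ ≤ 2 * (16 / d) ^ 2 := by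
    intro y hy
    have h0 := hh_nonneg hd y
    have h1 := hh_le hd y
    have : 0 < y := hy.1
    rw [Real.norm_of_nonneg (by positivity)]
    gcongr
    exact hy.2
  have hi : IntegrableOn (fun y => y * hh d y ^ 2) (Set.Ioc 0 2) := by
    refine Integrable.of_bound hm.aestronglyMeasurable (2 * (16 / d) ^ 2) ?_
    exact (ae_restrict_mem measurableSet_Ioc).mono hbd
  refine ⟨hi, ?_⟩
  have hu : Set.Ioc (0 : ℝ) 2 = Set.Ioc 0 (2 * d) ∪ Set.Ioc (2 * d) 2 :=
    (Set.Ioc_union_Ioc_eq_Ioc (by positivity) (by linarith)).symm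
  have hdj : Disjoint (Set.Ioc (0 : ℝ) (2 * d)) (Set.Ioc (2 * d) 2) := by
    rw [Set.disjoint_left]
    intro y h1 h2
    exact absurd h1.2 (not_le.2 h2.1)
  have hi' := hi
  rw [hu] at hi' ⊢
  rw [setIntegral_union hdj measurableSet_Ioc hi'.left_of_union hi'.right_of_union]
  have p1 : ∫ y in Set.Ioc (0 : ℝ) (2 * d), y * hh d y ^ 2 ≤ 1024 := by
    have : ∀ y ∈ Set.Ioc (0 : ℝ) (2 * d), y * hh d y ^ 2 ≤ 512 / d := by
      intro y hy
      have h0 := hh_nonneg hd y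
      have h1 := hh_le hd y
      have : 0 < y := hy.1
      calc y * hh d y ^ 2 ≤ (2 * d) * (16 / d) ^ 2 := by
            gcongr
            exact hy.2
        _ = 512 / d := by field_simp; norm_num
    refine (setIntegral_mono_on hi'.left_of_union (integrableOn_const measure_Ioc_lt_top.ne) measurableSet_Ioc this).trans ?_
    rw [setIntegral_const]
    simp [Measure.real, hd.le]
    field_simp
    norm_num
  have p2 : ∫ y in Set.Ioc (2 * d) 2, y * hh d y ^ 2 ≤ Real.log (1 / d) + 2 := by
    have e : Set.EqOn (fun y => y * hh d y ^ 2) (fun y => y * ((y - d)⁻¹) ^ 2) (Set.Ioc (2 * d) 2) := by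
      intro y hy
      simp [hh, hy.1.le]
    rw [setIntegral_congr_fun measurableSet_Ioc e, ← intervalIntegral.integral_of_le (by linarith)]
    have hder : ∀ y ∈ Set.uIcc (2 * d) 2, HasDerivAt (fun y => Real.log (y - d) - d * (y - d)⁻¹)
        (y * ((y - d)⁻¹) ^ 2) y := by
      intro y hy
      rw [Set.uIcc_of_le (by linarith)] at hy
      have hy' : y - d ≠ 0 := by have := hy.1; intro h; linarith
      have h1 : HasDerivAt (fun y => y - d) 1 y := (hasDerivAt_id y).sub_const d
      have h2 := (h1.log hy').sub ((h1.inv hy').const_mul d)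
      have h3 : y * ((y - d)⁻¹) ^ 2 = 1 / (y - d) - d * (-1 / (y - d) ^ 2) := by
        field_simp
        ring
      rw [h3]
      exact h2
    rw [intervalIntegral.integral_eq_sub_of_hasDerivAt hder]
    · have a1 : (2 * d - d) = d := by ring
      rw [a1, mul_inv_cancel₀ hd.ne']
      have a2 : Real.log (2 - d) ≤ 1 := by
        have := Real.log_le_sub_one_of_pos (by linarith : 0 < 2 - d)
        linarith
      have a3 : 0 ≤ d * (2 - d)⁻¹ := mul_nonneg hd.le (inv_nonneg.2 (by linarith))
      rw [Real.log_div one_ne_zero hd.ne', Real.log_one]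
      linarith
    · apply ContinuousOn.intervalIntegrable
      rw [Set.uIcc_of_le (by linarith)]
      refine continuousOn_id.mul ((ContinuousOn.inv₀ (by fun_prop) ?_).pow 2)
      intro y hy h
      have := hy.1
      linarith
  linarith

theorem hh_sq_int {d : ℝ} (hd : 0 < d) (hd1 : d ≤ 1) {x : E2} (hx : x ∈ Qs) :
    Integrable (fun z => hh d ‖x - z‖ ^ 2) lam ∧
    ∫ z, hh d ‖x - z‖ ^ 2 ∂lam ≤ 2 * Real.pi * (Real.log (1 / d) + 1026) := by
  have hm : Measurable fun z : E2 => hh d ‖x - z‖ ^ 2 := by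
    have := hh_measurable d
    fun_prop
  have hi : Integrable (fun z => hh d ‖x - z‖ ^ 2) lam := by
    refine integrable_lam_of_bdd hm.aestronglyMeasurable (B := (16 / d) ^ 2) fun z _ => ?_
    rw [Real.norm_of_nonneg (by positivity)]
    have h0 := hh_nonneg hd ‖x - z‖
    have h1 := hh_le hd ‖x - z‖
    gcongr
  refine ⟨hi, ?_⟩
  obtain ⟨r1, r2⟩ := hh_radial hd hd1
  set f : ℝ → ℝ := (Set.Iic 2).indicator (fun s => hh d s ^ 2) with hf
  have e : (fun y => y * f y) = (Set.Iic 2).indicator (fun y => y * hh d y ^ 2) := by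
    ext y
    by_cases h : y ∈ Set.Iic (2 : ℝ) <;> simp [hf, Set.indicator, h]
  have f0 : ∀ s, 0 ≤ f s := fun s => Set.indicator_nonneg (fun _ _ => by positivity) s
  have hI : IntegrableOn (fun y => y * f y) (Set.Ioi 0) := by
    rw [e, IntegrableOn, integrable_indicator_iff measurableSet_Iic, IntegrableOn,
      Measure.restrict_restrict measurableSet_Iic, Set.inter_comm, Set.Ioi_inter_Iic]
    exact r1
  have hII := radial_integrable hI
  have hv : ∫ w : E2, f ‖w‖ = 2 * Real.pi * ∫ y in Set.Ioc (0 : ℝ) 2, y * hh d y ^ 2 := by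
    rw [radial_integral, e, setIntegral_indicator measurableSet_Iic, Set.Ioi_inter_Iic]
  have e2 : ∫ z, hh d ‖x - z‖ ^ 2 ∂lam = ∫ z, f ‖x - z‖ ∂lam := by
    apply integral_congr_ae
    refine ae_lam.mono fun z hz => ?_
    have : ‖x - z‖ ≤ 2 := sq_diam' (sq_subset hx) (sq_subset hz)
    simp [hf, this]
  rw [e2]
  have hsub : Integrable (fun z => f ‖x - z‖) := hII.comp_sub_left x
  calc ∫ z, f ‖x - z‖ ∂lam ≤ ∫ z, f ‖x - z‖ :=
        setIntegral_le_integral hsub (Eventually.of_forall fun z => f0 _)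
    _ = ∫ w : E2, f ‖w‖ := integral_sub_left_eq_self (fun w : E2 => f ‖w‖) volume x
    _ ≤ _ := by
        rw [hv]
        have := Real.pi_pos
        gcongr

/-- Cell averages of the density. -/
def rb (m : ℕ) (R : E2 → ℝ) (z : E2) : ℝ := ∫ x, w0 m x z * R x ∂lam

/-- Standing assumptions on the density. -/
structure Den (R : E2 → ℝ) (a B : ℝ) (k : ℝ≥0) : Prop where
  lip : LipschitzWith k R
  apos : 0 < a
  lb : ∀ x, a ≤ R x
  ub : ∀ x, R x ≤ B
  mass : ∫ x, R x ∂lam = 1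

theorem Den.dens {R : E2 → ℝ} {a B : ℝ} {k : ℝ≥0} (h : Den R a B k) : Dens R :=
  ⟨h.lip.continuous.measurable, fun x => h.apos.le.trans (h.lb x), ⟨B, h.ub⟩, h.mass⟩

theorem rb_meas (m : ℕ) {R : E2 → ℝ} {a B : ℝ} {k : ℝ≥0} (h : Den R a B k) : Measurable (rb m R) := by
  have h1 : Measurable (fun y : E2 × E2 => w0 m y.2 y.1 * R y.2) :=
    ((w0_measurable m).comp measurable_swap).mul (h.dens.meas.comp measurable_snd)
  exact (h1.stronglyMeasurable.integral_prod_right' (ν := lam)).measurable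

theorem rb_integrable {m : ℕ} {R : E2 → ℝ} {a B : ℝ} {k : ℝ≥0} (h : Den R a B k) (z : E2) :
    Integrable (fun x => w0 m x z * R x) lam := by
  refine integrable_lam_of_bdd (B := m ^ 2 * B) ?_ fun x _ => ?_
  · have h1 : Measurable fun x => w0 m x z := (w0_measurable m).comp (by fun_prop : Measurable fun x : E2 => (x, z))
    exact (h1.mul h.dens.meas).aestronglyMeasurable
  · have := w0_nonneg m x z
    have := h.dens.nonneg x
    rw [Real.norm_of_nonneg (by positivity)]
    gcongr
    · exact w0_le m x z
    · exact h.ub x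

theorem rb_bounds {m : ℕ} (hm : 0 < m) {R : E2 → ℝ} {a B : ℝ} {k : ℝ≥0} (h : Den R a B k) {z : E2} (hz : z ∈ Qs)
    {c c' : ℝ} (hc : ∀ x, w0 m x z ≠ 0 → c ≤ R x) (hc' : ∀ x, w0 m x z ≠ 0 → R x ≤ c') :
    c ≤ rb m R z ∧ rb m R z ≤ c' := by
  have hw : Integrable (fun x => w0 m x z) lam := by
    simp_rw [w0_symm m _ z]; exact (w0_dens hm hz).integrable
  have hw1 : ∫ x, w0 m x z ∂lam = 1 := by
    simp_rw [w0_symm m _ z]; exact (w0_dens hm hz).mass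
  constructor
  · have := integral_mono (hw.mul_const c) (rb_integrable (m := m) h z) (fun x => by
      by_cases h0 : w0 m x z = 0
      · simp [h0]
      · exact mul_le_mul_of_nonneg_left (hc x h0) (w0_nonneg m x z))
    rwa [integral_mul_const, hw1, one_mul] at this
  · have := integral_mono (rb_integrable (m := m) h z) (hw.mul_const c') (fun x => by
      by_cases h0 : w0 m x z = 0
      · simp [h0]
      · exact mul_le_mul_of_nonneg_left (hc' x h0) (w0_nonneg m x z))
    rwa [integral_mul_const, hw1, one_mul] at this

theorem rb_lb {m : ℕ} (hm : 0 < m) {R : E2 → ℝ} {a B : ℝ} {k : ℝ≥0} (h : Den R a B k) {z : E2} (hz : z ∈ Qs) :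
    a ≤ rb m R z := (rb_bounds hm h hz (fun x _ => h.lb x) (fun x _ => h.ub x)).1

theorem rb_ub {m : ℕ} (hm : 0 < m) {R : E2 → ℝ} {a B : ℝ} {k : ℝ≥0} (h : Den R a B k) {z : E2} (hz : z ∈ Qs) :
    rb m R z ≤ B := (rb_bounds hm h hz (fun x _ => h.lb x) (fun x _ => h.ub x)).2

theorem rb_ratio {m : ℕ} (hm : 0 < m) {R : E2 → ℝ} {a B : ℝ} {k : ℝ≥0} (h : Den R a B k) {z : E2} (hz : z ∈ Qs)
    (x : E2) : R x / rb m R z ≤ 1 + k / a * (‖x - z‖ + 2 / m) := by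
  have ha := h.apos
  have hr := rb_lb hm h hz
  have h1 : R x - k * (‖x - z‖ + 2 / m) ≤ rb m R z := by
    refine (rb_bounds hm h hz (fun y hy => ?_) (fun y _ => h.ub y)).1
    have a1 := h.lip.dist_le_mul x y
    rw [Real.dist_eq, dist_eq_norm] at a1
    have a2 := w0_near hm hy
    have a3 := norm_sub_le_norm_sub_add_norm_sub x z y
    have a4 := (abs_le.1 a1).2
    have a5 : (k : ℝ) * ‖x - y‖ ≤ k * (‖x - z‖ + 2 / m) := by gcongr; linarith
    linarith
  have hr0 : 0 < rb m R z := ha.trans_le hr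
  rw [div_le_iff₀ hr0]
  have h2 : (k : ℝ) * (‖x - z‖ + 2 / m) ≤ k / a * (‖x - z‖ + 2 / m) * rb m R z := by
    have h3 : (k : ℝ) * (‖x - z‖ + 2 / m) = k / a * (‖x - z‖ + 2 / m) * a := by field_simp
    rw [h3]
    gcongr
  linarith

theorem rb_dens {m : ℕ} (hm : 0 < m) {R : E2 → ℝ} {a B : ℝ} {k : ℝ≥0} (h : Den R a B k) :
    Dens (rb m R) := by
  refine ⟨rb_meas m h, fun z => integral_nonneg fun x => mul_nonneg (w0_nonneg _ _ _) (h.dens.nonneg x),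
    ⟨m ^ 2, fun z => ?_⟩, ?_⟩
  · have h1 := integral_mono (rb_integrable (m := m) h z) (h.dens.integrable.const_mul ((m : ℝ) ^ 2)) (fun x =>
      mul_le_mul_of_nonneg_right (w0_le m x z) (h.dens.nonneg x))
    rw [integral_const_mul, h.mass, mul_one] at h1
    exact h1
  · unfold rb
    rw [integral_integral_swap]
    · have : ∫ x, ∫ z, w0 m x z * R x ∂lam ∂lam = ∫ x, R x ∂lam := by
        apply integral_congr_ae
        refine ae_lam.mono fun x hx => ?_
        simp only
        rw [integral_mul_const, w0_int hm hx, one_mul]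
      rw [this, h.mass]
    · refine Integrable.of_bound ?_ (m ^ 2 * B) (Eventually.of_forall fun y => ?_)
      · have h1 : Measurable (fun y : E2 × E2 => w0 m y.2 y.1 * R y.2) :=
          ((w0_measurable m).comp measurable_swap).mul (h.dens.meas.comp measurable_snd)
        exact h1.aestronglyMeasurable
      · simp only [Function.uncurry_def]
        have := w0_nonneg m y.2 y.1
        have := h.dens.nonneg y.2
        rw [Real.norm_of_nonneg (by positivity)]
        gcongr
        · exact w0_le m _ _
        · exact h.ub _

theorem ae_lam_prod : ∀ᵐ y ∂(lam.prod lam), y.1 ∈ Qs ∧ y.2 ∈ Qs :=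
  (Measure.quasiMeasurePreserving_fst.ae ae_lam).and (Measure.quasiMeasurePreserving_snd.ae ae_lam)

/-- Inner coefficient -/
def kin (m : ℕ) (δ : ℝ) : ℝ := (Real.pi * δ ^ 2)⁻¹ * (δ + 2 / m) ^ 2 / 2

theorem kin_nonneg (m : ℕ) (δ : ℝ) : 0 ≤ kin m δ := by
  have := Real.pi_pos
  unfold kin; positivity

theorem kap_measurable (m : ℕ) (δ : ℝ) : Measurable (kap m δ) := by
  unfold kap
  exact Measurable.ite (measurableSet_Inn δ) measurable_const measurable_const

theorem kap_nonneg (m : ℕ) (δ : ℝ) (x : E2) : 0 ≤ kap m δ x := by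
  have := kin_nonneg m δ
  unfold kap; unfold kin at this; split_ifs
  · exact this
  · norm_num

theorem kap_le {m : ℕ} {δ : ℝ} (hδ : 0 < δ) (hd : 2 / (m : ℝ) ≤ δ) (x : E2) : kap m δ x ≤ 2 := by
  unfold kap; split_ifs
  · have hpi := Real.pi_gt_three
    have h0 : (0 : ℝ) ≤ 2 / m := by positivity
    calc (Real.pi * δ ^ 2)⁻¹ * (δ + 2 / m) ^ 2 / 2 ≤ (Real.pi * δ ^ 2)⁻¹ * (δ + δ) ^ 2 / 2 := by
          gcongr
      _ = 2 / Real.pi := by field_simp; ring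
      _ ≤ 2 := by rw [div_le_iff₀ (by linarith)]; linarith
  · exact le_rfl

theorem kap_int {m : ℕ} {δ : ℝ} (hδ : 0 < δ) (hδ2 : δ ≤ 1 / 2) (hd : 2 / (m : ℝ) ≤ δ) :
    Integrable (fun x => kap m δ x ^ 2) lam ∧ ∫ x, kap m δ x ^ 2 ∂lam ≤ kin m δ ^ 2 + 16 * δ := by
  have hi : Integrable (fun x => kap m δ x ^ 2) lam := by
    refine integrable_lam_of_bdd ((kap_measurable m δ).pow_const 2).aestronglyMeasurable (B := 2 ^ 2) fun x _ => ?_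
    rw [Real.norm_of_nonneg (by positivity)]
    have := kap_nonneg m δ x
    have := kap_le hδ hd x
    gcongr
  refine ⟨hi, ?_⟩
  have hle : ∀ x, kap m δ x ^ 2 ≤ kin m δ ^ 2 + (Inn δ)ᶜ.indicator (fun _ => (4 : ℝ)) x := by
    intro x
    by_cases h : x ∈ Inn δ
    · simp [kap, kin, h]
    · simp only [kap, h, if_false, Set.indicator, Set.mem_compl_iff, not_false_eq_true, if_true]
      nlinarith [sq_nonneg (kin m δ)]
  have hi2 : Integrable ((Inn δ)ᶜ.indicator (fun _ => (4 : ℝ))) lam :=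
    (integrable_const _).indicator (measurableSet_Inn δ).compl
  refine (integral_mono hi ((integrable_const _).add hi2) hle).trans ?_
  simp only [Pi.add_apply]
  rw [integral_add (integrable_const _) hi2, integral_indicator (measurableSet_Inn δ).compl]
  simp only [integral_const, Measure.real, measure_univ, ENNReal.toReal_one, smul_eq_mul, one_mul,
    Measure.restrict_apply_univ]
  have h1 : lam (Inn δ) = ENNReal.ofReal ((1 - 2 * δ) ^ 2) := by
    have hsub : Inn δ ⊆ Qs := fun x hx i => ⟨hδ.le.trans (hx i).1, by linarith [(hx i).2]⟩
    rw [lam, Measure.restrict_apply (measurableSet_Inn δ), Set.inter_eq_left.2 hsub]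
    have := volume_box (fun _ => δ) (fun _ => 1 - δ)
    rw [Fin.prod_univ_two, ← ENNReal.ofReal_mul (by linarith)] at this
    rw [show Inn δ = {x : E2 | ∀ i, x i ∈ Set.Ico ((fun _ => δ) i) ((fun _ => 1 - δ) i)} from rfl, this]
    congr 1; ring
  rw [prob_compl_eq_one_sub (measurableSet_Inn δ), h1, ENNReal.toReal_sub_of_le, ENNReal.toReal_one,
    ENNReal.toReal_ofReal (by positivity)]
  · nlinarith
  · rw [← h1]; exact prob_le_one
  · simp

theorem V_sq {m : ℕ} (hm : 0 < m) {δ : ℝ} (hδ : 0 < δ) {x : E2} (hx : x ∈ Qs) (z : E2) {η : ℝ} (hη : 0 < η) :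
    ‖V m δ x z‖ ^ 2 ≤ (1 + η) * kap m δ x ^ 2 * hh (2 / m) ‖x - z‖ ^ 2 +
      (1 + 1 / η) * (16 * (Real.pi * δ ^ 2)⁻¹) ^ 2 := by
  have hb := V_bound hm hδ hx z
  have := pow_le_pow_left₀ (norm_nonneg _) hb 2
  refine this.trans ?_
  set A := kap m δ x * hh (2 / m) ‖x - z‖
  set c := 16 * (Real.pi * δ ^ 2)⁻¹
  have h1 : 2 * A * c ≤ η * A ^ 2 + 1 / η * c ^ 2 := by
    have : η * A ^ 2 + 1 / η * c ^ 2 - 2 * A * c = 1 / η * (η * A - c) ^ 2 := by field_simp; ring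
    have : 0 ≤ 1 / η * (η * A - c) ^ 2 := by positivity
    linarith
  have h2 : (1 + η) * kap m δ x ^ 2 * hh (2 / m) ‖x - z‖ ^ 2 = (1 + η) * A ^ 2 := by ring
  rw [h2]
  nlinarith

theorem V_norm_le {m : ℕ} (hm : 0 < m) {δ : ℝ} (hδ : 0 < δ) (hd : 2 / (m : ℝ) ≤ δ) {x : E2} (hx : x ∈ Qs) (z : E2) :
    ‖V m δ x z‖ ≤ (16 + 16 * (Real.pi * δ ^ 2)⁻¹) * m := by
  have hm' : (1 : ℝ) ≤ m := by exact_mod_cast hm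
  have hpi := Real.pi_pos
  have h1 := hh_le (by positivity : (0 : ℝ) < 2 / m) ‖x - z‖
  have h2 := kap_le hδ hd x
  have h3 := hh_nonneg (by positivity : (0 : ℝ) < 2 / m) ‖x - z‖
  have e3 : 16 / (2 / m : ℝ) = 8 * m := by field_simp; norm_num
  have h4 : kap m δ x * hh (2 / m) ‖x - z‖ ≤ 2 * (8 * m) := by
    rw [← e3]
    gcongr
  have h5 : 16 * (Real.pi * δ ^ 2)⁻¹ ≤ 16 * (Real.pi * δ ^ 2)⁻¹ * m :=
    le_mul_of_one_le_right (by positivity) hm'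
  have := V_bound hm hδ hx z
  linarith

theorem V_sq_measurable (m : ℕ) (δ : ℝ) : Measurable (fun y : E2 × E2 => ‖V m δ y.1 y.2‖ ^ 2) :=
  (V_measurable m δ).norm.pow_const 2

theorem fields_S {R : E2 → ℝ} {a B : ℝ} {k : ℝ≥0} (h : Den R a B k) {m : ℕ} (hm : 0 < m) {δ : ℝ}
    (hδ : 0 < δ) (hδ1 : δ ≤ 1) (hd : 2 / (m : ℝ) ≤ δ) {z : E2} (hz : z ∈ Qs) :
    ∫ x, ‖V m δ x z‖ ^ 2 * R x ∂lam ≤ B * (8 * (2 * Real.pi * (Real.log m + 1026)) +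
      2 * (16 * (Real.pi * δ ^ 2)⁻¹) ^ 2) := by
  have hB : 0 ≤ B := h.apos.le.trans ((h.lb 0).trans (h.ub 0))
  have hm1 : (1 : ℝ) ≤ m := by exact_mod_cast hm
  have hd0 : (0 : ℝ) < 2 / m := by positivity
  obtain ⟨i1, i2⟩ := hh_sq_int hd0 (hd.trans hδ1) hz
  have hlog : Real.log (1 / (2 / m)) ≤ Real.log m := by
    apply Real.log_le_log (by positivity)
    rw [one_div_div]
    linarith
  set c := 16 * (Real.pi * δ ^ 2)⁻¹
  have hi : Integrable (fun x => B * (8 * hh (2 / m) ‖z - x‖ ^ 2 + 2 * c ^ 2)) lam :=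
    ((i1.const_mul 8).add (integrable_const _)).const_mul B
  refine (integral_mono_of_nonneg (Eventually.of_forall fun x => ?_) hi
    (ae_lam.mono fun x hx => ?_)).trans ?_
  · have := h.dens.nonneg x
    simp only [Pi.zero_apply]
    positivity
  · have h1 := V_sq hm hδ hx z one_pos
    have h2 : ‖V m δ x z‖ ^ 2 ≤ 8 * hh (2 / m) ‖z - x‖ ^ 2 + 2 * c ^ 2 := by
      have h3 : kap m δ x ^ 2 ≤ 4 := by nlinarith [kap_nonneg m δ x, kap_le hδ hd x]
      rw [norm_sub_rev z x]
      have := mul_le_mul_of_nonneg_right h3 (sq_nonneg (hh (2 / m) ‖x - z‖))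
      have e1 : (1 : ℝ) + 1 = 2 := by norm_num
      have e2 : (1 : ℝ) + 1 / 1 = 2 := by norm_num
      rw [e2, e1] at h1
      change _ ≤ 2 * kap m δ x ^ 2 * hh (2 / m) ‖x - z‖ ^ 2 + 2 * c ^ 2 at h1
      linarith
    have := h.dens.nonneg x
    have h4 := mul_le_mul h2 (h.ub x) this (by positivity)
    simp only
    linarith
  · rw [integral_const_mul, integral_add (i1.const_mul 8) (integrable_const _), integral_const_mul]
    simp only [integral_const, Measure.real, measure_univ, ENNReal.toReal_one, smul_eq_mul, one_mul]
    gcongr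
    refine i2.trans ?_
    have := Real.pi_pos
    gcongr

theorem fields_Sig {R : E2 → ℝ} {a B : ℝ} {k : ℝ≥0} (h : Den R a B k) {m : ℕ} (hm : 0 < m) {δ : ℝ}
    (hδ : 0 < δ) (hδ1 : δ ≤ 1 / 2) (hd : 2 / (m : ℝ) ≤ δ) :
    ∫ z, (∫ x, ‖V m δ x z‖ ^ 2 * R x ∂lam) / rb m R z ∂lam ≤
      (1 + δ) * (kin m δ ^ 2 + 16 * δ) *
        ((1 + k / a * (2 / m)) * (2 * Real.pi * (Real.log m + 1026)) + 8192 * (k / a)) +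
      (1 + 1 / δ) * (16 * (Real.pi * δ ^ 2)⁻¹) ^ 2 * (1 + k / a * 3) := by
  have ha := h.apos
  have hB : 0 ≤ B := h.apos.le.trans ((h.lb 0).trans (h.ub 0))
  have hm1 : (1 : ℝ) ≤ m := by exact_mod_cast hm
  have hpi := Real.pi_pos
  have hd0 : (0 : ℝ) < 2 / m := by positivity
  have hd1 : 2 / (m : ℝ) ≤ 1 := by linarith
  have hlog : Real.log (1 / (2 / m)) ≤ Real.log m := by
    apply Real.log_le_log (by positivity)
    rw [one_div_div]
    linarith
  have hlog0 : 0 ≤ Real.log m := Real.log_nonneg hm1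
  set c := 16 * (Real.pi * δ ^ 2)⁻¹ with hc
  set q : ℝ := k / a with hq
  have hq0 : 0 ≤ q := by positivity
  set d : ℝ := 2 / m with hdd
  have hVb := fun (x : E2) (hx : x ∈ Qs) (z : E2) => V_norm_le hm hδ hd hx z
  set M := (16 + 16 * (Real.pi * δ ^ 2)⁻¹) * (m : ℝ) with hM
  have hM0 : 0 ≤ M := by positivity
  have e1 : ∫ z, (∫ x, ‖V m δ x z‖ ^ 2 * R x ∂lam) / rb m R z ∂lam =
      ∫ z, ∫ x, ‖V m δ x z‖ ^ 2 * (R x / rb m R z) ∂lam ∂lam := by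
    congr 1; ext z
    rw [← integral_div]
    congr 1; ext x; ring
  have hint : Integrable (Function.uncurry fun z x => ‖V m δ x z‖ ^ 2 * (R x / rb m R z)) (lam.prod lam) := by
    refine Integrable.of_bound ?_ (M ^ 2 * (B / a)) ?_
    · have h1 : Measurable (fun y : E2 × E2 => ‖V m δ y.2 y.1‖ ^ 2 * (R y.2 / rb m R y.1)) :=
        ((V_sq_measurable m δ).comp measurable_swap).mul
          ((h.dens.meas.comp measurable_snd).div ((rb_meas m h).comp measurable_fst))
      exact h1.aestronglyMeasurable
    · refine ae_lam_prod.mono fun y hy => ?_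
      simp only [Function.uncurry_def]
      have h1 := rb_lb hm h hy.1
      have h2 := h.dens.nonneg y.2
      have h3 := h.ub y.2
      have h4 := hVb y.2 hy.2 y.1
      have h5 : 0 < rb m R y.1 := ha.trans_le h1
      rw [Real.norm_of_nonneg (by positivity)]
      gcongr
  rw [e1, integral_integral_swap hint]
  have hin : ∀ x ∈ Qs, ∫ z, ‖V m δ x z‖ ^ 2 * (R x / rb m R z) ∂lam ≤
      (1 + δ) * kap m δ x ^ 2 * ((1 + q * d) * (2 * Real.pi * (Real.log m + 1026)) + 8192 * q) +
      (1 + 1 / δ) * c ^ 2 * (1 + q * 3) := by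
    intro x hx
    obtain ⟨i1, i2⟩ := hh_sq_int hd0 hd1 hx
    obtain ⟨j1, j2⟩ := inv_norm_lam' x
    have hkap : 0 ≤ (1 + δ) * kap m δ x ^ 2 := by positivity
    have hi : Integrable (fun z => (1 + δ) * kap m δ x ^ 2 * ((1 + q * d) * hh d ‖x - z‖ ^ 2 +
        1024 * q * ‖x - z‖⁻¹) + (1 + 1 / δ) * c ^ 2 * (1 + q * 3)) lam :=
      (((i1.const_mul _).add (j1.const_mul _)).const_mul _).add (integrable_const _)
    refine (integral_mono_of_nonneg (ae_lam.mono fun z hz => ?_) hi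
      (ae_lam.mono fun z hz => ?_)).trans ?_
    · have h1 := rb_lb hm h hz
      have h2 := h.dens.nonneg x
      have h5 : 0 < rb m R z := ha.trans_le h1
      simp only [Pi.zero_apply]
      positivity
    · have h1 := V_sq hm hδ hx z hδ
      have h2 := rb_ratio hm h hz x
      have h3 := hh_sq_mul hd0 (norm_nonneg (x - z))
      have h4 : ‖x - z‖ ≤ 2 := sq_diam' (sq_subset hx) (sq_subset hz)
      have h5 : 0 < rb m R z := ha.trans_le (rb_lb hm h hz)
      have h6 := h.dens.nonneg x
      simp only
      rw [← hq, ← hdd] at h2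
      rw [← hdd, ← hc] at h1
      have h7 := mul_le_mul h1 h2 (by positivity) (by positivity)
      refine h7.trans ?_
      set s := ‖x - z‖
      have hs : 0 ≤ s := norm_nonneg _
      have h8 : (1 + δ) * kap m δ x ^ 2 * hh d s ^ 2 * (1 + q * (s + d)) ≤
          (1 + δ) * kap m δ x ^ 2 * ((1 + q * d) * hh d s ^ 2 + 1024 * q * s⁻¹) := by
        have : hh d s ^ 2 * (1 + q * (s + d)) ≤ (1 + q * d) * hh d s ^ 2 + 1024 * q * s⁻¹ := by
          have := mul_le_mul_of_nonneg_left h3 hq0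
          nlinarith
        have := mul_le_mul_of_nonneg_left this hkap
        linarith
      have h9 : (1 + 1 / δ) * c ^ 2 * (1 + q * (s + d)) ≤ (1 + 1 / δ) * c ^ 2 * (1 + q * 3) := by
        have : s + d ≤ 3 := by linarith
        gcongr
      rw [add_mul]
      linarith
    · have hs : Integrable (fun z => (1 + q * d) * hh d ‖x - z‖ ^ 2 + 1024 * q * ‖x - z‖⁻¹) lam :=
        (i1.const_mul _).add (j1.const_mul _)
      rw [integral_add (hs.const_mul _) (integrable_const _),
        integral_const_mul, integral_add (i1.const_mul _) (j1.const_mul _), integral_const_mul,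
        integral_const_mul]
      simp only [integral_const, Measure.real, measure_univ, ENNReal.toReal_one, smul_eq_mul, one_mul]
      have h1 : ∫ z, hh d ‖x - z‖ ^ 2 ∂lam ≤ 2 * Real.pi * (Real.log m + 1026) := by
        refine i2.trans ?_
        gcongr
      have h2 : (1 + q * d) * ∫ z, hh d ‖x - z‖ ^ 2 ∂lam ≤ (1 + q * d) * (2 * Real.pi * (Real.log m + 1026)) := by
        gcongr
      have h3 : 1024 * q * ∫ z, ‖x - z‖⁻¹ ∂lam ≤ 8192 * q := by nlinarith
      gcongr
  obtain ⟨k1, k2⟩ := kap_int hδ hδ1 hd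
  set A := (1 + q * d) * (2 * Real.pi * (Real.log m + 1026)) + 8192 * q with hA
  have hA0 : 0 ≤ A := by positivity
  have hI : Integrable (fun x => (1 + δ) * kap m δ x ^ 2 * A + (1 + 1 / δ) * c ^ 2 * (1 + q * 3)) lam :=
    ((k1.const_mul _).mul_const _).add (integrable_const _)
  refine (integral_mono_ae hint.integral_prod_right hI (ae_lam.mono hin)).trans ?_
  rw [integral_add ((k1.const_mul _).mul_const _) (integrable_const _), integral_mul_const, integral_const_mul]
  simp only [integral_const, Measure.real, measure_univ, ENNReal.toReal_one, smul_eq_mul, one_mul]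
  gcongr

theorem fields {R : E2 → ℝ} {a B : ℝ} {k : ℝ≥0} (h : Den R a B k) {ε : ℝ} (hε : 0 < ε) :
    ∃ δ > 0, ∃ C > 0, ∀ᶠ m : ℕ in atTop, 0 < m ∧
      (∀ x ∈ Qs, ∀ z, ‖V m δ x z‖ ≤ C * m) ∧
      (∀ z ∈ Qs, ∫ x, ‖V m δ x z‖ ^ 2 * R x ∂lam ≤ C * (Real.log m + 1)) ∧
      ∫ z, (∫ x, ‖V m δ x z‖ ^ 2 * R x ∂lam) / rb m R z ∂lam ≤
        (1 / (2 * Real.pi) + ε) * Real.log m + C := by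
  have ha := h.apos
  have hB : 0 ≤ B := h.apos.le.trans ((h.lb 0).trans (h.ub 0))
  have hpi := Real.pi_pos
  set q : ℝ := k / a with hq
  have hq0 : 0 ≤ q := by positivity
  -- choice of δ
  have t1 : Tendsto (fun δ : ℝ => (1 + δ) * ((1 / (2 * Real.pi)) ^ 2 + 16 * δ) * (2 * Real.pi)) (𝓝[>] 0)
      (𝓝 ((1 + 0) * ((1 / (2 * Real.pi)) ^ 2 + 16 * 0) * (2 * Real.pi))) :=
    Tendsto.mono_left (Continuous.tendsto (by fun_prop) 0) nhdsWithin_le_nhds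
  have e1 : (1 + 0) * ((1 / (2 * Real.pi)) ^ 2 + 16 * 0) * (2 * Real.pi) = 1 / (2 * Real.pi) := by
    field_simp
    ring
  rw [e1] at t1
  have ev1 := t1.eventually_lt_const (by linarith : 1 / (2 * Real.pi) < 1 / (2 * Real.pi) + ε)
  have ev2 : ∀ᶠ δ : ℝ in 𝓝[>] 0, δ < 1 / 2 := by
    apply Filter.Eventually.filter_mono nhdsWithin_le_nhds
    exact eventually_lt_nhds (by norm_num)
  obtain ⟨δ, ⟨hδ1, hδ2⟩, hδ⟩ := ((ev1.and ev2).and eventually_mem_nhdsWithin).exists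
  have hδ : 0 < δ := hδ
  have t0 : Tendsto (fun m : ℕ => (2 : ℝ) / m) atTop (𝓝 0) := tendsto_const_div_atTop_nhds_zero_nat 2
  have t2 : Tendsto (fun m : ℕ => (1 + δ) * (kin m δ ^ 2 + 16 * δ) * ((1 + q * (2 / m)) * (2 * Real.pi))) atTop
      (𝓝 ((1 + δ) * (((Real.pi * δ ^ 2)⁻¹ * (δ + 0) ^ 2 / 2) ^ 2 + 16 * δ) * ((1 + q * 0) * (2 * Real.pi)))) := by
    unfold kin
    have : Continuous fun d : ℝ => (1 + δ) * (((Real.pi * δ ^ 2)⁻¹ * (δ + d) ^ 2 / 2) ^ 2 + 16 * δ) *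
      ((1 + q * d) * (2 * Real.pi)) := by fun_prop
    exact (this.tendsto 0).comp t0
  have e2 : (1 + δ) * (((Real.pi * δ ^ 2)⁻¹ * (δ + 0) ^ 2 / 2) ^ 2 + 16 * δ) * ((1 + q * 0) * (2 * Real.pi)) =
      (1 + δ) * ((1 / (2 * Real.pi)) ^ 2 + 16 * δ) * (2 * Real.pi) := by
    have : (Real.pi * δ ^ 2)⁻¹ * (δ + 0) ^ 2 / 2 = 1 / (2 * Real.pi) := by field_simp; ring
    rw [this]; ring
  rw [e2] at t2
  have ev3 := t2.eventually_lt_const hδ1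
  have ev4 := t0.eventually_lt_const hδ
  set c := 16 * (Real.pi * δ ^ 2)⁻¹ with hc
  set C1 := (1 / (2 * Real.pi) + ε) * 1026 + (1 + δ) * (4 + 16 * δ) * (8192 * q) +
    (1 + 1 / δ) * c ^ 2 * (1 + q * 3) with hC1
  set C2 := B * (16 * Real.pi * 1026 + 2 * c ^ 2) with hC2
  have hC10 : 0 < C1 := by positivity
  have hC20 : 0 ≤ C2 := by positivity
  have hc0 : 0 < 16 + c := by positivity
  refine ⟨δ, hδ, C1 + C2 + (16 + c), by positivity, ?_⟩
  filter_upwards [ev3, ev4, eventually_gt_atTop 0] with m hm3 hm4 hm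
  have hm1 : (1 : ℝ) ≤ m := by exact_mod_cast hm
  have hlog0 : 0 ≤ Real.log m := Real.log_nonneg hm1
  refine ⟨hm, ?_, ?_, ?_⟩
  · intro x hx z
    refine (V_norm_le hm hδ hm4.le hx z).trans ?_
    rw [← hc]
    have : 16 + c ≤ C1 + C2 + (16 + c) := by linarith
    gcongr
  · intro z hz
    refine (fields_S h hm hδ (by linarith) hm4.le hz).trans ?_
    have h1 : B * (8 * (2 * Real.pi * (Real.log m + 1026)) + 2 * c ^ 2) ≤ C2 * (Real.log m + 1) := by
      have : C2 * (Real.log m + 1) - B * (8 * (2 * Real.pi * (Real.log m + 1026)) + 2 * c ^ 2) =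
        B * (16 * Real.pi * 1025 + 2 * c ^ 2) * Real.log m := by rw [hC2]; ring
      have : 0 ≤ B * (16 * Real.pi * 1025 + 2 * c ^ 2) * Real.log m := by positivity
      linarith
    refine h1.trans ?_
    gcongr
    linarith
  · refine (fields_Sig h hm hδ hδ2.le hm4.le).trans ?_
    rw [← hq, ← hc]
    set P := (1 + δ) * (kin m δ ^ 2 + 16 * δ) with hP
    have hP0 : 0 ≤ P := by positivity
    have hkin : kin m δ ≤ 2 := by
      have hx : ((fun _ => 1/2 : Fin 2 → ℝ)) = fun _ => 1/2 := rfl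
      have := kap_le hδ hm4.le (WithLp.toLp 2 (fun _ => (1/2 : ℝ)))
      rw [kap, if_pos (by
        intro i
        simp only [Set.mem_Ico]
        constructor <;> linarith)] at this
      exact this
    have hP1 : P ≤ (1 + δ) * (4 + 16 * δ) := by
      rw [hP]
      have := kin_nonneg m δ
      gcongr
      nlinarith
    have h1 : P * ((1 + q * (2 / m)) * (2 * Real.pi * (Real.log m + 1026))) ≤
        (1 / (2 * Real.pi) + ε) * (Real.log m + 1026) := by
      have : P * ((1 + q * (2 / m)) * (2 * Real.pi * (Real.log m + 1026))) =
        (P * ((1 + q * (2 / m)) * (2 * Real.pi))) * (Real.log m + 1026) := by ring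
      rw [this]
      gcongr
    have h2 : P * (8192 * q) ≤ (1 + δ) * (4 + 16 * δ) * (8192 * q) := by gcongr
    rw [mul_add]
    linarith

theorem weak_inner_int {G W : E2 → E2} (hG : Continuous G) {L : ℝ} (hL : ∀ x, ‖G x‖ ≤ L)
    (hW : Integrable W lam) : Integrable (fun z => inner ℝ (G z) (W z)) lam := by
  refine (hW.norm.const_mul L).mono' (hG.aestronglyMeasurable.inner hW.aestronglyMeasurable)
    (Eventually.of_forall fun z => ?_)
  refine (norm_inner_le_norm _ _).trans ?_
  gcongr
  exact hL z

theorem Weak.symm {f g : E2 → ℝ} {W : E2 → E2} (h : Weak f g W) : Weak g f (fun z => - W z) := by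
  intro φ G hG hφ hL
  have := h φ G hG hφ hL
  simp only [inner_neg_right]
  rw [integral_neg]; linarith

theorem cont_of_grad {φ : E2 → ℝ} {G : E2 → E2} (hφ : ∀ x, HasGradientAt φ (G x) x) : Continuous φ :=
  continuous_iff_continuousAt.2 fun x => (hφ x).continuousAt

theorem Dens.avg {N : ℕ} (hN : 0 < N) {f : Fin N → E2 → ℝ} (hf : ∀ i, Dens (f i)) :
    Dens (fun z => (N : ℝ)⁻¹ * ∑ i, f i z) := by
  have hN' : (0 : ℝ) < N := by exact_mod_cast hN
  choose B hB using fun i => (hf i).bdd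
  refine ⟨?_, fun z => ?_, ⟨(N : ℝ)⁻¹ * ∑ i, B i, fun z => ?_⟩, ?_⟩
  · exact (Finset.measurable_sum _ fun i _ => (hf i).meas).const_mul _
  · exact mul_nonneg (by positivity) (Finset.sum_nonneg fun i _ => (hf i).nonneg z)
  · gcongr
    exact hB _ z
  · rw [integral_const_mul, integral_finsetSum _ fun i _ => (hf i).integrable]
    simp only [(hf _).mass]
    simp
    field_simp

theorem den_avg {N : ℕ} {f : Fin N → E2 → ℝ} (hf : ∀ i, Dens (f i)) {φ : E2 → ℝ} (hφ : Continuous φ) :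
    den (fun z => (N : ℝ)⁻¹ * ∑ i, f i z) φ = (N : ℝ)⁻¹ * ∑ i, den (f i) φ := by
  unfold den
  rw [← integral_finsetSum _ fun i _ => (hf i).integrable_mul hφ, ← integral_const_mul]
  congr 1; ext z
  simp only
  rw [Finset.mul_sum, Finset.mul_sum, Finset.mul_sum]
  congr 1; ext i; ring

theorem Weak.avg {N : ℕ} (hN : 0 < N) {f : Fin N → E2 → ℝ} (hf : ∀ i, Dens (f i)) {g : E2 → ℝ}
    {W : Fin N → E2 → E2} (hW : ∀ i, Integrable (W i) lam) (h : ∀ i, Weak (f i) g (W i)) :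
    Weak (fun z => (N : ℝ)⁻¹ * ∑ i, f i z) g (fun z => (N : ℝ)⁻¹ • ∑ i, W i z) := by
  have hN' : (N : ℝ) ≠ 0 := by positivity
  intro φ G hG hφ hL
  have h1 := fun i => h i φ G hG hφ hL
  obtain ⟨L, hL⟩ := hL
  rw [den_avg hf (cont_of_grad hφ)]
  simp only [inner_smul_right, inner_sum]
  rw [integral_const_mul, integral_finsetSum _ fun i _ => weak_inner_int hG hL (hW i)]
  simp only [← h1, Finset.sum_sub_distrib]
  simp
  field_simp

theorem Weak.mixr {f g : E2 → ℝ} (hf : Dens f) (hg : Dens g) {W : E2 → E2} (h : Weak f g W) (η : ℝ) :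
    Weak f (fun z => (1 - η) * f z + η * g z) (fun z => η • W z) := by
  intro φ G hG hφ hL
  have := h φ G hG hφ hL
  rw [den_mix hf hg _ (cont_of_grad hφ)]
  simp only [inner_smul_right]
  rw [integral_const_mul, ← this]; ring

theorem Weak.mixl {f g r : E2 → ℝ} (hf : Dens f) (hg : Dens g) (hr : Dens r) {W : E2 → E2} (h : Weak f g W) (η : ℝ) :
    Weak (fun z => (1 - η) * f z + η * r z) (fun z => (1 - η) * g z + η * r z) (fun z => (1 - η) • W z) := by
  intro φ G hG hφ hL
  have := h φ G hG hφ hL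
  rw [den_mix hf hr _ (cont_of_grad hφ), den_mix hg hr _ (cont_of_grad hφ)]
  simp only [inner_smul_right]
  rw [integral_const_mul, ← this]; ring

theorem path_mix {F r : E2 → ℝ} (hF : Dens F) (hr : Dens r) {Z : E2 → E2} (hZ : Measurable Z) {M : ℝ}
    (hZb : ∀ z ∈ Qs, ‖Z z‖ ≤ M) (hw : Weak F r Z) {c : ℝ} (hc : 0 < c) (hrc : ∀ z ∈ Qs, c ≤ r z)
    {η τ : ℝ} (hη : 0 < η) (hη1 : η ≤ 1) (hτ : 0 < τ) :
    TC τ (den F) (den (fun z => (1 - η) * F z + η * r z)) ((∫ z, 4 * η * (‖Z z‖ ^ 2 / r z) ∂lam) / (2 * τ)) := by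
  have hZi : Integrable Z lam := integrable_lam_of_bdd hZ.aestronglyMeasurable hZb
  refine path_lemma hF (hF.mix hr hη.le hη1) (W := fun z => η • Z z) (hZi.smul η) (hw.mixr hF hr η) ?_ hτ
    (a := fun s => s ^ 2) (by norm_num) (by norm_num) ?_ ?_ ?_
  · refine Integrable.const_mul (integrable_lam_of_bdd (B := M ^ 2 / c) ?_ ?_) _
    · exact ((hZ.norm.pow_const 2).div hr.meas).aestronglyMeasurable
    · intro z hz
      have h1 := hrc z hz
      have h2 := hZb z hz
      have h3 : 0 < r z := hc.trans_le h1
      rw [Real.norm_of_nonneg (by positivity)]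
      gcongr
  · intro s hs
    exact ⟨by positivity, pow_le_one₀ hs.1 hs.2⟩
  · intro n k hk z hz
    have h3 : 0 < r z := hc.trans_le (hrc z hz)
    have hn : (0 : ℝ) < n := by exact_mod_cast (by omega : 0 < n)
    have h4 := hF.nonneg z
    rw [norm_smul, Real.norm_of_nonneg hη.le]
    set a' : ℝ := (((k : ℝ) + 1) / n) ^ 2 with ha'
    have ha1 : a' ≤ 1 := by
      apply pow_le_one₀ (by positivity)
      rw [div_le_one hn]
      exact_mod_cast hk
    have ha0 : 0 ≤ a' := by positivity
    have e1 : (n * (a' - (k / n) ^ 2)) ^ 2 ≤ 4 * a' := by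
      have : (n * (a' - (k / n) ^ 2)) = (2 * k + 1) / n := by rw [ha']; field_simp; ring
      rw [this, ha', div_pow, div_pow, ← mul_div_assoc]
      gcongr
      have hk0 : (0 : ℝ) ≤ k := k.cast_nonneg
      nlinarith
    have e2 : a' * (η * r z) ≤ (1 - a') * F z + a' * ((1 - η) * F z + η * r z) := by
      have : 0 ≤ (1 - a') * F z := mul_nonneg (by linarith) h4
      have : 0 ≤ a' * ((1 - η) * F z) := mul_nonneg ha0 (mul_nonneg (by linarith) h4)
      linarith
    calc (n * (a' - (k / n) ^ 2)) ^ 2 * (η * ‖Z z‖) ^ 2 ≤ 4 * a' * (η * ‖Z z‖) ^ 2 := by gcongr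
      _ = 4 * η * (‖Z z‖ ^ 2 / r z) * (a' * (η * r z)) := by field_simp
      _ ≤ _ := by gcongr
  · intro z hz
    have h3 : 0 < r z := hc.trans_le (hrc z hz)
    positivity

/-- the kinetic integrand of the main phase -/
def HC (η : ℝ) (F G r : E2 → ℝ) (Z : E2 → E2) (z : E2) : ℝ :=
  ‖Z z‖ ^ 2 / r z * (1 + 1 / η * (|F z / r z - 1| + |G z / r z - 1|))

theorem path_main {F G r : E2 → ℝ} (hF : Dens F) (hG : Dens G) (hr : Dens r) {Z : E2 → E2} (hZ : Measurable Z) {M : ℝ}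
    (hZb : ∀ z ∈ Qs, ‖Z z‖ ≤ M) (hw : Weak F G Z) {c : ℝ} (hc : 0 < c) (hrc : ∀ z ∈ Qs, c ≤ r z)
    {η T : ℝ} (hη : 0 < η) (hη1 : η ≤ 1) (hT : 0 < T) :
    TC T (den (fun z => (1 - η) * F z + η * r z)) (den (fun z => (1 - η) * G z + η * r z))
      ((∫ z, HC η F G r Z z ∂lam) / (2 * T)) := by
  have hZi : Integrable Z lam := integrable_lam_of_bdd hZ.aestronglyMeasurable hZb
  refine path_lemma (hF.mix hr hη.le hη1) (hG.mix hr hη.le hη1) (W := fun z => (1 - η) • Z z)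
    (hZi.smul (1 - η)) (hw.mixl hF hG hr η) ?_ hT
    (a := fun s => s) (by norm_num) (by norm_num) (fun s hs => hs) ?_ ?_
  · obtain ⟨A, hA⟩ := hF.bdd
    obtain ⟨A', hA'⟩ := hG.bdd
    refine integrable_lam_of_bdd (B := M ^ 2 / c * (1 + 1 / η * ((A / c + 1) + (A' / c + 1)))) ?_ ?_
    · unfold HC
      have := hF.meas; have := hG.meas; have := hr.meas
      exact Measurable.aestronglyMeasurable (by fun_prop)
    · intro z hz
      have h1 := hrc z hz
      have h2 := hZb z hz
      have h3 : 0 < r z := hc.trans_le h1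
      have b : ∀ {f : E2 → ℝ} (A : ℝ), Dens f → f z ≤ A → |f z / r z - 1| ≤ A / c + 1 := by
        intro f A hf hA
        have h0 := hf.nonneg z
        have : 0 ≤ f z / r z := by positivity
        have : f z / r z ≤ A / c := div_le_div₀ (h0.trans hA) hA hc h1
        rw [abs_le]; constructor <;> linarith
      have b1 := b A hF (hA z)
      have b2 := b A' hG (hA' z)
      unfold HC
      rw [Real.norm_of_nonneg (by positivity)]
      gcongr
  · intro n k hk z hz
    have h3 : 0 < r z := hc.trans_le (hrc z hz)
    have hn : (0 : ℝ) < n := by exact_mod_cast (by omega : 0 < n)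
    rw [norm_smul, Real.norm_of_nonneg (by linarith)]
    have e1 : n * (((k : ℝ) + 1) / n - k / n) = 1 := by field_simp; ring
    rw [e1]
    set a' : ℝ := ((k : ℝ) + 1) / n with ha'
    have ha1 : a' ≤ 1 := by
      rw [div_le_one hn]
      exact_mod_cast hk
    have ha0 : 0 ≤ a' := by positivity
    set u := F z / r z with hu
    set v := G z / r z with hv
    have hFu : F z = u * r z := by rw [hu]; field_simp
    have hGv : G z = v * r z := by rw [hv]; field_simp
    have hu0 : 0 ≤ u := div_nonneg (hF.nonneg z) h3.le
    have hv0 : 0 ≤ v := div_nonneg (hG.nonneg z) h3.le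
    unfold HC
    rw [← hu, ← hv]
    set E := |u - 1| + |v - 1| with hE
    have hE0 : 0 ≤ E := by positivity
    have e3 : (1 - a') * ((1 - η) * F z + η * r z) + a' * ((1 - η) * G z + η * r z) =
      r z * (η + (1 - η) * ((1 - a') * u + a' * v)) := by rw [hFu, hGv]; ring
    rw [e3]
    have k1 : 0 ≤ (1 - a') * u + a' * v := by
      have : 0 ≤ 1 - a' := by linarith
      positivity
    have k2 : 1 - E ≤ (1 - a') * u + a' * v := by
      have := neg_abs_le (u - 1)
      have := neg_abs_le (v - 1)
      have := abs_nonneg (u - 1)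
      have := abs_nonneg (v - 1)
      nlinarith
    have k3 : η ≤ η + (1 - η) * ((1 - a') * u + a' * v) := by
      have : 0 ≤ (1 - η) * ((1 - a') * u + a' * v) := mul_nonneg (by linarith) k1
      linarith
    have k4 : 1 - E ≤ η + (1 - η) * ((1 - a') * u + a' * v) := by
      have : (1 - η) * (1 - E) ≤ (1 - η) * ((1 - a') * u + a' * v) :=
        mul_le_mul_of_nonneg_left k2 (by linarith)
      nlinarith
    set D := η + (1 - η) * ((1 - a') * u + a' * v)
    have k5 : 1 ≤ (1 + 1 / η * E) * D := by
      rcases le_total E (1 - η) with h | h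
      · have h6 : (1 + 1 / η * E) * (1 - E) ≤ (1 + 1 / η * E) * D := by gcongr
        have h7 : (1 + 1 / η * E) * (1 - E) = 1 + E / η * (1 - η - E) := by field_simp; ring
        have h8 : 0 ≤ E / η * (1 - η - E) := mul_nonneg (by positivity) (by linarith)
        linarith
      · have h6 : (1 + 1 / η * E) * η ≤ (1 + 1 / η * E) * D := by gcongr
        have h7 : (1 + 1 / η * E) * η = η + E := by field_simp
        linarith
    have e4 : ‖Z z‖ ^ 2 / r z * (1 + 1 / η * E) * (r z * D) = ‖Z z‖ ^ 2 * ((1 + 1 / η * E) * D) := by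
      field_simp
    rw [e4]
    have k6 : (1 - η) ^ 2 ≤ 1 := pow_le_one₀ (by linarith) (by linarith)
    have : (1 - η) ^ 2 * ‖Z z‖ ^ 2 ≤ ‖Z z‖ ^ 2 := by
      have := mul_le_mul_of_nonneg_right k6 (sq_nonneg ‖Z z‖)
      linarith
    have : ‖Z z‖ ^ 2 ≤ ‖Z z‖ ^ 2 * ((1 + 1 / η * E) * D) := le_mul_of_one_le_right (by positivity) k5
    rw [mul_pow]; linarith
  · intro z hz
    have h3 : 0 < r z := hc.trans_le (hrc z hz)
    unfold HC
    positivity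

/-- empirical functional -/
def emp {N : ℕ} (x : Fin N → E2) (φ : E2 → ℝ) : ℝ := (N : ℝ)⁻¹ * ∑ i, φ (x i)

theorem emp_good {N : ℕ} (x : Fin N → E2) : Good (emp x) := by
  refine ⟨fun L φ ψ _ _ h => ?_, fun φ => ?_⟩
  · unfold emp
    gcongr
    exact h _
  · simp [emp]

/-- histogram density -/
def hist (m : ℕ) {N : ℕ} (x : Fin N → E2) (z : E2) : ℝ := (N : ℝ)⁻¹ * ∑ i, w0 m (x i) z

theorem hist_dens {m : ℕ} (hm : 0 < m) {N : ℕ} (hN : 0 < N) {x : Fin N → E2} (hx : ∀ i, x i ∈ Qs) :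
    Dens (hist m x) := Dens.avg hN fun i => w0_dens hm (hx i)

theorem TC_hist {m : ℕ} (hm : 0 < m) {N : ℕ} (hN : 0 < N) {x : Fin N → E2} (hx : ∀ i, x i ∈ Qs) {τ : ℝ} (hτ : 0 < τ) :
    TC τ (emp x) (den (hist m x)) ((2 / m) ^ 2 / (2 * τ)) := by
  intro L φ hφ
  have hN' : (N : ℝ) ≠ 0 := by positivity
  have hH := (HL_lip hφ hτ).continuous
  have e : den (hist m x) (HL τ φ) = (N : ℝ)⁻¹ * ∑ i, den (w0 m (x i)) (HL τ φ) :=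
    den_avg (fun i => w0_dens hm (hx i)) hH
  have h1 : ∀ i, den (w0 m (x i)) (HL τ φ) ≤ φ (x i) + (2 / m) ^ 2 / (2 * τ) := by
    intro i
    have hD := w0_dens hm (hx i)
    have : den (w0 m (x i)) (HL τ φ) ≤ ∫ z, (φ (x i) + (2 / m) ^ 2 / (2 * τ)) * w0 m (x i) z ∂lam := by
      refine integral_mono (hD.integrable_mul hH) (hD.integrable.const_mul _) fun z => ?_
      simp only
      by_cases h : w0 m (x i) z = 0
      · simp [h]
      · refine mul_le_mul_of_nonneg_right ?_ (hD.nonneg z)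
        refine (HL_le hφ hτ (x i) z).trans ?_
        have := w0_near hm h
        rw [norm_sub_rev] at this
        gcongr
    rwa [integral_const_mul, hD.mass, mul_one] at this
  have h2 : (N : ℝ)⁻¹ * ∑ i, den (w0 m (x i)) (HL τ φ) ≤ (N : ℝ)⁻¹ * ∑ i : Fin N, (φ (x i) + (2 / m) ^ 2 / (2 * τ)) := by
    gcongr
    exact h1 _
  rw [e]
  rw [Finset.sum_add_distrib] at h2
  simp only [Finset.sum_const, Finset.card_univ, Fintype.card_fin, nsmul_eq_mul] at h2
  rw [mul_add, ← mul_assoc, inv_mul_cancel₀ hN', one_mul] at h2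
  unfold emp
  linarith

theorem chain {m : ℕ} (hm : 0 < m) {N : ℕ} (hN : 0 < N) {x y : Fin N → E2} (hx : ∀ i, x i ∈ Qs) (hy : ∀ i, y i ∈ Qs)
    {r : E2 → ℝ} (hr : Dens r) {c : ℝ} (hc : 0 < c) (hrc : ∀ z ∈ Qs, c ≤ r z) {ZX ZY : E2 → E2}
    (mX : Measurable ZX) (mY : Measurable ZY) {M : ℝ} (bX : ∀ z ∈ Qs, ‖ZX z‖ ≤ M) (bY : ∀ z ∈ Qs, ‖ZY z‖ ≤ M)
    (wX : Weak (hist m x) r ZX) (wY : Weak (hist m y) r ZY) {η τ : ℝ} (hη : 0 < η) (hη1 : η ≤ 1) (hτ : 0 < τ)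
    (hτ1 : 4 * τ < 1) :
    W2sq (empMeas x) (empMeas y) ≤ 8 / (τ * m ^ 2) +
      4 * η / τ * (∫ z, ‖ZX z‖ ^ 2 / r z ∂lam + ∫ z, ‖ZY z‖ ^ 2 / r z ∂lam) +
      (1 / (1 - 4 * τ)) * ∫ z, HC η (hist m x) (hist m y) r (fun z => ZX z - ZY z) z ∂lam := by
  have hFX := hist_dens hm hN hx
  have hFY := hist_dens hm hN hy
  have gX := den_good hFX
  have gY := den_good hFY
  have gX' := den_good (hFX.mix hr hη.le hη1)
  have gY' := den_good (hFY.mix hr hη.le hη1)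
  have hT : 0 < 1 - 4 * τ := by linarith
  have t1 := TC_hist hm hN hx hτ
  have t2 := path_mix hFX hr mX bX wX hc hrc hη hη1 hτ
  have hwXY : Weak (hist m x) (hist m y) (fun z => ZX z - ZY z) := by
    have := wX.trans wY.symm (integrable_lam_of_bdd mX.aestronglyMeasurable bX)
      (integrable_lam_of_bdd mY.aestronglyMeasurable bY).neg
    simpa only [← sub_eq_add_neg] using this
  have t3 := path_main hFX hFY hr (Z := fun z => ZX z - ZY z) (mX.sub mY) (M := M + M) (fun z hz => (norm_sub_le _ _).trans
    (add_le_add (bX z hz) (bY z hz))) hwXY hc hrc hη hη1 hT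
  have t4 := TC_symm hτ gY gY' (path_mix hFY hr mY bY wY hc hrc hη hη1 hτ)
  have t5 := TC_symm hτ (emp_good y) gY (TC_hist hm hN hy hτ)
  have t := TC_trans (by linarith) hτ (emp_good y) (TC_trans (by linarith) hτ gY (TC_trans (by linarith) hT gY' (TC_trans hτ hτ gX' t1 t2) t3) t4) t5
  have eT : τ + τ + (1 - 4 * τ) + τ + τ = 1 := by ring
  rw [eT] at t
  have : ∀ C, TC 1 (emp x) (emp y) C → W2sq (empMeas x) (empMeas y) / 2 ≤ C := by
    intro C hC
    refine le_of_forall_pos_le_add fun δ hδ => ?_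
    obtain ⟨φ, hφ, h⟩ := duality hN x y (fun i => sq_subset (hx i)) (fun i => sq_subset (hy i)) hδ
    have h2 := hC 2 φ hφ
    unfold emp at h2
    linarith
  have := this _ t
  have e2 : ∀ Z : E2 → E2, ∫ z, 4 * η * (‖Z z‖ ^ 2 / r z) ∂lam = 4 * η * ∫ z, ‖Z z‖ ^ 2 / r z ∂lam := fun Z =>
    integral_const_mul _ _
  rw [e2, e2] at this
  have hm' : (m : ℝ) ≠ 0 := by positivity
  set A := ∫ z, ‖ZX z‖ ^ 2 / r z ∂lam
  set A' := ∫ z, ‖ZY z‖ ^ 2 / r z ∂lam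
  set C := ∫ z, HC η (hist m x) (hist m y) r (fun z => ZX z - ZY z) z ∂lam
  have e3 : 8 / (τ * m ^ 2) + 4 * η / τ * (A + A') + (1 / (1 - 4 * τ)) * C =
    2 * ((2 / m) ^ 2 / (2 * τ) + 4 * η * A / (2 * τ) + C / (2 * (1 - 4 * τ)) + 4 * η * A' / (2 * τ) + (2 / m) ^ 2 / (2 * τ)) := by
    field_simp
    ring
  rw [e3]
  linarith

/-- mean field -/
def Vb (m : ℕ) (δ : ℝ) (R : E2 → ℝ) (z : E2) : E2 := ∫ x, R x • V m δ x z ∂lam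

/-- centred field -/
def Zf (m : ℕ) (δ : ℝ) (R : E2 → ℝ) (x z : E2) : E2 := V m δ x z - Vb m δ R z

theorem RV_measurable (m : ℕ) (δ : ℝ) {R : E2 → ℝ} (hR : Measurable R) :
    Measurable (fun y : E2 × E2 => R y.2 • V m δ y.2 y.1) :=
  (hR.comp measurable_snd).smul ((V_measurable m δ).comp measurable_swap)

theorem Vb_measurable (m : ℕ) (δ : ℝ) {R : E2 → ℝ} (hR : Measurable R) : Measurable (Vb m δ R) :=
  ((RV_measurable m δ hR).stronglyMeasurable.integral_prod_right' (ν := lam)).measurable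

theorem Zf_measurable (m : ℕ) (δ : ℝ) {R : E2 → ℝ} (hR : Measurable R) :
    Measurable (fun y : E2 × E2 => Zf m δ R y.1 y.2) :=
  (V_measurable m δ).sub ((Vb_measurable m δ hR).comp measurable_snd)

theorem V_measurable_left (m : ℕ) (δ : ℝ) (z : E2) : Measurable (fun x => V m δ x z) :=
  (V_measurable m δ).comp (by fun_prop : Measurable fun x : E2 => (x, z))

theorem V_measurable_right (m : ℕ) (δ : ℝ) (x : E2) : Measurable (fun z => V m δ x z) :=
  (V_measurable m δ).comp (by fun_prop : Measurable fun z : E2 => (x, z))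

section
variable {R : E2 → ℝ} {a B : ℝ} {k : ℝ≥0} {m : ℕ} {δ M : ℝ}

theorem RV_int (h : Den R a B k) (hM : ∀ x ∈ Qs, ∀ z, ‖V m δ x z‖ ≤ M) (z : E2) :
    Integrable (fun x => R x • V m δ x z) lam := by
  refine integrable_lam_of_bdd (B := B * M)
    (h.dens.meas.smul (V_measurable_left m δ z)).aestronglyMeasurable fun x hx => ?_
  rw [norm_smul, Real.norm_of_nonneg (h.dens.nonneg x)]
  have := h.ub x
  have := hM x hx z
  have := (h.dens.nonneg x).trans (h.ub x)
  gcongr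

theorem Vb_bound (h : Den R a B k) (hM : ∀ x ∈ Qs, ∀ z, ‖V m δ x z‖ ≤ M) (z : E2) : ‖Vb m δ R z‖ ≤ M := by
  unfold Vb
  have := norm_integral_le_of_norm_le (h.dens.integrable.mul_const M) (f := fun x => R x • V m δ x z)
    (ae_lam.mono fun x hx => by
      rw [norm_smul, Real.norm_of_nonneg (h.dens.nonneg x)]
      exact mul_le_mul_of_nonneg_left (hM x hx z) (h.dens.nonneg x))
  rwa [integral_mul_const, h.mass, one_mul] at this

theorem Zf_bound (h : Den R a B k) (hM : ∀ x ∈ Qs, ∀ z, ‖V m δ x z‖ ≤ M) {x : E2} (hx : x ∈ Qs) (z : E2) :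
    ‖Zf m δ R x z‖ ≤ 2 * M := by
  have := norm_sub_le (V m δ x z) (Vb m δ R z)
  have := hM x hx z
  have := Vb_bound h hM z
  unfold Zf
  linarith

theorem Vb_weak (h : Den R a B k) (hm : 0 < m) (hδ : 0 < δ) (hM : ∀ x ∈ Qs, ∀ z, ‖V m δ x z‖ ≤ M) :
    Weak (rb m R) oneQ (Vb m δ R) := by
  intro φ G hG hφ hL
  have h1 := fun x hx => V_weak hm hδ (x := x) hx φ G hG hφ hL
  obtain ⟨L, hL⟩ := hL
  have hφc := cont_of_grad hφ
  obtain ⟨A, hA0, hA⟩ := continuous_bdd_sq hφc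
  have hB0 : 0 ≤ B := (h.dens.nonneg 0).trans (h.ub 0)
  have hL0 : 0 ≤ L := (norm_nonneg _).trans (hL 0)
  -- first Fubini
  have e1 : den (rb m R) φ = ∫ x, R x * den (w0 m x) φ ∂lam := by
    have hi : Integrable (Function.uncurry fun z x => φ z * (w0 m x z * R x)) (lam.prod lam) := by
      refine Integrable.of_bound ?_ (A * (m ^ 2 * B)) ?_
      · have : Measurable (fun y : E2 × E2 => φ y.1 * (w0 m y.2 y.1 * R y.2)) :=
          (hφc.measurable.comp measurable_fst).mul
            (((w0_measurable m).comp measurable_swap).mul (h.dens.meas.comp measurable_snd))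
        exact this.aestronglyMeasurable
      · refine ae_lam_prod.mono fun y hy => ?_
        simp only [Function.uncurry_def]
        rw [norm_mul, Real.norm_of_nonneg (mul_nonneg (w0_nonneg m y.2 y.1) (h.dens.nonneg y.2))]
        have := hA y.1 hy.1
        have := w0_le m y.2 y.1
        have := w0_nonneg m y.2 y.1
        have := h.ub y.2
        have := h.dens.nonneg y.2
        gcongr
    have := integral_integral_swap hi
    unfold den rb
    simp only [← integral_const_mul]
    rw [this]
    congr 1; ext x
    congr 1; ext z; ring
  have e2 : ∫ z, inner ℝ (G z) (Vb m δ R z) ∂lam = ∫ x, R x * ∫ z, inner ℝ (G z) (V m δ x z) ∂lam ∂lam := by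
    have hi : Integrable (Function.uncurry fun z x => R x * inner ℝ (G z) (V m δ x z)) (lam.prod lam) := by
      refine Integrable.of_bound ?_ (B * (L * M)) ?_
      · have : Measurable (fun y : E2 × E2 => R y.2 * inner ℝ (G y.1) (V m δ y.2 y.1)) :=
          (h.dens.meas.comp measurable_snd).mul
            ((hG.measurable.comp measurable_fst).inner ((V_measurable m δ).comp measurable_swap))
        exact this.aestronglyMeasurable
      · refine ae_lam_prod.mono fun y hy => ?_
        simp only [Function.uncurry_def]
        rw [norm_mul, Real.norm_of_nonneg (h.dens.nonneg y.2)]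
        have h2 : ‖inner ℝ (G y.1) (V m δ y.2 y.1)‖ ≤ L * M :=
          (norm_inner_le_norm _ _).trans (mul_le_mul (hL _) (hM _ hy.2 _) (norm_nonneg _) hL0)
        have := h.ub y.2
        have := h.dens.nonneg y.2
        gcongr
    have := integral_integral_swap hi
    simp only [integral_const_mul] at this
    rw [← this]
    congr 1; ext z
    unfold Vb
    rw [← integral_inner (RV_int h hM z)]
    simp only [inner_smul_right]
  rw [e1, e2]
  have e3 : den oneQ φ = ∫ x, R x * den oneQ φ ∂lam := by rw [integral_mul_const, h.mass, one_mul]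
  rw [e3, ← integral_sub (h.dens.integrable.mul_const _)]
  · apply integral_congr_ae
    refine ae_lam.mono fun x hx => ?_
    simp only
    rw [← h1 x hx]; ring
  · refine integrable_lam_of_bdd (B := B * (A * m ^ 2)) ?_ ?_
    · have h3 : Measurable (fun y : E2 × E2 => φ y.2 * w0 m y.1 y.2) :=
        (hφc.measurable.comp measurable_snd).mul (w0_measurable m)
      have h4 : Measurable (fun x => den (w0 m x) φ) :=
        (h3.stronglyMeasurable.integral_prod_right' (ν := lam)).measurable
      exact (h.dens.meas.mul h4).aestronglyMeasurable
    · intro x hx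
      rw [norm_mul, Real.norm_of_nonneg (h.dens.nonneg x)]
      have h5 : ‖den (w0 m x) φ‖ ≤ A * m ^ 2 := by
        unfold den
        have := norm_integral_le_of_norm_le (integrable_const (μ := lam) (A * (m : ℝ) ^ 2)) (f := fun z => φ z * w0 m x z)
          (ae_lam.mono fun z hz => by
            rw [norm_mul, Real.norm_of_nonneg (w0_nonneg m x z)]
            exact mul_le_mul (hA z hz) (w0_le m x z) (w0_nonneg m x z) hA0)
        simpa using this
      have := h.ub x
      gcongr

theorem Zf_weak (h : Den R a B k) (hm : 0 < m) (hδ : 0 < δ) (hM : ∀ x ∈ Qs, ∀ z, ‖V m δ x z‖ ≤ M) {x : E2} (hx : x ∈ Qs) :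
    Weak (w0 m x) (rb m R) (Zf m δ R x) := by
  have := (V_weak hm hδ hx).trans (Vb_weak h hm hδ hM).symm
    (integrable_lam_of_bdd (V_measurable_right m δ x).aestronglyMeasurable fun z _ => hM x hx z)
    (integrable_lam_of_bdd (Vb_measurable m δ h.dens.meas).aestronglyMeasurable fun z _ => Vb_bound h hM z).neg
  simp only [← sub_eq_add_neg] at this
  exact this

/-- empirical field -/
def ZN (m : ℕ) (δ : ℝ) (R : E2 → ℝ) {N : ℕ} (x : Fin N → E2) (z : E2) : E2 := (N : ℝ)⁻¹ • ∑ i, Zf m δ R (x i) z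

theorem ZN_measurable (m : ℕ) (δ : ℝ) (hR : Measurable R) {N : ℕ} :
    Measurable (fun y : (Fin N → E2) × E2 => ZN m δ R y.1 y.2) := by
  unfold ZN
  have : Measurable (fun y : (Fin N → E2) × E2 => ∑ i, Zf m δ R (y.1 i) y.2) := by
    refine Finset.measurable_sum _ fun i _ => ?_
    exact (Zf_measurable m δ hR).comp (by fun_prop : Measurable fun y : (Fin N → E2) × E2 => (y.1 i, y.2))
  exact this.const_smul ((N : ℝ)⁻¹)

theorem ZN_bound (h : Den R a B k) (hM : ∀ x ∈ Qs, ∀ z, ‖V m δ x z‖ ≤ M) {N : ℕ} (hN : 0 < N) {x : Fin N → E2}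
    (hx : ∀ i, x i ∈ Qs) (z : E2) : ‖ZN m δ R x z‖ ≤ 2 * M := by
  have hN' : (N : ℝ) ≠ 0 := by positivity
  unfold ZN
  rw [norm_smul, Real.norm_of_nonneg (by positivity)]
  have : ‖∑ i, Zf m δ R (x i) z‖ ≤ ∑ i : Fin N, 2 * M := norm_sum_le_of_le _ fun i _ => Zf_bound h hM (hx i) z
  calc _ ≤ (N : ℝ)⁻¹ * ∑ i : Fin N, 2 * M := by gcongr
    _ = 2 * M := by simp; field_simp

theorem ZN_weak (h : Den R a B k) (hm : 0 < m) (hδ : 0 < δ) (hM : ∀ x ∈ Qs, ∀ z, ‖V m δ x z‖ ≤ M) {N : ℕ} (hN : 0 < N)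
    {x : Fin N → E2} (hx : ∀ i, x i ∈ Qs) : Weak (hist m x) (rb m R) (ZN m δ R x) := by
  refine Weak.avg hN (fun i => w0_dens hm (hx i)) (fun i => ?_) (fun i => Zf_weak h hm hδ hM (hx i))
  refine integrable_lam_of_bdd (B := 2 * M) ?_ fun z _ => Zf_bound h hM (hx i) z
  exact ((Zf_measurable m δ h.dens.meas).comp (by fun_prop : Measurable fun z : E2 => (x i, z))).aestronglyMeasurable

theorem det_bound (h : Den R a B k) (hm : 0 < m) (hδ : 0 < δ) (hM : ∀ x ∈ Qs, ∀ z, ‖V m δ x z‖ ≤ M) {N : ℕ} (hN : 0 < N)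
    {x y : Fin N → E2} (hx : ∀ i, x i ∈ Qs) (hy : ∀ i, y i ∈ Qs) {η τ : ℝ} (hη : 0 < η) (hη1 : η ≤ 1) (hτ : 0 < τ)
    (hτ1 : 4 * τ < 1) :
    W2sq (empMeas x) (empMeas y) ≤ 8 / (τ * m ^ 2) +
      4 * η / τ * (∫ z, ‖ZN m δ R x z‖ ^ 2 / rb m R z ∂lam + ∫ z, ‖ZN m δ R y z‖ ^ 2 / rb m R z ∂lam) +
      (1 / (1 - 4 * τ)) * ∫ z, HC η (hist m x) (hist m y) (rb m R) (fun z => ZN m δ R x z - ZN m δ R y z) z ∂lam :=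
  chain hm hN hx hy (rb_dens hm h) h.apos (fun z hz => rb_lb hm h hz)
    ((ZN_measurable m δ h.dens.meas).comp (by fun_prop : Measurable fun z : E2 => (x, z)))
    ((ZN_measurable m δ h.dens.meas).comp (by fun_prop : Measurable fun z : E2 => (y, z)))
    (fun z _ => ZN_bound h hM hN hx z) (fun z _ => ZN_bound h hM hN hy z)
    (ZN_weak h hm hδ hM hN hx) (ZN_weak h hm hδ hM hN hy) hη hη1 hτ hτ1
end

section moments
open ProbabilityTheory
variable {Ω : Type*} [MeasurableSpace Ω] {P : Measure Ω} [IsProbabilityMeasure P]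

theorem int_pow_bdd {X : Ω → ℝ} (hX : Measurable X) {b : ℝ} (hb : ∀ᵐ ω ∂P, |X ω| ≤ b) (n : ℕ) :
    Integrable (fun ω => X ω ^ n) P :=
  Integrable.of_bound (hX.pow_const n).aestronglyMeasurable (b ^ n) (hb.mono fun ω h => by
    rw [norm_pow]; exact pow_le_pow_left₀ (norm_nonneg _) h n)

theorem int_mul_bdd {X Y : Ω → ℝ} (hX : Measurable X) (hY : Measurable Y) {b : ℝ} (hbX : ∀ᵐ ω ∂P, |X ω| ≤ b)
    (hbY : ∀ᵐ ω ∂P, |Y ω| ≤ b) (n k : ℕ) :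
    Integrable (fun ω => X ω ^ n * Y ω ^ k) P :=
  Integrable.of_bound ((hX.pow_const n).mul (hY.pow_const k)).aestronglyMeasurable (b ^ n * b ^ k)
    ((hbX.and hbY).mono fun ω h => by
      rw [norm_mul, norm_pow, norm_pow]
      exact mul_le_mul (pow_le_pow_left₀ (norm_nonneg _) h.1 n) (pow_le_pow_left₀ (norm_nonneg _) h.2 k)
        (by positivity) (pow_nonneg ((abs_nonneg _).trans h.1) n))

theorem indep_mul {X Y : Ω → ℝ} (hX : Measurable X) (hY : Measurable Y) (h : IndepFun X Y P) (n k : ℕ) :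
    ∫ ω, X ω ^ n * Y ω ^ k ∂P = (∫ ω, X ω ^ n ∂P) * ∫ ω, Y ω ^ k ∂P := by
  have h2 : IndepFun (fun ω => X ω ^ n) (fun ω => Y ω ^ k) P :=
    h.comp (φ := fun t : ℝ => t ^ n) (ψ := fun t : ℝ => t ^ k) (by fun_prop) (by fun_prop)
  exact h2.integral_fun_mul_eq_mul_integral (hX.pow_const n).aestronglyMeasurable
    (hY.pow_const k).aestronglyMeasurable

theorem pair_moment {X Y : Ω → ℝ} (hX : Measurable X) (hY : Measurable Y) {b : ℝ} (hbX : ∀ᵐ ω ∂P, |X ω| ≤ b)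
    (hbY : ∀ᵐ ω ∂P, |Y ω| ≤ b) (h : IndepFun X Y P) (eX : ∫ ω, X ω ∂P = 0) (eY : ∫ ω, Y ω ∂P = 0) :
    ∫ ω, (X ω + Y ω) ^ 2 ∂P = ∫ ω, X ω ^ 2 ∂P + ∫ ω, Y ω ^ 2 ∂P ∧
    ∫ ω, (X ω + Y ω) ^ 4 ∂P = ∫ ω, X ω ^ 4 ∂P + 6 * ((∫ ω, X ω ^ 2 ∂P) * ∫ ω, Y ω ^ 2 ∂P) + ∫ ω, Y ω ^ 4 ∂P := by
  have I := int_mul_bdd hX hY hbX hbY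
  have E := indep_mul hX hY h
  have e1 : ∫ ω, X ω ^ 1 ∂P = 0 := by simpa using eX
  have e2 : ∫ ω, Y ω ^ 1 ∂P = 0 := by simpa using eY
  have z0 : ∫ ω, Y ω ^ 0 ∂P = 1 := by simp
  have z1 : ∫ ω, X ω ^ 0 ∂P = 1 := by simp
  constructor
  · have : ∀ ω, (X ω + Y ω) ^ 2 = X ω ^ 2 * Y ω ^ 0 + 2 * (X ω ^ 1 * Y ω ^ 1) + X ω ^ 0 * Y ω ^ 2 := fun ω => by ring
    simp only [this]
    have i1 : Integrable (fun ω => X ω ^ 2 * Y ω ^ 0 + 2 * (X ω ^ 1 * Y ω ^ 1)) P := (I 2 0).add ((I 1 1).const_mul 2)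
    rw [integral_add i1 (I 0 2), integral_add (I 2 0) ((I 1 1).const_mul 2), integral_const_mul, E, E, E, e1, z0, z1]
    ring
  · have : ∀ ω, (X ω + Y ω) ^ 4 = X ω ^ 4 * Y ω ^ 0 + 4 * (X ω ^ 3 * Y ω ^ 1) + 6 * (X ω ^ 2 * Y ω ^ 2)
      + 4 * (X ω ^ 1 * Y ω ^ 3) + X ω ^ 0 * Y ω ^ 4 := fun ω => by ring
    simp only [this]
    have i1 : Integrable (fun ω => X ω ^ 4 * Y ω ^ 0 + 4 * (X ω ^ 3 * Y ω ^ 1)) P := (I 4 0).add ((I 3 1).const_mul 4)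
    have i2 : Integrable (fun ω => X ω ^ 4 * Y ω ^ 0 + 4 * (X ω ^ 3 * Y ω ^ 1) + 6 * (X ω ^ 2 * Y ω ^ 2)) P :=
      i1.add ((I 2 2).const_mul 6)
    have i3 : Integrable (fun ω => X ω ^ 4 * Y ω ^ 0 + 4 * (X ω ^ 3 * Y ω ^ 1) + 6 * (X ω ^ 2 * Y ω ^ 2)
      + 4 * (X ω ^ 1 * Y ω ^ 3)) P := i2.add ((I 1 3).const_mul 4)
    rw [integral_add i3 (I 0 4), integral_add i2 ((I 1 3).const_mul 4), integral_add i1 ((I 2 2).const_mul 6),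
      integral_add (I 4 0) ((I 3 1).const_mul 4), integral_const_mul, integral_const_mul, integral_const_mul,
      E, E, E, E, E, e1, e2, z0, z1]
    ring

theorem sum_moment {ι : Type*} {Y : ι → Ω → ℝ} (hY : ∀ i, Measurable (Y i)) (hind : iIndepFun Y P) {b : ℝ}
    (hb : ∀ i, ∀ᵐ ω ∂P, |Y i ω| ≤ b) (h1 : ∀ i, ∫ ω, Y i ω ∂P = 0) {A D : ℝ} (h2 : ∀ i, ∫ ω, Y i ω ^ 2 ∂P ≤ A)
    (h4 : ∀ i, ∫ ω, Y i ω ^ 4 ∂P ≤ D) (s : Finset ι) :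
    (∀ᵐ ω ∂P, |∑ i ∈ s, Y i ω| ≤ s.card * b) ∧ ∫ ω, ∑ i ∈ s, Y i ω ∂P = 0 ∧
    ∫ ω, (∑ i ∈ s, Y i ω) ^ 2 ∂P ≤ s.card * A ∧
    ∫ ω, (∑ i ∈ s, Y i ω) ^ 4 ∂P ≤ 3 * s.card ^ 2 * A ^ 2 + s.card * D := by
  classical
  induction s using Finset.induction_on with
  | empty => simp
  | insert j s hj ih =>
    obtain ⟨ihb, ih1, ih2, ih4⟩ := ih
    have hA : 0 ≤ A := (integral_nonneg fun ω => by positivity).trans (h2 j)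
    have hb0 : 0 ≤ b := by
      obtain ⟨ω, hω⟩ := (hb j).exists
      exact (abs_nonneg _).trans hω
    have mS : Measurable (fun ω => ∑ i ∈ s, Y i ω) := Finset.measurable_sum _ fun i _ => hY i
    have hi : IndepFun (fun ω => ∑ i ∈ s, Y i ω) (Y j) P := by
      have := hind.indepFun_finsetSum_of_notMem hY hj
      convert this using 1
      ext ω; simp
    have n0 : (0 : ℝ) ≤ s.card := Nat.cast_nonneg _
    have pm := pair_moment (hY j) mS (b := (s.card + 1) * b) ((hb j).mono fun ω h => h.trans (by nlinarith))
      (ihb.mono fun ω h => h.trans (by nlinarith)) hi.symm (h1 j) ih1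
    simp only [Finset.sum_insert hj, Finset.card_insert_of_notMem hj]
    push_cast
    refine ⟨?_, ?_, ?_, ?_⟩
    · filter_upwards [hb j, ihb] with ω a1 a2
      refine (abs_add_le _ _).trans ?_
      linarith
    · have a1 := int_pow_bdd (hY j) (hb j) 1
      have a2 := int_pow_bdd mS ihb 1
      simp only [pow_one] at a1 a2
      rw [integral_add a1 a2, h1, ih1, add_zero]
    · rw [pm.1]
      linarith [h2 j]
    · rw [pm.2]
      have : (∫ ω, Y j ω ^ 2 ∂P) * ∫ ω, (∑ i ∈ s, Y i ω) ^ 2 ∂P ≤ A * (s.card * A) :=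
        mul_le_mul (h2 j) ih2 (integral_nonneg fun ω => by positivity) hA
      nlinarith [h4 j, sq_nonneg A]
end moments

/-- law of the points -/
def muR (R : E2 → ℝ) : Measure E2 := lam.withDensity fun x => ENNReal.ofReal (R x)

section
variable {R : E2 → ℝ} {a B : ℝ} {k : ℝ≥0}

theorem muR_integral (h : Den R a B k) (f : E2 → ℝ) : ∫ x, f x ∂(muR R) = ∫ x, f x * R x ∂lam := by
  unfold muR
  rw [integral_withDensity_eq_integral_toReal_smul (h.dens.meas.ennreal_ofReal) (by simp)]
  congr 1; ext x
  rw [ENNReal.toReal_ofReal (h.dens.nonneg x), smul_eq_mul, mul_comm]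

theorem muR_prob (h : Den R a B k) : IsProbabilityMeasure (muR R) := ⟨by
  unfold muR
  rw [withDensity_apply _ MeasurableSet.univ, Measure.restrict_univ,
    ← ofReal_integral_eq_lintegral_ofReal h.dens.integrable (Eventually.of_forall h.dens.nonneg), h.mass,
    ENNReal.ofReal_one]⟩

theorem muR_ae : ∀ᵐ x ∂(muR R), x ∈ Qs :=
  (withDensity_absolutelyContinuous _ _).ae_le ae_lam

/-- joint law of the sample -/
def PN (R : E2 → ℝ) (N : ℕ) : Measure (Fin N → E2) := Measure.pi fun _ => muR R

theorem PN_prob (h : Den R a B k) (N : ℕ) : IsProbabilityMeasure (PN R N) := by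
  have := muR_prob h
  unfold PN; infer_instance

theorem PN_ae (h : Den R a B k) (N : ℕ) : ∀ᵐ x ∂(PN R N), ∀ i, x i ∈ Qs := by
  have := muR_prob h
  rw [ae_all_iff]
  intro i
  exact (Measure.quasiMeasurePreserving_eval (fun _ : Fin N => muR R) i).ae muR_ae

theorem PN_moment (h : Den R a B k) {N : ℕ} (hN : 0 < N) {ξ : E2 → ℝ} (hξ : Measurable ξ) {b : ℝ} (hb : ∀ x ∈ Qs, |ξ x| ≤ b)
    (h1 : ∫ x, ξ x * R x ∂lam = 0) {A : ℝ} (h2 : ∫ x, ξ x ^ 2 * R x ∂lam ≤ A) :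
    ∫ x, ((N : ℝ)⁻¹ * ∑ i, ξ (x i)) ∂(PN R N) = 0 ∧
    ∫ x, ((N : ℝ)⁻¹ * ∑ i, ξ (x i)) ^ 2 ∂(PN R N) ≤ A / N ∧
    ∫ x, ((N : ℝ)⁻¹ * ∑ i, ξ (x i)) ^ 4 ∂(PN R N) ≤ 3 * A ^ 2 / N ^ 2 + b ^ 2 * A / N ^ 3 := by
  have hp := muR_prob h
  have hpN := PN_prob h N
  have hN' : (0 : ℝ) < N := by exact_mod_cast hN
  have ev : ∀ (i : Fin N) (f : E2 → ℝ), Measurable f → ∫ x, f (x i) ∂(PN R N) = ∫ x, f x * R x ∂lam := by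
    intro i f hf
    rw [← muR_integral h]
    have := (measurePreserving_eval (fun _ : Fin N => muR R) i)
    rw [← this.map_eq, integral_map (measurable_pi_apply i).aemeasurable hf.aestronglyMeasurable]
    rfl
  have h4 : ∫ x, ξ x ^ 4 * R x ∂lam ≤ b ^ 2 * A := by
    have i2 : Integrable (fun x => ξ x ^ 2 * R x) lam := by
      refine integrable_lam_of_bdd (B := b ^ 2 * B) ((hξ.pow_const 2).mul h.dens.meas).aestronglyMeasurable fun x hx => ?_
      rw [norm_mul, norm_pow, Real.norm_of_nonneg (h.dens.nonneg x)]
      have := hb x hx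
      have := h.ub x
      have := h.dens.nonneg x
      rw [Real.norm_eq_abs]
      gcongr
    calc ∫ x, ξ x ^ 4 * R x ∂lam ≤ ∫ x, b ^ 2 * (ξ x ^ 2 * R x) ∂lam := by
          refine integral_mono_of_nonneg (Eventually.of_forall fun x => ?_) (i2.const_mul _) (ae_lam.mono fun x hx => ?_)
          · have := h.dens.nonneg x
            simp only [Pi.zero_apply]; positivity
          · have h5 : ξ x ^ 2 ≤ b ^ 2 := sq_le_sq' (by linarith [neg_abs_le (ξ x), hb x hx]) ((le_abs_self _).trans (hb x hx))
            have h6 : 0 ≤ ξ x ^ 2 * R x := mul_nonneg (sq_nonneg _) (h.dens.nonneg x)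
            have := mul_le_mul_of_nonneg_right h5 h6
            simp only
            calc ξ x ^ 4 * R x = ξ x ^ 2 * (ξ x ^ 2 * R x) := by ring
              _ ≤ _ := this
      _ = b ^ 2 * ∫ x, ξ x ^ 2 * R x ∂lam := integral_const_mul _ _
      _ ≤ _ := by gcongr
  have sm := sum_moment (P := PN R N) (Y := fun (i : Fin N) x => ξ (x i)) (b := b) (A := A) (D := b ^ 2 * A)
    (fun i => hξ.comp (measurable_pi_apply i))
    (ProbabilityTheory.iIndepFun_pi (μ := fun _ : Fin N => muR R) (X := fun _ => ξ) fun i => hξ.aemeasurable)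
    (fun i => (PN_ae h N).mono fun x hx => hb _ (hx i))
    (fun i => (ev i ξ hξ).trans h1)
    (fun i => (ev i (fun t => ξ t ^ 2) (hξ.pow_const 2)).trans_le h2)
    (fun i => (ev i (fun t => ξ t ^ 4) (hξ.pow_const 4)).trans_le h4) Finset.univ
  simp only [Finset.card_univ, Fintype.card_fin] at sm
  obtain ⟨-, s1, s2, s4⟩ := sm
  refine ⟨?_, ?_, ?_⟩
  · rw [integral_const_mul, s1, mul_zero]
  · simp only [mul_pow]
    rw [integral_const_mul]
    calc _ ≤ ((N : ℝ)⁻¹) ^ 2 * (N * A) := by gcongr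
      _ = A / N := by field_simp
  · simp only [mul_pow]
    rw [integral_const_mul]
    calc _ ≤ ((N : ℝ)⁻¹) ^ 4 * (3 * N ^ 2 * A ^ 2 + N * (b ^ 2 * A)) := by gcongr
      _ = _ := by field_simp
end

/-- second moment of the field -/
def Sf (m : ℕ) (δ : ℝ) (R : E2 → ℝ) (z : E2) : ℝ := ∫ x, ‖V m δ x z‖ ^ 2 * R x ∂lam

section
variable {R : E2 → ℝ} {a B : ℝ} {k : ℝ≥0} {m : ℕ} {δ M : ℝ}

theorem E2_norm_sq (v : E2) : ‖v‖ ^ 2 = v 0 ^ 2 + v 1 ^ 2 := by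
  rw [EuclideanSpace.norm_sq_eq, Fin.sum_univ_two]; simp

theorem E2_coord (v : E2) (j : Fin 2) : |v j| ≤ ‖v‖ := by
  have := PiLp.norm_apply_le v j
  simpa using this

theorem Vj_int (h : Den R a B k) (hM : ∀ x ∈ Qs, ∀ z, ‖V m δ x z‖ ≤ M) (z : E2) (j : Fin 2) (n : ℕ) :
    Integrable (fun x => V m δ x z j ^ n * R x) lam := by
  have hm1 : Measurable fun x => V m δ x z j :=
    (by fun_prop : Measurable fun v : E2 => v j).comp (V_measurable_left m δ z)
  refine integrable_lam_of_bdd (B := M ^ n * B) ((hm1.pow_const n).mul h.dens.meas).aestronglyMeasurable fun x hx => ?_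
  rw [norm_mul, norm_pow, Real.norm_of_nonneg (h.dens.nonneg x), Real.norm_eq_abs]
  have h1 := (E2_coord (V m δ x z) j).trans (hM x hx z)
  have := h.ub x
  have := h.dens.nonneg x
  have := (abs_nonneg _).trans h1
  gcongr

theorem Vb_coord (h : Den R a B k) (hM : ∀ x ∈ Qs, ∀ z, ‖V m δ x z‖ ≤ M) (z : E2) (j : Fin 2) :
    Vb m δ R z j = ∫ x, V m δ x z j * R x ∂lam := by
  have := (EuclideanSpace.proj (𝕜 := ℝ) j : E2 →L[ℝ] ℝ).integral_comp_comm (RV_int h hM z)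
  unfold Vb
  refine Eq.trans this.symm ?_
  congr 1; ext x
  simp [mul_comm]

theorem center_sq {f : E2 → ℝ} (h : Den R a B k) (h1 : Integrable (fun x => f x * R x) lam)
    (h2 : Integrable (fun x => f x ^ 2 * R x) lam) {c : ℝ} (hc : c = ∫ x, f x * R x ∂lam) :
    ∫ x, (f x - c) * R x ∂lam = 0 ∧ ∫ x, (f x - c) ^ 2 * R x ∂lam ≤ ∫ x, f x ^ 2 * R x ∂lam := by
  constructor
  · simp only [sub_mul]
    rw [integral_sub h1 (h.dens.integrable.const_mul c), integral_const_mul, h.mass, ← hc]; ring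
  · have : ∀ x, (f x - c) ^ 2 * R x = f x ^ 2 * R x - (2 * c * (f x * R x) - c ^ 2 * R x) := fun x => by ring
    simp only [this]
    have i1 : Integrable (fun x => 2 * c * (f x * R x) - c ^ 2 * R x) lam :=
      (h1.const_mul _).sub (h.dens.integrable.const_mul _)
    rw [integral_sub h2 i1, integral_sub (h1.const_mul _) (h.dens.integrable.const_mul _), integral_const_mul,
      integral_const_mul, h.mass, ← hc]
    nlinarith [sq_nonneg c]

/-- coordinate second moments -/
def Aj (m : ℕ) (δ : ℝ) (R : E2 → ℝ) (z : E2) (j : Fin 2) : ℝ := ∫ x, V m δ x z j ^ 2 * R x ∂lam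

theorem Aj_nonneg (h : Den R a B k) (z : E2) (j : Fin 2) : 0 ≤ Aj m δ R z j :=
  integral_nonneg fun x => mul_nonneg (sq_nonneg _) (h.dens.nonneg x)

theorem Sf_eq (h : Den R a B k) (hM : ∀ x ∈ Qs, ∀ z, ‖V m δ x z‖ ≤ M) (z : E2) :
    Sf m δ R z = Aj m δ R z 0 + Aj m δ R z 1 := by
  unfold Sf Aj
  rw [← integral_add (Vj_int h hM z 0 2) (Vj_int h hM z 1 2)]
  congr 1; ext x
  rw [E2_norm_sq]; ring

theorem Sf_nonneg (h : Den R a B k) (z : E2) : 0 ≤ Sf m δ R z :=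
  integral_nonneg fun x => mul_nonneg (sq_nonneg _) (h.dens.nonneg x)

theorem ZN_coord {N : ℕ} (x : Fin N → E2) (z : E2) (j : Fin 2) :
    ZN m δ R x z j = (N : ℝ)⁻¹ * ∑ i, (V m δ (x i) z j - Vb m δ R z j) := by
  unfold ZN Zf
  simp

theorem ZNj_moment (h : Den R a B k) (hM : ∀ x ∈ Qs, ∀ z, ‖V m δ x z‖ ≤ M) {N : ℕ} (hN : 0 < N) (z : E2) (j : Fin 2) :
    ∫ x, ZN m δ R x z j ∂(PN R N) = 0 ∧ ∫ x, ZN m δ R x z j ^ 2 ∂(PN R N) ≤ Aj m δ R z j / N ∧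
    ∫ x, ZN m δ R x z j ^ 4 ∂(PN R N) ≤ 3 * Aj m δ R z j ^ 2 / N ^ 2 + (2 * M) ^ 2 * Aj m δ R z j / N ^ 3 := by
  have hm1 : Measurable fun x => V m δ x z j :=
    (by fun_prop : Measurable fun v : E2 => v j).comp (V_measurable_left m δ z)
  have i1 := Vj_int h hM z j 1
  simp only [pow_one] at i1
  have cs := center_sq h i1 (Vj_int h hM z j 2) (Vb_coord h hM z j)
  have := PN_moment h hN (ξ := fun x => V m δ x z j - Vb m δ R z j) (hm1.sub_const _) (b := 2 * M) (fun x hx => by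
    have h1 := E2_coord (Zf m δ R x z) j
    have h2 := Zf_bound h hM hx z
    have h3 : Zf m δ R x z j = V m δ x z j - Vb m δ R z j := by simp [Zf]
    rw [h3] at h1
    exact h1.trans h2) cs.1 (A := Aj m δ R z j) cs.2
  simp only [ZN_coord]
  exact this

theorem ZNz_measurable {N : ℕ} (z : E2) : Measurable (fun x : Fin N → E2 => ZN m δ R x z) := by
  have h0 : Measurable fun x => Zf m δ R x z := (V_measurable_left m δ z).sub_const _
  have h1 : Measurable fun x : Fin N → E2 => ∑ i, Zf m δ R (x i) z :=
    Finset.measurable_sum _ fun i _ => h0.comp (measurable_pi_apply i)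
  exact h1.const_smul ((N : ℝ)⁻¹)

theorem ZNj_measurable {N : ℕ} (z : E2) (j : Fin 2) :
    Measurable (fun x : Fin N → E2 => ZN m δ R x z j) :=
  (by fun_prop : Measurable fun v : E2 => v j).comp (ZNz_measurable z)

theorem ZNj_bdd (h : Den R a B k) (hM : ∀ x ∈ Qs, ∀ z, ‖V m δ x z‖ ≤ M) {N : ℕ} (hN : 0 < N) (z : E2) (j : Fin 2) :
    ∀ᵐ x ∂(PN R N), |ZN m δ R x z j| ≤ 2 * M :=
  (PN_ae h N).mono fun x hx => (E2_coord _ j).trans (ZN_bound h hM hN hx z)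

theorem ZN_four (h : Den R a B k) (hM : ∀ x ∈ Qs, ∀ z, ‖V m δ x z‖ ≤ M) {N : ℕ} (hN : 0 < N) (z : E2) :
    Integrable (fun x => ‖ZN m δ R x z‖ ^ 4) (PN R N) ∧
    ∫ x, ‖ZN m δ R x z‖ ^ 4 ∂(PN R N) ≤ 4 * (3 * Sf m δ R z ^ 2 / N ^ 2 + 4 * M ^ 2 * Sf m δ R z / N ^ 3) := by
  have hpN := PN_prob h N
  have hN' : (0 : ℝ) < N := by exact_mod_cast hN
  have m0 := ZNj_moment h hM hN z 0
  have m1 := ZNj_moment h hM hN z 1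
  have i0 := int_pow_bdd (ZNj_measurable z 0) (ZNj_bdd h hM hN z 0) 4
  have i1 := int_pow_bdd (ZNj_measurable z 1) (ZNj_bdd h hM hN z 1) 4
  have hi : Integrable (fun x => 2 * (ZN m δ R x z 0 ^ 4 + ZN m δ R x z 1 ^ 4)) (PN R N) := (i0.add i1).const_mul 2
  have hle : ∀ x : Fin N → E2, ‖ZN m δ R x z‖ ^ 4 ≤ 2 * (ZN m δ R x z 0 ^ 4 + ZN m δ R x z 1 ^ 4) := by
    intro x
    have : ‖ZN m δ R x z‖ ^ 4 = (‖ZN m δ R x z‖ ^ 2) ^ 2 := by ring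
    rw [this, E2_norm_sq]
    nlinarith [sq_nonneg (ZN m δ R x z 0 ^ 2 - ZN m δ R x z 1 ^ 2)]
  have hI : Integrable (fun x => ‖ZN m δ R x z‖ ^ 4) (PN R N) :=
    hi.mono' ((ZNz_measurable z).norm.pow_const 4).aestronglyMeasurable (Eventually.of_forall fun x => by
      rw [Real.norm_of_nonneg (by positivity)]; exact hle x)
  refine ⟨hI, (integral_mono hI hi hle).trans ?_⟩
  rw [integral_const_mul, integral_add i0 i1, Sf_eq h hM]
  have a0 := Aj_nonneg (m := m) (δ := δ) h z 0
  have a1 := Aj_nonneg (m := m) (δ := δ) h z 1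
  have k1 : ∀ A A' : ℝ, 0 ≤ A → 0 ≤ A' → 3 * A ^ 2 / N ^ 2 + (2 * M) ^ 2 * A / N ^ 3 ≤
      3 * (A + A') ^ 2 / N ^ 2 + 4 * M ^ 2 * (A + A') / N ^ 3 := by
    intro A A' hA hA'
    have : (2 * M) ^ 2 = 4 * M ^ 2 := by ring
    rw [this]
    gcongr <;> linarith
  have k2 := k1 _ _ a0 a1
  have k3 := k1 _ _ a1 a0
  rw [add_comm (Aj m δ R z 1)] at k3
  linarith [m0.2.2, m1.2.2]

theorem ZN_two (h : Den R a B k) (hM : ∀ x ∈ Qs, ∀ z, ‖V m δ x z‖ ≤ M) {N : ℕ} (hN : 0 < N) (z : E2) :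
    ∫ x, ‖ZN m δ R x z‖ ^ 2 ∂(PN R N) ≤ Sf m δ R z / N := by
  have hpN := PN_prob h N
  have m0 := ZNj_moment h hM hN z 0
  have m1 := ZNj_moment h hM hN z 1
  have i0 := int_pow_bdd (ZNj_measurable z 0) (ZNj_bdd h hM hN z 0) 2
  have i1 := int_pow_bdd (ZNj_measurable z 1) (ZNj_bdd h hM hN z 1) 2
  simp only [E2_norm_sq]
  rw [integral_add i0 i1, Sf_eq h hM, add_div]
  linarith [m0.2.1, m1.2.1]

/-- joint law of both samples -/
def PP (R : E2 → ℝ) (N : ℕ) : Measure ((Fin N → E2) × (Fin N → E2)) := (PN R N).prod (PN R N)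

theorem PP_prob (h : Den R a B k) (N : ℕ) : IsProbabilityMeasure (PP R N) := by
  have := PN_prob h N
  unfold PP; infer_instance

theorem PP_ae (h : Den R a B k) (N : ℕ) : ∀ᵐ p ∂(PP R N), (∀ i, p.1 i ∈ Qs) ∧ ∀ i, p.2 i ∈ Qs := by
  have := PN_prob h N
  exact (Measure.quasiMeasurePreserving_fst.ae (PN_ae h N)).and (Measure.quasiMeasurePreserving_snd.ae (PN_ae h N))

theorem PP_fst (h : Den R a B k) {N : ℕ} (f : (Fin N → E2) → ℝ) : ∫ p, f p.1 ∂(PP R N) = ∫ x, f x ∂(PN R N) := by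
  have := PN_prob h N
  unfold PP
  rw [integral_fun_fst]; simp

theorem PP_snd (h : Den R a B k) {N : ℕ} (f : (Fin N → E2) → ℝ) : ∫ p, f p.2 ∂(PP R N) = ∫ x, f x ∂(PN R N) := by
  have := PN_prob h N
  unfold PP
  rw [integral_fun_snd]; simp

theorem PP_fst_int (h : Den R a B k) {N : ℕ} {f : (Fin N → E2) → ℝ} (hf : Integrable f (PN R N)) :
    Integrable (fun p => f p.1) (PP R N) := by
  have := PN_prob h N
  exact hf.comp_fst _

theorem PP_snd_int (h : Den R a B k) {N : ℕ} {f : (Fin N → E2) → ℝ} (hf : Integrable f (PN R N)) :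
    Integrable (fun p => f p.2) (PP R N) := by
  have := PN_prob h N
  exact hf.comp_snd _

theorem ZD_two (h : Den R a B k) (hM : ∀ x ∈ Qs, ∀ z, ‖V m δ x z‖ ≤ M) {N : ℕ} (hN : 0 < N) (z : E2) :
    Integrable (fun p => ‖ZN m δ R p.1 z - ZN m δ R p.2 z‖ ^ 2) (PP R N) ∧
    ∫ p, ‖ZN m δ R p.1 z - ZN m δ R p.2 z‖ ^ 2 ∂(PP R N) ≤ 2 * Sf m δ R z / N := by
  have hpN := PN_prob h N
  have hpp := PP_prob h N
  have key : ∀ j : Fin 2, Integrable (fun p => (ZN m δ R p.1 z j - ZN m δ R p.2 z j) ^ 2) (PP R N) ∧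
      ∫ p, (ZN m δ R p.1 z j - ZN m δ R p.2 z j) ^ 2 ∂(PP R N) ≤ 2 * Aj m δ R z j / N := by
    intro j
    have mj := ZNj_moment h hM hN z j
    have me := ZNj_measurable (m := m) (δ := δ) (R := R) (N := N) z j
    have bd := ZNj_bdd h hM hN z j
    have b1 : ∀ᵐ p ∂(PP R N), |ZN m δ R p.1 z j| ≤ 2 * M := Measure.quasiMeasurePreserving_fst.ae bd
    have b2 : ∀ᵐ p ∂(PP R N), |-ZN m δ R p.2 z j| ≤ 2 * M := by
      simp only [abs_neg]
      exact Measure.quasiMeasurePreserving_snd.ae bd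
    have ind : ProbabilityTheory.IndepFun (fun p : (Fin N → E2) × (Fin N → E2) => ZN m δ R p.1 z j)
        (fun p => -ZN m δ R p.2 z j) (PP R N) :=
      ProbabilityTheory.indepFun_prod (X := fun x => ZN m δ R x z j) (Y := fun x => -ZN m δ R x z j) me me.neg
    have pm := (pair_moment (me.comp measurable_fst) (me.comp measurable_snd).neg b1 b2 ind
      ((PP_fst h _).trans mj.1) ((PP_snd h (fun x => -ZN m δ R x z j)).trans (by rw [integral_neg, mj.1, neg_zero]))).1
    refine ⟨?_, ?_⟩
    · refine int_pow_bdd (b := 2 * M + 2 * M) ((me.comp measurable_fst).sub (me.comp measurable_snd)) ?_ 2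
      filter_upwards [b1, b2] with p h1 h2
      rw [abs_neg] at h2
      exact (abs_sub _ _).trans (add_le_add h1 h2)
    · have e1 := PP_fst h (N := N) fun x => ZN m δ R x z j ^ 2
      have e2 := PP_snd h (N := N) fun x => ZN m δ R x z j ^ 2
      have : 2 * Aj m δ R z j / N = Aj m δ R z j / N + Aj m δ R z j / N := by ring
      rw [this]
      refine le_trans (le_of_eq pm) ?_
      refine add_le_add (e1.trans_le mj.2.1) (le_trans (le_of_eq ?_) (e2.trans_le mj.2.1))
      congr 1; ext p; simp
  obtain ⟨i0, k0⟩ := key 0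
  obtain ⟨i1, k1⟩ := key 1
  have e : ∀ p : (Fin N → E2) × (Fin N → E2), ‖ZN m δ R p.1 z - ZN m δ R p.2 z‖ ^ 2 =
      (ZN m δ R p.1 z 0 - ZN m δ R p.2 z 0) ^ 2 + (ZN m δ R p.1 z 1 - ZN m δ R p.2 z 1) ^ 2 := by
    intro p; rw [E2_norm_sq]; simp
  simp only [e]
  refine ⟨i0.add i1, ?_⟩
  rw [integral_add i0 i1, Sf_eq h hM]
  have : 2 * (Aj m δ R z 0 + Aj m δ R z 1) / N = 2 * Aj m δ R z 0 / N + 2 * Aj m δ R z 1 / N := by ring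
  linarith

theorem hist_two (h : Den R a B k) (hm : 0 < m) {N : ℕ} (hN : 0 < N) {z : E2} (hz : z ∈ Qs) :
    Integrable (fun x => (hist m x z / rb m R z - 1) ^ 2) (PN R N) ∧
    ∫ x, (hist m x z / rb m R z - 1) ^ 2 ∂(PN R N) ≤ m ^ 2 / a / N := by
  have hpN := PN_prob h N
  have hN' : (0 : ℝ) < N := by exact_mod_cast hN
  have ha := h.apos
  have hr := rb_lb hm h hz
  have hr0 : 0 < rb m R z := ha.trans_le hr
  have hw : Measurable fun x => w0 m x z := (w0_measurable m).comp (by fun_prop : Measurable fun x : E2 => (x, z))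
  have e : ∀ x : Fin N → E2, hist m x z / rb m R z - 1 = (N : ℝ)⁻¹ * ∑ i, (w0 m (x i) z / rb m R z - 1) := by
    intro x
    unfold hist
    rw [Finset.sum_sub_distrib, ← Finset.sum_div]
    simp
    field_simp
  have i1 : Integrable (fun x => w0 m x z / rb m R z * R x) lam := by
    have := (rb_integrable (m := m) h z).div_const (rb m R z)
    refine this.congr (Eventually.of_forall fun x => ?_)
    simp only; ring
  have e1 : (1 : ℝ) = ∫ x, w0 m x z / rb m R z * R x ∂lam := by
    have : ∀ x, w0 m x z / rb m R z * R x = (w0 m x z * R x) / rb m R z := fun x => by ring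
    simp only [this]
    rw [integral_div]
    exact (div_self hr0.ne').symm
  have hle : ∀ x, (w0 m x z / rb m R z) ^ 2 * R x ≤ m ^ 2 / a * (w0 m x z / rb m R z * R x) := by
    intro x
    have h1 : w0 m x z / rb m R z ≤ m ^ 2 / a := div_le_div₀ (by positivity) (w0_le m x z) ha hr
    have h2 : 0 ≤ w0 m x z / rb m R z * R x :=
      mul_nonneg (div_nonneg (w0_nonneg _ _ _) hr0.le) (h.dens.nonneg x)
    calc _ = w0 m x z / rb m R z * (w0 m x z / rb m R z * R x) := by ring
      _ ≤ _ := mul_le_mul_of_nonneg_right h1 h2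
  have i2 : Integrable (fun x => (w0 m x z / rb m R z) ^ 2 * R x) lam := by
    refine (i1.const_mul (m ^ 2 / a)).mono' (((hw.div_const _).pow_const 2).mul h.dens.meas).aestronglyMeasurable
      (Eventually.of_forall fun x => ?_)
    rw [Real.norm_of_nonneg (mul_nonneg (sq_nonneg _) (h.dens.nonneg x))]
    exact hle x
  have cs := center_sq h i1 i2 e1
  have hA : ∫ x, (w0 m x z / rb m R z) ^ 2 * R x ∂lam ≤ m ^ 2 / a := by
    refine (integral_mono i2 (i1.const_mul (m ^ 2 / a)) hle).trans ?_
    rw [integral_const_mul, ← e1, mul_one]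
  have hb : ∀ x, |w0 m x z / rb m R z - 1| ≤ m ^ 2 / a + 1 := by
    intro x
    have h1 : w0 m x z / rb m R z ≤ m ^ 2 / a := div_le_div₀ (by positivity) (w0_le m x z) ha hr
    have h2 : 0 ≤ w0 m x z / rb m R z := div_nonneg (w0_nonneg _ _ _) hr0.le
    rw [abs_le]
    have : 0 ≤ (m : ℝ) ^ 2 / a := by positivity
    constructor <;> linarith
  have pm := PN_moment h hN (ξ := fun x => w0 m x z / rb m R z - 1) ((hw.div_const _).sub_const _)
    (fun x _ => hb x) cs.1 (cs.2.trans hA)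
  simp only [e]
  refine ⟨?_, pm.2.1⟩
  have hms : Measurable (fun x : Fin N → E2 => (N : ℝ)⁻¹ * ∑ i, (w0 m (x i) z / rb m R z - 1)) :=
    (Finset.measurable_sum _ fun i _ => ((hw.div_const _).sub_const _).comp (measurable_pi_apply i)).const_mul _
  refine int_pow_bdd (b := (N : ℝ)⁻¹ * ∑ i : Fin N, (m ^ 2 / a + 1)) hms (Eventually.of_forall fun x => ?_) 2
  rw [abs_mul, abs_of_nonneg (by positivity : 0 ≤ (N : ℝ)⁻¹)]
  gcongr
  exact (Finset.abs_sum_le_sum_abs _ _).trans (Finset.sum_le_sum fun i _ => hb _)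
end

section
variable {R : E2 → ℝ} {a B : ℝ} {k : ℝ≥0} {m : ℕ} {δ M : ℝ}

theorem fub (h : Den R a B k) {N : ℕ} {f : ((Fin N → E2) × (Fin N → E2)) → E2 → ℝ}
    (hf : Measurable (Function.uncurry f)) {K : ℝ}
    (hK : ∀ p : (Fin N → E2) × (Fin N → E2), (∀ i, p.1 i ∈ Qs) → (∀ i, p.2 i ∈ Qs) → ∀ z ∈ Qs, |f p z| ≤ K)
    {g : E2 → ℝ} (hg : Integrable g lam) (hfg : ∀ z ∈ Qs, ∫ p, f p z ∂(PP R N) ≤ g z) :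
    Integrable (fun p => ∫ z, f p z ∂lam) (PP R N) ∧ ∫ p, ∫ z, f p z ∂lam ∂(PP R N) ≤ ∫ z, g z ∂lam := by
  have hpp := PP_prob h N
  have hI : Integrable (Function.uncurry f) ((PP R N).prod lam) := by
    refine Integrable.of_bound hf.aestronglyMeasurable K ?_
    have b1 : ∀ᵐ q ∂((PP R N).prod lam), (∀ i, q.1.1 i ∈ Qs) ∧ ∀ i, q.1.2 i ∈ Qs :=
      Measure.quasiMeasurePreserving_fst.ae (PP_ae h N)
    have b2 : ∀ᵐ q ∂((PP R N).prod lam), q.2 ∈ Qs := Measure.quasiMeasurePreserving_snd.ae ae_lam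
    filter_upwards [b1, b2] with q h1 h2
    exact hK q.1 h1.1 h1.2 q.2 h2
  refine ⟨hI.integral_prod_left, ?_⟩
  rw [integral_integral_swap hI]
  exact integral_mono_ae hI.integral_prod_right hg (ae_lam.mono hfg)

theorem Sf_measurable (h : Den R a B k) : Measurable (Sf m δ R) := by
  have h1 : Measurable (fun y : E2 × E2 => ‖V m δ y.2 y.1‖ ^ 2 * R y.2) :=
    (((V_measurable m δ).comp measurable_swap).norm.pow_const 2).mul (h.dens.meas.comp measurable_snd)
  exact (h1.stronglyMeasurable.integral_prod_right' (ν := lam)).measurable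

theorem Sfr_int (h : Den R a B k) (hm : 0 < m) {Sb : ℝ} (hS : ∀ z ∈ Qs, Sf m δ R z ≤ Sb) :
    Integrable (fun z => Sf m δ R z / rb m R z) lam := by
  refine integrable_lam_of_bdd (B := Sb / a) ((Sf_measurable h).div (rb_meas m h)).aestronglyMeasurable fun z hz => ?_
  have hr := rb_lb hm h hz
  have := h.apos
  have h0 := Sf_nonneg (m := m) (δ := δ) h z
  rw [Real.norm_of_nonneg (div_nonneg h0 (this.le.trans hr))]
  exact div_le_div₀ (h0.trans (hS z hz)) (hS z hz) this hr

theorem ZNp1 (h : Den R a B k) {N : ℕ} :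
    Measurable (fun q : ((Fin N → E2) × (Fin N → E2)) × E2 => ZN m δ R q.1.1 q.2) := by
  have h2 : Measurable (fun q : ((Fin N → E2) × (Fin N → E2)) × E2 => (q.1.1, q.2)) := by fun_prop
  have h1 : Measurable (fun y : (Fin N → E2) × E2 => ZN m δ R y.1 y.2) := ZN_measurable m δ h.dens.meas
  have h3 := h1.comp h2
  exact h3

theorem ZNp2 (h : Den R a B k) {N : ℕ} :
    Measurable (fun q : ((Fin N → E2) × (Fin N → E2)) × E2 => ZN m δ R q.1.2 q.2) := by
  have h2 : Measurable (fun q : ((Fin N → E2) × (Fin N → E2)) × E2 => (q.1.2, q.2)) := by fun_prop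
  have h1 : Measurable (fun y : (Fin N → E2) × E2 => ZN m δ R y.1 y.2) := ZN_measurable m δ h.dens.meas
  have h3 := h1.comp h2
  exact h3

theorem hist_meas {N : ℕ} : Measurable (fun y : (Fin N → E2) × E2 => hist m y.1 y.2) := by
  unfold hist
  refine (Finset.measurable_sum _ fun i _ => ?_).const_mul _
  exact (w0_measurable m).comp (by fun_prop : Measurable fun y : (Fin N → E2) × E2 => (y.1 i, y.2))

theorem hist_le {N : ℕ} (hN : 0 < N) (x : Fin N → E2) (z : E2) : 0 ≤ hist m x z ∧ hist m x z ≤ (m : ℝ) ^ 2 := by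
  have hN' : (0 : ℝ) < N := by exact_mod_cast hN
  unfold hist
  constructor
  · exact mul_nonneg (by positivity) (Finset.sum_nonneg fun i _ => w0_nonneg _ _ _)
  · have : ∑ i, w0 m (x i) z ≤ ∑ _i : Fin N, (m : ℝ) ^ 2 := Finset.sum_le_sum fun i _ => w0_le _ _ _
    simp at this
    rw [inv_mul_le_iff₀ hN']
    exact this

theorem hist_u {N : ℕ} (h : Den R a B k) (hm : 0 < m) (hN : 0 < N) (x : Fin N → E2) {z : E2} (hz : z ∈ Qs) :
    |hist m x z / rb m R z - 1| ≤ (m : ℝ) ^ 2 / a + 1 := by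
  have hr := rb_lb hm h hz
  have ha := h.apos
  obtain ⟨h1, h2⟩ := hist_le (m := m) hN x z
  have h3 : hist m x z / rb m R z ≤ (m : ℝ) ^ 2 / a := div_le_div₀ (by positivity) h2 ha hr
  have h4 : 0 ≤ hist m x z / rb m R z := div_nonneg h1 (ha.le.trans hr)
  have : 0 ≤ (m : ℝ) ^ 2 / a := by positivity
  rw [abs_le]; constructor <;> linarith

theorem HC_pt {r D u v X Y η s a : ℝ} (ha : 0 < a) (hr : a ≤ r) (hη : 0 < η) (hs : 0 < s) (hX : 0 ≤ X) (hY : 0 ≤ Y)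
    (hD0 : 0 ≤ D) (hD : D ≤ X + Y) :
    D ^ 2 / r * (1 + 1 / η * (|u| + |v|)) ≤
      D ^ 2 / r + 1 / (η * a) * (8 * s * (X ^ 4 + Y ^ 4) + (u ^ 2 + v ^ 2) / (2 * s)) := by
  have hr0 : 0 < r := ha.trans_le hr
  have h1 : D ^ 2 * (|u| + |v|) ≤ s * D ^ 4 + (u ^ 2 + v ^ 2) / (2 * s) := by
    have e1 : s * D ^ 4 + (u ^ 2 + v ^ 2) / (2 * s) - D ^ 2 * (|u| + |v|) =
      ((2 * s * D ^ 2 - (|u| + |v|)) ^ 2 + (|u| - |v|) ^ 2) / (4 * s) := by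
      rw [← sq_abs u, ← sq_abs v]
      field_simp; ring
    have : 0 ≤ ((2 * s * D ^ 2 - (|u| + |v|)) ^ 2 + (|u| - |v|) ^ 2) / (4 * s) := by positivity
    linarith
  have h2 : D ^ 4 ≤ 8 * (X ^ 4 + Y ^ 4) := by
    have e1 : D ^ 2 ≤ 2 * (X ^ 2 + Y ^ 2) := by nlinarith [sq_nonneg (X - Y)]
    have e2 : D ^ 4 = (D ^ 2) ^ 2 := by ring
    have e3 : (D ^ 2) ^ 2 ≤ (2 * (X ^ 2 + Y ^ 2)) ^ 2 := by gcongr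
    nlinarith [sq_nonneg (X ^ 2 - Y ^ 2)]
  have h3 : D ^ 2 / r * (1 / η * (|u| + |v|)) ≤ 1 / (η * a) * (D ^ 2 * (|u| + |v|)) := by
    have : D ^ 2 / r ≤ D ^ 2 / a := by gcongr
    calc _ ≤ D ^ 2 / a * (1 / η * (|u| + |v|)) := by gcongr
      _ = _ := by field_simp
  have h4 : s * D ^ 4 ≤ 8 * s * (X ^ 4 + Y ^ 4) := by nlinarith
  have h5 : 1 / (η * a) * (D ^ 2 * (|u| + |v|)) ≤ 1 / (η * a) * (8 * s * (X ^ 4 + Y ^ 4) + (u ^ 2 + v ^ 2) / (2 * s)) := by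
    gcongr; linarith
  linarith

theorem HC_exp (h : Den R a B k) (hm : 0 < m) (hM : ∀ x ∈ Qs, ∀ z, ‖V m δ x z‖ ≤ M) {N : ℕ} (hN : 0 < N) {η s Sb : ℝ}
    (hη : 0 < η) (hs : 0 < s) (hS : ∀ z ∈ Qs, Sf m δ R z ≤ Sb) {z : E2} (hz : z ∈ Qs) :
    ∫ p, HC η (hist m p.1) (hist m p.2) (rb m R) (fun z => ZN m δ R p.1 z - ZN m δ R p.2 z) z ∂(PP R N) ≤
      2 / N * (Sf m δ R z / rb m R z) +
        1 / (η * a) * (64 * s * (3 * Sb ^ 2 / N ^ 2 + 4 * M ^ 2 * Sb / N ^ 3) + m ^ 2 / (a * N * s)) := by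
  have hpp := PP_prob h N
  have hN' : (0 : ℝ) < N := by exact_mod_cast hN
  have ha := h.apos
  have hr := rb_lb hm h hz
  have hr0 : 0 < rb m R z := ha.trans_le hr
  obtain ⟨d1, d2⟩ := ZD_two h hM hN z
  obtain ⟨f1, f2⟩ := ZN_four h hM hN z
  obtain ⟨u1, u2⟩ := hist_two h hm hN hz
  have fx := PP_fst_int h f1
  have fy := PP_snd_int h f1
  have ux := PP_fst_int h u1
  have uy := PP_snd_int h u1
  have efx := PP_fst h (N := N) fun x => ‖ZN m δ R x z‖ ^ 4
  have efy := PP_snd h (N := N) fun x => ‖ZN m δ R x z‖ ^ 4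
  have eux := PP_fst h (N := N) fun x => (hist m x z / rb m R z - 1) ^ 2
  have euy := PP_snd h (N := N) fun x => (hist m x z / rb m R z - 1) ^ 2
  set T1 : ((Fin N → E2) × (Fin N → E2)) → ℝ := fun p => ‖ZN m δ R p.1 z - ZN m δ R p.2 z‖ ^ 2 / rb m R z with hT1
  set T2 : ((Fin N → E2) × (Fin N → E2)) → ℝ := fun p => 8 * s * (‖ZN m δ R p.1 z‖ ^ 4 + ‖ZN m δ R p.2 z‖ ^ 4) with hT2
  set T3 : ((Fin N → E2) × (Fin N → E2)) → ℝ := fun p =>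
    ((hist m p.1 z / rb m R z - 1) ^ 2 + (hist m p.2 z / rb m R z - 1) ^ 2) / (2 * s) with hT3
  have i1 : Integrable T1 (PP R N) := d1.div_const _
  have i2 : Integrable T2 (PP R N) := (fx.add fy).const_mul (8 * s)
  have i3 : Integrable T3 (PP R N) := (ux.add uy).div_const (2 * s)
  have i23 : Integrable (fun p => T2 p + T3 p) (PP R N) := i2.add i3
  have i23' : Integrable (fun p => 1 / (η * a) * (T2 p + T3 p)) (PP R N) := i23.const_mul _
  have iall : Integrable (fun p => T1 p + 1 / (η * a) * (T2 p + T3 p)) (PP R N) := i1.add i23'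
  have hle : ∀ p : (Fin N → E2) × (Fin N → E2),
      HC η (hist m p.1) (hist m p.2) (rb m R) (fun z => ZN m δ R p.1 z - ZN m δ R p.2 z) z ≤
      T1 p + 1 / (η * a) * (T2 p + T3 p) := fun p =>
    HC_pt ha hr hη hs (norm_nonneg _) (norm_nonneg _) (norm_nonneg _) (norm_sub_le _ _)
  have hnn : ∀ p : (Fin N → E2) × (Fin N → E2),
      0 ≤ HC η (hist m p.1) (hist m p.2) (rb m R) (fun z => ZN m δ R p.1 z - ZN m δ R p.2 z) z := fun p => by
    unfold HC; positivity
  refine (integral_mono_of_nonneg (Eventually.of_forall hnn) iall (Eventually.of_forall hle)).trans ?_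
  have S0 := Sf_nonneg (m := m) (δ := δ) h z
  have S1 := hS z hz
  have e1 : ∫ p, T1 p ∂(PP R N) ≤ 2 / N * (Sf m δ R z / rb m R z) := by
    rw [hT1, integral_div]
    calc _ ≤ (2 * Sf m δ R z / N) / rb m R z := by gcongr
      _ = _ := by ring
  have e2 : ∫ p, T2 p ∂(PP R N) ≤ 64 * s * (3 * Sb ^ 2 / N ^ 2 + 4 * M ^ 2 * Sb / N ^ 3) := by
    rw [hT2, integral_const_mul, integral_add fx fy, efx, efy]
    have : 3 * Sf m δ R z ^ 2 / N ^ 2 + 4 * M ^ 2 * Sf m δ R z / N ^ 3 ≤ 3 * Sb ^ 2 / N ^ 2 + 4 * M ^ 2 * Sb / N ^ 3 := by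
      gcongr
    have q : ∀ A : ℝ, 8 * s * (4 * A + 4 * A) = 64 * s * A := fun A => by ring
    rw [← q]
    have := f2.trans (mul_le_mul_of_nonneg_left this (by norm_num : (0 : ℝ) ≤ 4))
    gcongr
  have e3 : ∫ p, T3 p ∂(PP R N) ≤ m ^ 2 / (a * N * s) := by
    rw [hT3, integral_div, integral_add ux uy, eux, euy]
    calc _ ≤ (m ^ 2 / a / N + m ^ 2 / a / N) / (2 * s) := by gcongr
      _ = _ := by field_simp; norm_num
  rw [integral_add i1 i23', integral_const_mul, integral_add i2 i3]
  gcongr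

theorem W2sq_nonneg (ν₁ ν₂ : Measure E2) : 0 ≤ W2sq ν₁ ν₂ := by
  unfold W2sq
  refine Real.sInf_nonneg ?_
  rintro c ⟨J, _, _, _, rfl⟩
  exact integral_nonneg fun p => by positivity

theorem exp_bound (h : Den R a B k) (hm : 0 < m) (hδ : 0 < δ) (hM : ∀ x ∈ Qs, ∀ z, ‖V m δ x z‖ ≤ M) {N : ℕ} (hN : 0 < N)
    {η τ s Sb : ℝ} (hη : 0 < η) (hη1 : η ≤ 1) (hτ : 0 < τ) (hτ1 : 4 * τ < 1) (hs : 0 < s)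
    (hS : ∀ z ∈ Qs, Sf m δ R z ≤ Sb) {Sg : ℝ} (hSg : ∫ z, Sf m δ R z / rb m R z ∂lam ≤ Sg) :
    ∫ p, W2sq (empMeas p.1) (empMeas p.2) ∂(PP R N) ≤ 8 / (τ * m ^ 2) + 8 * η / τ * (Sg / N) +
      (1 / (1 - 4 * τ)) * (2 / N * Sg +
        1 / (η * a) * (64 * s * (3 * Sb ^ 2 / N ^ 2 + 4 * M ^ 2 * Sb / N ^ 3) + m ^ 2 / (a * N * s))) := by
  have hpp := PP_prob h N
  have hN' : (0 : ℝ) < N := by exact_mod_cast hN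
  have ha := h.apos
  have hSi := Sfr_int h hm hS
  have h1τ : 0 < 1 - 4 * τ := by linarith
  have hrm : Measurable (fun q : ((Fin N → E2) × (Fin N → E2)) × E2 => rb m R q.2) := (rb_meas m h).comp measurable_snd
  have hM0 : 0 ≤ M := (norm_nonneg _).trans (hM 0 (fun i => by simp) 0)
  have A1 := fub h (f := fun p z => ‖ZN m δ R p.1 z‖ ^ 2 / rb m R z) (((ZNp1 h).norm.pow_const 2).div hrm)
    (K := (2 * M) ^ 2 / a) (fun p h1 _ z hz => by
      have hr := rb_lb hm h hz
      have := ZN_bound h hM hN h1 z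
      rw [abs_of_nonneg (div_nonneg (sq_nonneg _) (ha.le.trans hr))]
      gcongr) (g := fun z => 1 / N * (Sf m δ R z / rb m R z)) (hSi.const_mul _) (fun z hz => by
      have hr := ha.trans_le (rb_lb hm h hz)
      rw [integral_div, PP_fst h fun x => ‖ZN m δ R x z‖ ^ 2]
      calc _ ≤ Sf m δ R z / N / rb m R z := by
            have := ZN_two h hM hN z
            gcongr
        _ = _ := by ring)
  have A2 := fub h (f := fun p z => ‖ZN m δ R p.2 z‖ ^ 2 / rb m R z) (((ZNp2 h).norm.pow_const 2).div hrm)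
    (K := (2 * M) ^ 2 / a) (fun p _ h1 z hz => by
      have hr := rb_lb hm h hz
      have := ZN_bound h hM hN h1 z
      rw [abs_of_nonneg (div_nonneg (sq_nonneg _) (ha.le.trans hr))]
      gcongr) (g := fun z => 1 / N * (Sf m δ R z / rb m R z)) (hSi.const_mul _) (fun z hz => by
      have hr := ha.trans_le (rb_lb hm h hz)
      rw [integral_div, PP_snd h fun x => ‖ZN m δ R x z‖ ^ 2]
      calc _ ≤ Sf m δ R z / N / rb m R z := by
            have := ZN_two h hM hN z
            gcongr
        _ = _ := by ring)
  have hh1 : Measurable (fun q : ((Fin N → E2) × (Fin N → E2)) × E2 => hist m q.1.1 q.2) := by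
    have t1 : Measurable fun q : ((Fin N → E2) × (Fin N → E2)) × E2 => (q.1.1, q.2) := by fun_prop
    have t2 := (hist_meas (m := m) (N := N)).comp t1
    exact t2
  have hh2 : Measurable (fun q : ((Fin N → E2) × (Fin N → E2)) × E2 => hist m q.1.2 q.2) := by
    have t1 : Measurable fun q : ((Fin N → E2) × (Fin N → E2)) × E2 => (q.1.2, q.2) := by fun_prop
    have t2 := (hist_meas (m := m) (N := N)).comp t1
    exact t2
  set E0 := 1 / (η * a) * (64 * s * (3 * Sb ^ 2 / N ^ 2 + 4 * M ^ 2 * Sb / N ^ 3) + m ^ 2 / (a * N * s)) with hE0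
  have hgi : Integrable (fun z => 2 / N * (Sf m δ R z / rb m R z) + E0) lam := (hSi.const_mul _).add (integrable_const _)
  have mHC : Measurable (Function.uncurry (fun (p : (Fin N → E2) × (Fin N → E2)) z =>
      HC η (hist m p.1) (hist m p.2) (rb m R) (fun z => ZN m δ R p.1 z - ZN m δ R p.2 z) z)) := by
    have q1 := (((ZNp1 (m := m) (δ := δ) (N := N) h).sub (ZNp2 (m := m) (δ := δ) h)).norm.pow_const 2).div hrm
    have q2 := ((hh1.div hrm).sub_const 1).abs
    have q3 := ((hh2.div hrm).sub_const 1).abs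
    have q4 := q1.mul (((q2.add q3).const_mul (1 / η)).const_add 1)
    exact q4
  have A3 := fub h mHC
    (K := (4 * M) ^ 2 / a * (1 + 1 / η * ((m ^ 2 / a + 1) + (m ^ 2 / a + 1)))) (fun p h1 h2 z hz => by
      have hr := rb_lb hm h hz
      have hr0 := ha.trans_le hr
      have b1 := ZN_bound h hM hN h1 z
      have b2 := ZN_bound h hM hN h2 z
      have b3 : ‖ZN m δ R p.1 z - ZN m δ R p.2 z‖ ≤ 4 * M := (norm_sub_le _ _).trans (by linarith)
      have b4 := hist_u h hm hN p.1 hz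
      have b5 := hist_u h hm hN p.2 hz
      unfold HC
      rw [abs_of_nonneg (by positivity)]
      gcongr) hgi (fun z hz => HC_exp h hm hM hN hη hs hS hz)
  have B1 : Integrable (fun p => 4 * η / τ * (∫ z, ‖ZN m δ R p.1 z‖ ^ 2 / rb m R z ∂lam +
    ∫ z, ‖ZN m δ R p.2 z‖ ^ 2 / rb m R z ∂lam)) (PP R N) := (A1.1.add A2.1).const_mul _
  have B2 : Integrable (fun p => 8 / (τ * m ^ 2) + 4 * η / τ * (∫ z, ‖ZN m δ R p.1 z‖ ^ 2 / rb m R z ∂lam +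
    ∫ z, ‖ZN m δ R p.2 z‖ ^ 2 / rb m R z ∂lam)) (PP R N) := (integrable_const _).add B1
  have B3 := A3.1.const_mul (1 / (1 - 4 * τ))
  have B4 : Integrable (fun p => 8 / (τ * m ^ 2) + 4 * η / τ * (∫ z, ‖ZN m δ R p.1 z‖ ^ 2 / rb m R z ∂lam +
    ∫ z, ‖ZN m δ R p.2 z‖ ^ 2 / rb m R z ∂lam) + (1 / (1 - 4 * τ)) *
      ∫ z, HC η (hist m p.1) (hist m p.2) (rb m R) (fun z => ZN m δ R p.1 z - ZN m δ R p.2 z) z ∂lam) (PP R N) := B2.add B3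
  refine (integral_mono_of_nonneg (Eventually.of_forall fun p => W2sq_nonneg _ _) B4 ((PP_ae h N).mono fun p hp =>
    det_bound h hm hδ hM hN hp.1 hp.2 hη hη1 hτ hτ1)).trans ?_
  rw [integral_add B2 B3, integral_add (integrable_const _) B1, integral_const_mul, integral_const_mul,
    integral_add A1.1 A2.1]
  have a1 := A1.2
  have a2 := A2.2
  have a3 := A3.2
  rw [integral_add (hSi.const_mul _) (integrable_const _), integral_const_mul] at a3
  rw [integral_const_mul] at a1 a2
  simp only [integral_const, probReal_univ, smul_eq_mul, one_mul] at a3 ⊢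
  have c1 : 1 / (N : ℝ) * ∫ z, Sf m δ R z / rb m R z ∂lam ≤ Sg / N := by
    rw [one_div_mul_eq_div]; gcongr
  have c2 : 2 / (N : ℝ) * ∫ z, Sf m δ R z / rb m R z ∂lam ≤ 2 / N * Sg := by gcongr
  have d1 : 8 * η / τ * (Sg / N) = 4 * η / τ * (Sg / N + Sg / N) := by ring
  rw [d1]
  have d2 := a3.trans (add_le_add_left c2 E0)
  have d3 := a1.trans c1
  have d4 := a2.trans c1
  gcongr
end

theorem volume_unitSq : volume unitSq = 1 := by
  have hms : MeasurableSet unitSq := by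
    unfold unitSq
    rw [Set.ofPred_forall]
    exact MeasurableSet.iInter fun i => (by fun_prop : Measurable fun x : E2 => x i) measurableSet_Icc
  have h := (EuclideanSpace.volume_preserving_symm_measurableEquiv_toLp (Fin 2)).symm.measure_preimage
    (s := unitSq) hms.nullMeasurableSet
  rw [← h]
  have e : (⇑(MeasurableEquiv.toLp 2 (Fin 2 → ℝ)).symm.symm ⁻¹' unitSq) = Set.Icc (fun _ => 0) (fun _ => 1) := by
    ext x
    simp only [unitSq, Set.mem_preimage, Set.mem_ofPred_eq, Set.mem_Icc, Pi.le_def]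
    exact forall_and
  rw [e, Real.volume_Icc_pi]
  simp

theorem restrict_unitSq : volume.restrict unitSq = lam := by
  unfold lam
  refine Measure.restrict_congr_set (ae_eq_of_subset_of_measure_ge sq_subset ?_ measurableSet_sq.nullMeasurableSet ?_).symm
  · rw [volume_unitSq, volume_sq]
  · rw [volume_unitSq]; simp

theorem setup (ρ : E2 → ℝ) (a : ℝ) (ha : 0 < a) (hlip : ∃ K : ℝ≥0, LipschitzOnWith K ρ unitSq)
    (hpos : ∀ x ∈ unitSq, a ≤ ρ x) (hint : ∫ x in unitSq, ρ x = 1) :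
    ∃ (R : E2 → ℝ) (B : ℝ) (k : ℝ≥0), Den R a B k ∧
      (volume.restrict unitSq).withDensity (fun x => ENNReal.ofReal (ρ x)) = muR R := by
  obtain ⟨K, hK⟩ := hlip
  obtain ⟨g, hg, hgeq⟩ := hK.extend_real
  obtain ⟨B, hB⟩ := (isCompact_closedBall (0 : E2) 2).exists_bound_of_continuousOn hg.continuous.continuousOn
  have heq : ∀ x ∈ Qs, min (max (g x) a) B = ρ x := by
    intro x hx
    have h1 := hgeq (sq_subset hx)
    have h2 := hpos x (sq_subset hx)
    have h3 := hB x (by simpa using sq_norm (sq_subset hx))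
    rw [← h1, max_eq_left h2, min_eq_left]
    rw [h1]
    exact (le_abs_self _).trans h3
  have haB : a ≤ B := by
    have h0 : (0 : E2) ∈ Qs := fun i => by simp
    have h1 := hgeq (sq_subset h0)
    have h2 := hpos 0 (sq_subset h0)
    have h3 := hB 0 (by simp)
    rw [h1] at h2
    exact h2.trans ((le_abs_self _).trans h3)
  refine ⟨fun x => min (max (g x) a) B, B, K, ⟨(hg.max_const a).min_const B, ha, fun x => le_min (le_max_right _ _) haB,
    fun x => min_le_right _ _, ?_⟩, ?_⟩
  · rw [restrict_unitSq] at hint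
    rw [← hint]
    exact integral_congr_ae (ae_lam.mono heq)
  · rw [restrict_unitSq]
    unfold muR
    refine withDensity_congr_ae (ae_lam.mono fun x hx => ?_)
    simp only [heq x hx]

/-- the normalized bound as a function of `log N` -/
def GG (a τ η θ c C L : ℝ) : ℝ :=
  16 * Real.pi / (τ * θ ^ 2) * (1 / L) + 16 * Real.pi * η / τ * (c / 2 + C * (1 / L)) +
    1 / (1 - 4 * τ) * (2 * Real.pi * c + 4 * Real.pi * C * (1 / L) +
      2 * Real.pi / (η * a) * (64 * θ * (3 * C ^ 2 + 16 * C ^ 3 * θ ^ 2 * (1 / L)) + 4 * θ / a))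

theorem asm {a τ η θ c C L N m : ℝ} (ha : 0 < a) (hτ : 0 < τ) (hτ1 : 4 * τ < 1) (hη : 0 < η) (hθ : 0 < θ)
    (hC : 0 < C) (hL : 0 < L) (hN : 0 < N) (hm : 0 < m) (h1 : θ ^ 2 * N ≤ m ^ 2) (h2 : m ^ 2 ≤ 4 * θ ^ 2 * N) :
    2 * Real.pi * N / L * (8 / (τ * m ^ 2) + 8 * η / τ * ((c * (L / 2) + C) / N) +
      (1 / (1 - 4 * τ)) * (2 / N * (c * (L / 2) + C) +
        1 / (η * a) * (64 * (θ * N / L) * (3 * (C * L) ^ 2 / N ^ 2 + 4 * (C * m) ^ 2 * (C * L) / N ^ 3) +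
          m ^ 2 / (a * N * (θ * N / L))))) ≤ GG a τ η θ c C L := by
  have hpi := Real.pi_pos
  have h1τ : 0 < 1 - 4 * τ := by linarith
  have k1 : 8 / (τ * m ^ 2) ≤ 8 / (τ * (θ ^ 2 * N)) := by gcongr
  have k2 : 4 * (C * m) ^ 2 * (C * L) / N ^ 3 ≤ 4 * (C ^ 2 * (4 * θ ^ 2 * N)) * (C * L) / N ^ 3 := by
    rw [mul_pow]; gcongr
  have k3 : m ^ 2 / (a * N * (θ * N / L)) ≤ 4 * θ ^ 2 * N / (a * N * (θ * N / L)) := by gcongr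
  calc _ ≤ 2 * Real.pi * N / L * (8 / (τ * (θ ^ 2 * N)) + 8 * η / τ * ((c * (L / 2) + C) / N) +
      (1 / (1 - 4 * τ)) * (2 / N * (c * (L / 2) + C) +
        1 / (η * a) * (64 * (θ * N / L) * (3 * (C * L) ^ 2 / N ^ 2 + 4 * (C ^ 2 * (4 * θ ^ 2 * N)) * (C * L) / N ^ 3) +
          4 * θ ^ 2 * N / (a * N * (θ * N / L))))) := by gcongr
    _ = _ := by
      unfold GG
      field_simp
      ring

theorem GG_tendsto (a τ η θ c C : ℝ) : Tendsto (fun L => GG a τ η θ c C L) atTop (𝓝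
    (8 * Real.pi * c / τ * η + 1 / (1 - 4 * τ) * (2 * Real.pi * c +
      2 * Real.pi / (η * a) * (192 * C ^ 2 + 4 / a) * θ))) := by
  have h : Tendsto (fun L : ℝ => 1 / L) atTop (𝓝 0) := by simpa using tendsto_inv_atTop_zero
  have h2 : Continuous (fun t : ℝ => 16 * Real.pi / (τ * θ ^ 2) * t + 16 * Real.pi * η / τ * (c / 2 + C * t) +
    1 / (1 - 4 * τ) * (2 * Real.pi * c + 4 * Real.pi * C * t +
      2 * Real.pi / (η * a) * (64 * θ * (3 * C ^ 2 + 16 * C ^ 3 * θ ^ 2 * t) + 4 * θ / a))) := by fun_prop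
  have h3 := (h2.tendsto 0).comp h
  unfold GG
  refine h3.congr' ?_ |>.trans (le_of_eq ?_)
  · exact Eventually.of_forall fun L => rfl
  · congr 1; ring

theorem pos_choice {f : ℝ → ℝ} (hf : ContinuousAt f 0) {b : ℝ} (h0 : f 0 < b) {u : ℝ} (hu : 0 < u) :
    ∃ t, 0 < t ∧ t < u ∧ f t < b := by
  have h1 : ∀ᶠ t in 𝓝[>] (0 : ℝ), f t < b := (hf.eventually (gt_mem_nhds h0)).filter_mono nhdsWithin_le_nhds
  have h2 : ∀ᶠ t in 𝓝[>] (0 : ℝ), t ∈ Set.Ioo 0 u := Ioo_mem_nhdsGT hu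
  obtain ⟨t, h3, h4⟩ := (h1.and h2).exists
  exact ⟨t, h4.1, h4.2, h3⟩

theorem main_ev {R : E2 → ℝ} {a B : ℝ} {k : ℝ≥0} (h : Den R a B k) {ε : ℝ} (hε : 0 < ε) :
    ∀ᶠ N : ℕ in atTop, 2 * Real.pi * N / Real.log N * ∫ p, W2sq (empMeas p.1) (empMeas p.2) ∂(PP R N) ≤ 1 + ε := by
  have ha := h.apos
  have hpi := Real.pi_pos
  obtain ⟨τ, hτ, hτ1, hτ2⟩ := pos_choice (f := fun τ => 1 / (1 - 4 * τ)) (b := 1 + ε)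
    (ContinuousAt.div continuousAt_const (by fun_prop) (by norm_num)) (by simpa using hε) (u := 1 / 4) (by norm_num)
  have hτ3 : 4 * τ < 1 := by linarith
  obtain ⟨e, he, -, he2⟩ := pos_choice (f := fun e => 1 / (1 - 4 * τ) * (2 * Real.pi * (1 / (2 * Real.pi) + e)))
    (b := 1 + ε) (by fun_prop) (by
      have : 2 * Real.pi * (1 / (2 * Real.pi) + 0) = 1 := by field_simp; simp
      simp only [this, mul_one]; exact hτ2) (u := 1) (by norm_num)
  obtain ⟨δ, hδ, C, hC, hf⟩ := fields h he
  set c := 1 / (2 * Real.pi) + e with hc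
  have hc0 : 0 < c := by positivity
  obtain ⟨η, hη, hη1, hη2⟩ := pos_choice (f := fun η => 8 * Real.pi * c / τ * η + 1 / (1 - 4 * τ) * (2 * Real.pi * c))
    (b := 1 + ε) (by fun_prop) (by simpa using he2) (u := 1) (by norm_num)
  obtain ⟨θ, hθ, hθ1, hθ2⟩ := pos_choice (f := fun θ => 8 * Real.pi * c / τ * η + 1 / (1 - 4 * τ) * (2 * Real.pi * c +
      2 * Real.pi / (η * a) * (192 * C ^ 2 + 4 / a) * θ))
    (b := 1 + ε) (by fun_prop) (by simpa using hη2) (u := 1 / 2) (by norm_num)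
  have hlogt : Tendsto (fun N : ℕ => Real.log N) atTop atTop := Real.tendsto_log_atTop.comp tendsto_natCast_atTop_atTop
  have hsq : Tendsto (fun N : ℕ => θ * Real.sqrt N) atTop atTop :=
    (Real.tendsto_sqrt_atTop.comp tendsto_natCast_atTop_atTop).const_mul_atTop hθ
  have hmt : Tendsto (fun N : ℕ => ⌈θ * Real.sqrt N⌉₊) atTop atTop := tendsto_nat_ceil_atTop.comp hsq
  have ev1 : ∀ᶠ N : ℕ in atTop, GG a τ η θ c C (Real.log N) < 1 + ε :=
    hlogt.eventually ((GG_tendsto a τ η θ c C).eventually (gt_mem_nhds hθ2))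
  filter_upwards [ev1, hmt.eventually hf, hlogt.eventually_ge_atTop 2, hsq.eventually_ge_atTop 1, eventually_gt_atTop 0]
    with N g1 g2 g3 g4 hN
  obtain ⟨hm, hM, hS, hSg⟩ := g2
  set m := ⌈θ * Real.sqrt N⌉₊ with hmdef
  set L := Real.log N with hL
  have hN' : (0 : ℝ) < N := by exact_mod_cast hN
  have hm' : (0 : ℝ) < m := by exact_mod_cast hm
  have hsN : Real.sqrt N ^ 2 = N := Real.sq_sqrt hN'.le
  have hs0 : 0 ≤ Real.sqrt N := Real.sqrt_nonneg _
  have m1 : θ * Real.sqrt N ≤ m := Nat.le_ceil _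
  have m2 : (m : ℝ) ≤ 2 * (θ * Real.sqrt N) := by
    have := (Nat.ceil_lt_add_one (by positivity : 0 ≤ θ * Real.sqrt N)).le
    linarith
  have m3 : (m : ℝ) ≤ Real.sqrt N := by nlinarith
  have q1 : θ ^ 2 * N ≤ (m : ℝ) ^ 2 := by
    rw [← hsN, ← mul_pow]; gcongr
  have q2 : (m : ℝ) ^ 2 ≤ 4 * θ ^ 2 * N := by
    have : (m : ℝ) ^ 2 ≤ (2 * (θ * Real.sqrt N)) ^ 2 := by gcongr
    calc _ ≤ _ := this
      _ = 4 * θ ^ 2 * Real.sqrt N ^ 2 := by ring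
      _ = _ := by rw [hsN]
  have hlm : Real.log m ≤ L / 2 := by
    have := Real.log_le_log hm' m3
    rwa [Real.log_sqrt hN'.le] at this
  have hL0 : 0 < L := by linarith
  have hS' : ∀ z ∈ Qs, Sf m δ R z ≤ C * L := fun z hz => (hS z hz).trans (by
    have : Real.log m + 1 ≤ L := by linarith
    gcongr)
  have hSg' : ∫ z, Sf m δ R z / rb m R z ∂lam ≤ c * (L / 2) + C := hSg.trans (by gcongr)
  have hb := exp_bound h hm hδ hM hN hη hη1.le hτ hτ3 (s := θ * N / L) (by positivity) hS' hSg'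
  refine le_trans ?_ g1.le
  refine le_trans (mul_le_mul_of_nonneg_left hb (by positivity)) ?_
  exact asm ha hτ hτ3 hη hθ hC hL0 hN' hm' q1 q2

/-- limsup_{N→∞} (2πN / log N) · E_μ[W₂²(X^N, Y^N)] ≤ 1, for two independent
empirical measures of `N` points each, sampled from the measure `μ` with
Lipschitz, strictly positive density `ρ` on the unit square. -/
theorem bipartite_wasserstein_upper_bound
    (ρ : E2 → ℝ) (a : ℝ) (ha : 0 < a)
    (hlip : ∃ K : ℝ≥0, LipschitzOnWith K ρ unitSq)
    (hpos : ∀ x ∈ unitSq, a ≤ ρ x)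
    (hint : ∫ x in unitSq, ρ x = 1)
    (μ : Measure E2)
    (hμ : μ = (volume.restrict unitSq).withDensity fun x => ENNReal.ofReal (ρ x))
    (hprob : IsProbabilityMeasure μ) :
    limsup (fun N : ℕ =>
        (2 * Real.pi * N / Real.log N) *
          ∫ p : (Fin N → E2) × (Fin N → E2), W2sq (empMeas p.1) (empMeas p.2)
            ∂((Measure.pi fun _ => μ).prod (Measure.pi fun _ => μ)))
      atTop ≤ 1 := by
  obtain ⟨R, B, k, h, hR⟩ := setup ρ a ha hlip hpos hint
  rw [hR] at hμ
  subst hμ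
  refine le_of_forall_pos_le_add fun ε hε => ?_
  refine limsup_le_of_le ?_ (main_ev h hε)
  refine IsBoundedUnder.isCoboundedUnder_le (isBoundedUnder_of ⟨0, fun N => ?_⟩)
  have := Real.log_natCast_nonneg N
  have h2 : 0 ≤ ∫ p : (Fin N → E2) × (Fin N → E2), W2sq (empMeas p.1) (empMeas p.2)
            ∂((Measure.pi fun _ => muR R).prod (Measure.pi fun _ => muR R)) := integral_nonneg fun p => W2sq_nonneg _ _
  have hpi := Real.pi_pos
  exact mul_nonneg (by positivity) h2
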